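/- Assume GRH for L(s,χ), χ primitive mod q > 1. Let t ≥ 2, 4 ≤ x ≤ t², σ₁ = 1/2 + 1/log x, and set M₁ = ∫_{σ₁}^{∞} (L'/L)(σ+it,χ) dσ. Then M₁ = -∑_{n<x²} Λ_x(n)χ(n)/(n^{σ₁+it} log n) + η₁(t) with |η₁(t)| ≤ [(1/e + 1/(2e²))/(1 - (1/e)(1+1/e))]·(1/2)·(log(q(t+1))/log x) + O((1/log x)·|∑_{n<x²} Λ_x(n)χ(n) n^{-(σ₁+it)}|), the implied constant being absolute. -/

import Mathlib

open Complex Real ArithmeticFunction MeasureTheory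

/-- The generalized Riemann hypothesis for the Dirichlet L-function of `χ`. -/
def GRH {q : ℕ} [NeZero q] (χ : DirichletCharacter ℂ q) : Prop :=
  ∀ ρ : ℂ, DirichletCharacter.LFunction χ ρ = 0 → 0 < ρ.re → ρ.re < 1 → ρ.re = 1 / 2

/-- Selberg's truncated von Mangoldt function `Λ_x`. -/
noncomputable def Lambdax (x : ℝ) (n : ℕ) : ℝ :=
  if (n : ℝ) ≤ x then vonMangoldt n
  else if (n : ℝ) ≤ x ^ 2 then vonMangoldt n * (Real.log (x ^ 2 / n) / Real.log x)
  else 0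

/-- The Dirichlet polynomial `∑_{n<x²} Λ_x(n) χ(n) n^{-s}`. -/
noncomputable def Dpoly {q : ℕ} (χ : DirichletCharacter ℂ q) (x : ℝ) (s : ℂ) : ℂ :=
  ∑ n ∈ Finset.filter (fun n : ℕ => (n : ℝ) < x ^ 2) (Finset.range (⌈x ^ 2⌉₊ + 1)),
    (Lambdax x n : ℂ) * χ n / (n : ℂ) ^ s

lemma integrable_one_add_abs_rpow : Integrable fun u : ℝ => (1 + |u|) ^ (-(3 / 2 : ℝ)) := by
  have := integrable_one_add_norm (E := ℝ) (μ := volume) (r := 3 / 2) (by norm_num)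
  simpa using this

lemma one_add_norm_rpow_le (b u : ℝ) :
    (1 + ‖(b : ℂ) + u * I‖) ^ (-(3 / 2 : ℝ)) ≤ (1 + |u|) ^ (-(3 / 2 : ℝ)) := by
  apply Real.rpow_le_rpow_of_nonpos (by positivity) _ (by norm_num)
  have := Complex.abs_im_le_norm ((b : ℂ) + u * I)
  simp at this
  linarith

lemma tendsto_one_add_rpow_atTop :
    Filter.Tendsto (fun T : ℝ => (1 + T) ^ (-(3 / 2 : ℝ))) Filter.atTop (nhds 0) :=
  (tendsto_rpow_neg_atTop (by norm_num : (0 : ℝ) < 3 / 2)).comp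
    (Filter.tendsto_atTop_add_const_left _ _ Filter.tendsto_id)

lemma integrable_vertical {F : ℂ → ℂ} {b C : ℝ}
    (hF : ContinuousOn F {w | w.re = b})
    (hC : ∀ w : ℂ, w.re = b → ‖F w‖ ≤ C * (1 + ‖w‖) ^ (-(3 / 2 : ℝ))) :
    Integrable fun u : ℝ => F (b + u * I) := by
  have hcont : Continuous fun u : ℝ => F (b + u * I) :=
    hF.comp_continuous (by fun_prop) (fun u => by simp)
  refine (integrable_one_add_abs_rpow.const_mul |C|).mono' hcont.aestronglyMeasurable
    (Filter.Eventually.of_forall fun u => ?_)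
  refine (hC _ (by simp)).trans ?_
  exact mul_le_mul (le_abs_self C) (one_add_norm_rpow_le b u) (by positivity) (abs_nonneg C)

/-- Shifting a vertical line of integration. -/
lemma integral_vertical_shift {F : ℂ → ℂ} {b c C : ℝ} (hbc : b ≤ c)
    (hF : DifferentiableOn ℂ F {w | b ≤ w.re ∧ w.re ≤ c})
    (hC : ∀ w : ℂ, b ≤ w.re → w.re ≤ c → ‖F w‖ ≤ C * (1 + ‖w‖) ^ (-(3 / 2 : ℝ))) :
    ∫ u : ℝ, F (b + u * I) = ∫ u : ℝ, F (c + u * I) := by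
  have h1 : Integrable fun u : ℝ => F (b + u * I) :=
    integrable_vertical (hF.continuousOn.mono fun w hw => ⟨hw.ge, hw.le.trans hbc⟩)
      fun w hw => hC w hw.ge (hw.le.trans hbc)
  have h2 : Integrable fun u : ℝ => F (c + u * I) :=
    integrable_vertical (hF.continuousOn.mono fun w hw => ⟨hbc.trans hw.ge, hw.le⟩)
      fun w hw => hC w (hbc.trans hw.ge) hw.le
  have l1 := intervalIntegral_tendsto_integral h1 Filter.tendsto_neg_atTop_atBot
    Filter.tendsto_id
  have l2 := intervalIntegral_tendsto_integral h2 Filter.tendsto_neg_atTop_atBot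
    Filter.tendsto_id
  have l3 := l2.sub l1
  have hor : ∀ T y : ℝ, 0 < T → |y| = T → ‖∫ x in b..c, F (x + y * I)‖
      ≤ |C| * (1 + T) ^ (-(3 / 2 : ℝ)) * |c - b| := by
    intro T y hT hy
    apply intervalIntegral.norm_integral_le_of_norm_le_const
    intro x hx
    rw [Set.uIoc_of_le hbc] at hx
    refine (hC _ (by simpa using hx.1.le) (by simpa using hx.2)).trans ?_
    exact mul_le_mul (le_abs_self C) (hy ▸ one_add_norm_rpow_le x y) (by positivity)
      (abs_nonneg C)
  have key : ∀ᶠ T : ℝ in Filter.atTop,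
      ‖(∫ u in (-T)..T, F (c + u * I)) - ∫ u in (-T)..T, F (b + u * I)‖
      ≤ |C| * (1 + T) ^ (-(3 / 2 : ℝ)) * |c - b| + |C| * (1 + T) ^ (-(3 / 2 : ℝ)) * |c - b| := by
    filter_upwards [Filter.eventually_gt_atTop 0] with T hT
    have h := Complex.integral_boundary_rect_eq_zero_of_differentiableOn F
      (b + (-T : ℝ) * I) (c + (T : ℝ) * I) (hF.mono ?_)
    · simp only [add_re, ofReal_re, mul_re, I_re, mul_zero, ofReal_im, I_im, mul_one, sub_self,
        add_zero, add_im, mul_im, zero_add, smul_eq_mul] at h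
      have h' : (∫ u in (-T)..T, F (c + u * I)) - ∫ u in (-T)..T, F (b + u * I)
          = I * ((∫ x in b..c, F (x + (-T : ℝ) * I)) - ∫ x in b..c, F (x + (T : ℝ) * I)) := by
        linear_combination (-I) * h +
          ((∫ u in (-T)..T, F (c + u * I)) - ∫ u in (-T)..T, F (b + u * I)) * I_mul_I
      rw [h', norm_mul, norm_I, one_mul]
      refine (norm_sub_le _ _).trans (add_le_add ?_ ?_)
      · exact hor T (-T) hT (by simp [abs_of_pos hT])
      · exact hor T T hT (abs_of_pos hT)
    · intro w hw
      have := hw.1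
      simp [Set.uIcc_of_le hbc] at this
      exact this
  have l4 : Filter.Tendsto (fun T : ℝ => |C| * (1 + T) ^ (-(3 / 2 : ℝ)) * |c - b| +
      |C| * (1 + T) ^ (-(3 / 2 : ℝ)) * |c - b|) Filter.atTop (nhds 0) := by
    have := ((tendsto_one_add_rpow_atTop.const_mul |C|).mul_const |c - b|)
    simpa using this.add this
  have l5 := squeeze_zero_norm' key l4
  have := tendsto_nhds_unique l3 l5
  exact (sub_eq_zero.mp this).symm

/-- Closing the contour to the right. -/
lemma integral_vertical_eq_zero {F : ℂ → ℂ} {b C : ℝ}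
    (hF : DifferentiableOn ℂ F {w | b ≤ w.re})
    (hC : ∀ w : ℂ, b ≤ w.re → ‖F w‖ ≤ C * (1 + ‖w‖) ^ (-(3 / 2 : ℝ))) :
    ∫ u : ℝ, F (b + u * I) = 0 := by
  have h1 : Filter.Tendsto (fun c : ℝ => ∫ u : ℝ, F (c + u * I)) Filter.atTop
      (nhds (∫ _ : ℝ, (0 : ℂ))) := by
    apply tendsto_integral_filter_of_dominated_convergence
      (fun u => |C| * (1 + |u|) ^ (-(3 / 2 : ℝ)))
    · filter_upwards [Filter.eventually_ge_atTop b] with c hc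
      exact (integrable_vertical (hF.continuousOn.mono fun w hw => hc.trans (Eq.ge hw))
        fun w hw => hC w (hc.trans hw.ge)).aestronglyMeasurable
    · filter_upwards [Filter.eventually_ge_atTop b] with c hc
      refine Filter.Eventually.of_forall fun u => ?_
      refine (hC _ (by simpa using hc)).trans ?_
      exact mul_le_mul (le_abs_self C) (one_add_norm_rpow_le c u) (by positivity) (abs_nonneg C)
    · exact integrable_one_add_abs_rpow.const_mul |C|
    · refine Filter.Eventually.of_forall fun u => ?_
      have l := tendsto_one_add_rpow_atTop.const_mul |C|
      rw [mul_zero] at l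
      refine squeeze_zero_norm' ?_ l
      filter_upwards [Filter.eventually_ge_atTop b, Filter.eventually_gt_atTop 0] with c hc hc0
      refine (hC _ (by simpa using hc)).trans ?_
      refine mul_le_mul (le_abs_self C) ?_ (by positivity) (abs_nonneg C)
      · apply Real.rpow_le_rpow_of_nonpos (by positivity) _ (by norm_num)
        have := Complex.re_le_norm ((c : ℂ) + u * I)
        simp at this
        linarith
  have h2 : ∀ᶠ c : ℝ in Filter.atTop, (∫ u : ℝ, F (b + u * I)) = ∫ u : ℝ, F (c + u * I) := by
    filter_upwards [Filter.eventually_ge_atTop b] with c hc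
    exact integral_vertical_shift hc (hF.mono fun w hw => hw.1) fun w hw _ => hC w hw
  simp only [integral_zero] at h1
  exact tendsto_nhds_unique (tendsto_const_nhds.congr' h2) h1

lemma integrable_inv_sq_vertical {c : ℝ} (hc : c ≠ 0) :
    Integrable fun u : ℝ => (((c : ℂ) + u * I) ^ 2)⁻¹ := by
  have h0 : ∀ u : ℝ, (c : ℂ) + u * I ≠ 0 := fun u h => hc (by simpa using congrArg re h)
  have hcont : Continuous fun u : ℝ => (((c : ℂ) + u * I) ^ 2)⁻¹ :=
    Continuous.inv₀ (by fun_prop) fun u => pow_ne_zero 2 (h0 u)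
  have h1 : Integrable fun u : ℝ => (c ^ 2)⁻¹ * (1 + (u / c) ^ 2)⁻¹ :=
    (integrable_inv_one_add_sq.comp_div hc).const_mul _
  refine h1.mono' hcont.aestronglyMeasurable (Filter.Eventually.of_forall fun u => ?_)
  rw [norm_inv, norm_pow, ← Complex.normSq_eq_norm_sq, ← mul_inv]
  apply le_of_eq
  simp [Complex.normSq_apply]
  field_simp

lemma integrableOn_mul_exp_neg {c : ℝ} (hc : 0 < c) :
    IntegrableOn (fun y : ℝ => y * Real.exp (-c * y)) (Set.Ioi 0) := by
  have h1 : IntegrableOn (fun y : ℝ => y ^ (1 : ℝ) * Real.exp (-c * y ^ (1 : ℝ)))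
      (Set.Ioi 0) := integrableOn_rpow_mul_exp_neg_mul_rpow (by norm_num) one_pos hc
  simpa using h1

lemma integral_mul_cexp_neg_Ioi {a : ℂ} (ha : 0 < a.re) :
    ∫ y in Set.Ioi (0 : ℝ), (y : ℂ) * cexp (-a * y) = (a ^ 2)⁻¹ := by
  have ha0 : a ≠ 0 := fun h => by simp [h] at ha
  have hd : ∀ y : ℝ, HasDerivAt (fun y : ℝ => -((y : ℂ) / a + 1 / a ^ 2) * cexp (-a * y))
      ((y : ℂ) * cexp (-a * y)) y := by
    intro y
    have h1 : HasDerivAt (fun y : ℝ => (y : ℂ)) 1 y := ofRealCLM.hasDerivAt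
    have h2 := (((h1.div_const a).add_const (1 / a ^ 2)).neg).mul (h1.const_mul (-a)).cexp
    refine h2.congr_deriv ?_
    simp only [Pi.neg_apply]
    field_simp
    ring
  have hn : ∀ y : ℝ, ‖cexp (-a * y)‖ = Real.exp (-a.re * y) := fun y => by
    simp [Complex.norm_exp]
  have hi : IntegrableOn (fun y : ℝ => (y : ℂ) * cexp (-a * y)) (Set.Ioi 0) := by
    refine (integrableOn_mul_exp_neg ha).mono' (by fun_prop) ?_
    filter_upwards [ae_restrict_mem measurableSet_Ioi] with y hy
    rw [norm_mul, hn, norm_real, Real.norm_of_nonneg (le_of_lt hy)]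
  have ht : Filter.Tendsto (fun y : ℝ => -((y : ℂ) / a + 1 / a ^ 2) * cexp (-a * y))
      Filter.atTop (nhds 0) := by
    have e1 := Real.tendsto_pow_mul_exp_neg_atTop_nhds_zero 1
    have e2 := Real.tendsto_pow_mul_exp_neg_atTop_nhds_zero 0
    have hs : Filter.Tendsto (fun y : ℝ => a.re * y) Filter.atTop Filter.atTop :=
      Filter.tendsto_id.const_mul_atTop ha
    have e3 := ((e1.comp hs).const_mul (‖a‖⁻¹ / a.re)).add ((e2.comp hs).const_mul (‖a‖ ^ 2)⁻¹)
    simp only [mul_zero, add_zero] at e3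
    refine squeeze_zero_norm' ?_ e3
    filter_upwards [Filter.eventually_ge_atTop 0] with y hy
    rw [norm_mul, hn, norm_neg]
    have : ‖(y : ℂ) / a + 1 / a ^ 2‖ ≤ y * ‖a‖⁻¹ + (‖a‖ ^ 2)⁻¹ := by
      refine (norm_add_le _ _).trans (le_of_eq ?_)
      simp [abs_of_nonneg hy, div_eq_mul_inv]
    refine (mul_le_mul_of_nonneg_right this (Real.exp_nonneg _)).trans (le_of_eq ?_)
    simp only [Function.comp, pow_one, pow_zero, one_mul, neg_mul]
    field_simp
  have := integral_Ioi_of_hasDerivAt_of_tendsto (a := 0) (by fun_prop) (fun y _ => hd y) hi ht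
  rw [this]
  simp

/-- Perron's formula with the kernel `1 / v ^ 2`. -/
lemma perron_sq {c : ℝ} (hc : 0 < c) (lam : ℝ) :
    ∫ u : ℝ, cexp (lam * (c + u * I)) / ((c : ℂ) + u * I) ^ 2 = 2 * π * (max 0 lam : ℝ) := by
  set g : ℝ → ℂ := fun y => ((max 0 y * Real.exp (-c * y) : ℝ) : ℂ) with hg
  have hgc : Continuous g := by fun_prop
  have hgi : Integrable g := by
    have h1 := integrableOn_mul_exp_neg hc
    rw [← integrable_indicator_iff measurableSet_Ioi] at h1
    refine (h1.ofReal (𝕜 := ℂ)).congr (Filter.Eventually.of_forall fun y => ?_)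
    by_cases hy : 0 < y
    · simp [hg, Set.indicator_of_mem (Set.mem_Ioi.mpr hy), max_eq_right hy.le]
    · have : y ∉ Set.Ioi (0 : ℝ) := hy
      simp [hg, Set.indicator_of_notMem this, max_eq_left (not_lt.mp hy)]
  have hF : ∀ w : ℝ, FourierTransform.fourier g w = (((c : ℂ) + (2 * π * w : ℝ) * I) ^ 2)⁻¹ := by
    intro w
    rw [Real.fourier_real_eq_integral_exp_smul]
    have hre : 0 < ((c : ℂ) + (2 * π * w : ℝ) * I).re := by simpa using hc
    have h3 : ∫ v : ℝ, cexp ((-2 * π * v * w : ℝ) * I) • g v =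
        ∫ t in Set.Ioi (0 : ℝ), (t : ℂ) *
          cexp (-((c : ℂ) + (2 * π * w : ℝ) * I) * t) := by
      rw [← integral_indicator measurableSet_Ioi]
      congr 1
      ext v
      by_cases hv : 0 < v
      · rw [Set.indicator_of_mem (Set.mem_Ioi.mpr hv)]
        simp only [hg, max_eq_right hv.le, smul_eq_mul]
        push_cast
        rw [mul_left_comm, ← Complex.exp_add]
        ring_nf
      · have h : v ∉ Set.Ioi (0 : ℝ) := hv
        rw [Set.indicator_of_notMem h]
        simp [hg, max_eq_left (not_lt.mp hv)]
    rw [h3, integral_mul_cexp_neg_Ioi hre]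
  have hF' : FourierTransform.fourier g = fun w : ℝ => (((c : ℂ) + (2 * π * w : ℝ) * I) ^ 2)⁻¹ :=
    funext hF
  have hFi : Integrable (FourierTransform.fourier g) := by
    rw [hF']
    exact (integrable_inv_sq_vertical hc.ne').comp_mul_left' (by positivity)
  have h5 := congrFun (hgc.fourierInv_fourier_eq hgi hFi) lam
  rw [Real.fourierInv_eq', hF'] at h5
  have h6 := Measure.integral_comp_mul_left
    (fun u : ℝ => cexp (lam * (u * I)) * (((c : ℂ) + u * I) ^ 2)⁻¹) (2 * π)
  have h7 : ∫ x : ℝ, cexp (lam * ((2 * π * x : ℝ) * I)) * (((c : ℂ) + (2 * π * x : ℝ) * I) ^ 2)⁻¹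
      = g lam := by
    rw [← h5]
    congr 1
    ext v
    simp only [smul_eq_mul]
    congr 2
    simp
    ring
  rw [h7, abs_of_pos (by positivity)] at h6
  have h8 : ∫ u : ℝ, cexp (lam * (c + u * I)) / ((c : ℂ) + u * I) ^ 2 = cexp (lam * c) *
      ∫ u : ℝ, cexp (lam * (u * I)) * (((c : ℂ) + u * I) ^ 2)⁻¹ := by
    rw [← integral_const_mul]
    congr 1
    ext u
    rw [mul_add, Complex.exp_add]
    ring
  rw [h8]
  have h9 : ∫ u : ℝ, cexp (lam * (u * I)) * (((c : ℂ) + u * I) ^ 2)⁻¹ = 2 * π * g lam := by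
    rw [h6, Complex.real_smul]
    push_cast
    rw [← mul_assoc, mul_inv_cancel₀ (by simp [Real.pi_ne_zero]), one_mul]
  rw [h9]
  simp only [hg]
  push_cast
  have : cexp (-c * lam) = (cexp (lam * c))⁻¹ := by rw [← Complex.exp_neg]; ring_nf
  rw [this]
  field_simp

/-- Perron's formula with the kernel `1 / v ^ 2`, on a line to the left of the origin. -/
lemma perron_sq_neg {c : ℝ} (hc : c < 0) (lam : ℝ) :
    ∫ u : ℝ, cexp (lam * (c + u * I)) / ((c : ℂ) + u * I) ^ 2 = 2 * π * (max 0 (-lam) : ℝ) := by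
  have h := perron_sq (neg_pos.mpr hc) (-lam)
  rw [← integral_neg_eq_self] at h
  rw [← h]
  congr 1
  ext u
  push_cast
  congr 1
  · congr 1; ring
  · ring

/-- The kernel `(e ^ (l v) - e ^ (2 l v)) / v ^ 2` in Selberg's formula. -/
noncomputable def selbergKernel (l : ℝ) (v : ℂ) : ℂ :=
  (cexp (l * v) - cexp (2 * l * v)) / v ^ 2

lemma norm_selbergKernel_le {l : ℝ} (hl : 0 ≤ l) {v : ℂ} {r : ℝ} (hr : v.re ≤ r) :
    ‖selbergKernel l v‖ ≤ (Real.exp (l * r) + Real.exp (2 * l * r)) / ‖v‖ ^ 2 := by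
  rw [selbergKernel, norm_div, norm_pow]
  gcongr
  refine (norm_sub_le _ _).trans ?_
  have h2 : (2 * (l : ℂ) * v).re = 2 * l * v.re := by simp
  have h1 : ((l : ℂ) * v).re = l * v.re := by simp
  rw [Complex.norm_exp, Complex.norm_exp, h1, h2]
  gcongr

lemma conj_selbergKernel (l : ℝ) (v : ℂ) :
    (starRingEnd ℂ) (selbergKernel l v) = selbergKernel l ((starRingEnd ℂ) v) := by
  simp [selbergKernel, ← Complex.exp_conj, map_ofNat (starRingEnd ℂ) 2]

lemma integrable_exp_div_sq {c : ℝ} (hc : c ≠ 0) (lam : ℝ) :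
    Integrable fun u : ℝ => cexp (lam * (c + u * I)) / ((c : ℂ) + u * I) ^ 2 := by
  have h := integrable_inv_sq_vertical hc
  have h0 : ∀ u : ℝ, (c : ℂ) + u * I ≠ 0 := fun u h => hc (by simpa using congrArg re h)
  refine (h.norm.const_mul (Real.exp (lam * c))).mono' (Continuous.aestronglyMeasurable ?_) ?_
  · exact Continuous.div (by fun_prop) (by fun_prop) fun u => pow_ne_zero 2 (h0 u)
  · refine Filter.Eventually.of_forall fun u => ?_
    rw [norm_div, Complex.norm_exp, norm_inv, div_eq_mul_inv]
    simp

lemma exp_mul_selbergKernel (l lam : ℝ) (v : ℂ) :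
    cexp (-lam * v) * selbergKernel l v =
      cexp ((l - lam : ℝ) * v) / v ^ 2 - cexp ((2 * l - lam : ℝ) * v) / v ^ 2 := by
  rw [selbergKernel, ← sub_div, mul_div_assoc', mul_sub, ← Complex.exp_add, ← Complex.exp_add]
  push_cast
  ring_nf

lemma integral_selbergKernel_right {c : ℝ} (hc : 0 < c) (l lam : ℝ) :
    ∫ u : ℝ, cexp (-lam * (c + u * I)) * selbergKernel l (c + u * I) =
      2 * π * (max 0 (l - lam) - max 0 (2 * l - lam) : ℝ) := by
  simp only [exp_mul_selbergKernel]
  rw [integral_sub (integrable_exp_div_sq hc.ne' _) (integrable_exp_div_sq hc.ne' _),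
    perron_sq hc, perron_sq hc]
  push_cast
  ring

lemma integral_selbergKernel_left {c : ℝ} (hc : c < 0) (l lam : ℝ) :
    ∫ u : ℝ, cexp (-lam * (c + u * I)) * selbergKernel l (c + u * I) =
      2 * π * (max 0 (lam - l) - max 0 (lam - 2 * l) : ℝ) := by
  simp only [exp_mul_selbergKernel]
  rw [integral_sub (integrable_exp_div_sq hc.ne _) (integrable_exp_div_sq hc.ne _),
    perron_sq_neg hc, perron_sq_neg hc]
  push_cast
  ring_nf

lemma integrable_exp_mul_selbergKernel {c : ℝ} (hc : c ≠ 0) (l lam : ℝ) :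
    Integrable fun u : ℝ => cexp (-lam * (c + u * I)) * selbergKernel l (c + u * I) := by
  simp only [exp_mul_selbergKernel]
  exact (integrable_exp_div_sq hc _).sub (integrable_exp_div_sq hc _)

lemma vertical_sub (b u : ℝ) (s : ℂ) :
    (b : ℂ) + u * I - s = ((b - s.re : ℝ) : ℂ) + ((u - s.im : ℝ) : ℂ) * I := by
  apply Complex.ext <;> simp

lemma integral_exp_mul_selbergKernel_sub (b l lam : ℝ) (s : ℂ) :
    ∫ u : ℝ, cexp (-lam * (b + u * I - s)) * selbergKernel l (b + u * I - s) =
    ∫ u : ℝ, cexp (-lam * ((b - s.re : ℝ) + u * I)) * selbergKernel l ((b - s.re : ℝ) + u * I) := by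
  simp only [vertical_sub]
  exact integral_sub_right_eq_self (fun u : ℝ => cexp (-lam * ((b - s.re : ℝ) + u * I)) *
    selbergKernel l ((b - s.re : ℝ) + u * I)) s.im

lemma integrable_selbergKernel_sub {b : ℝ} {s : ℂ} (hb : b ≠ s.re) (l : ℝ) :
    Integrable fun u : ℝ => selbergKernel l (b + u * I - s) := by
  have h := (integrable_exp_mul_selbergKernel (sub_ne_zero.mpr hb) l 0).comp_sub_right s.im
  simp only [vertical_sub]
  simpa using h

lemma one_add_norm_le_of_dist {w s : ℂ} {d : ℝ} (hd : 0 < d) (h : d ≤ ‖w - s‖) :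
    1 + ‖w‖ ≤ ((1 + ‖s‖) / d + 1) * ‖w - s‖ := by
  have h1 : ‖w‖ ≤ ‖w - s‖ + ‖s‖ := by simpa using norm_add_le (w - s) s
  have h2 : 1 + ‖s‖ ≤ (1 + ‖s‖) / d * ‖w - s‖ := by
    rw [div_mul_eq_mul_div, le_div_iff₀ hd]
    gcongr
  linarith

lemma inv_norm_sq_le_of_dist {w s : ℂ} {d : ℝ} (hd : 0 < d) (h : d ≤ ‖w - s‖) :
    (‖w - s‖ ^ 2)⁻¹ ≤ ((1 + ‖s‖) / d + 1) ^ 2 * (1 + ‖w‖) ^ (-2 : ℝ) := by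
  have h1 := one_add_norm_le_of_dist hd h
  have h0 : 0 < ‖w - s‖ := hd.trans_le h
  rw [Real.rpow_neg (by positivity), Real.rpow_ofNat, ← div_eq_mul_inv,
    inv_le_comm₀ (by positivity) (by positivity), inv_div, div_le_iff₀ (by positivity), ← mul_pow,
    mul_comm]
  gcongr

lemma half_mul_neg_two {y : ℝ} (hy : 0 < y) : y ^ (1 / 2 : ℝ) * y ^ (-2 : ℝ) = y ^ (-(3 / 2 : ℝ)) := by
  rw [← Real.rpow_add hy]; norm_num

/-- If `f = O(|w|^(1/2))` and `k = O(|w - s|^(-2))`, then `f k` is integrable on vertical lines. -/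
lemma mul_bound_of_dist {x y : ℂ} {w s : ℂ} {d C K : ℝ} (hd : 0 < d) (h : d ≤ ‖w - s‖)
    (hx : ‖x‖ ≤ C * (1 + ‖w‖) ^ (1 / 2 : ℝ)) (hy : ‖y‖ ≤ K / ‖w - s‖ ^ 2) :
    ‖x * y‖ ≤ C * (K * ((1 + ‖s‖) / d + 1) ^ 2) * (1 + ‖w‖) ^ (-(3 / 2 : ℝ)) := by
  have h0 : 0 < ‖w - s‖ := hd.trans_le h
  have hK : 0 ≤ K := by
    by_contra hK
    have := (norm_nonneg y).trans hy
    have h2 : K / ‖w - s‖ ^ 2 < 0 := div_neg_of_neg_of_pos (by linarith) (by positivity)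
    linarith
  have h1 : ‖y‖ ≤ K * (((1 + ‖s‖) / d + 1) ^ 2 * (1 + ‖w‖) ^ (-2 : ℝ)) := by
    refine hy.trans ?_
    rw [div_eq_mul_inv]
    exact mul_le_mul_of_nonneg_left (inv_norm_sq_le_of_dist hd h) hK
  rw [norm_mul]
  calc ‖x‖ * ‖y‖ ≤ (C * (1 + ‖w‖) ^ (1 / 2 : ℝ)) *
        (K * (((1 + ‖s‖) / d + 1) ^ 2 * (1 + ‖w‖) ^ (-2 : ℝ))) :=
        mul_le_mul hx h1 (norm_nonneg _) ((norm_nonneg _).trans hx)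
    _ = _ := by rw [← half_mul_neg_two (by positivity)]; ring

lemma exists_bound_of_dist {F : ℂ → ℂ} {S : Set ℂ} {s : ℂ} {d C : ℝ} (hF : ContinuousOn F S)
    (hS : Metric.closedBall s d ⊆ S)
    (hC : ∀ w ∈ S, d ≤ ‖w - s‖ → ‖F w‖ ≤ C * (1 + ‖w‖) ^ (-(3 / 2 : ℝ))) :
    ∃ C', ∀ w ∈ S, ‖F w‖ ≤ C' * (1 + ‖w‖) ^ (-(3 / 2 : ℝ)) := by
  have hcont : ContinuousOn (fun w => F w * (((1 + ‖w‖) ^ (3 / 2 : ℝ) : ℝ) : ℂ))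
      (Metric.closedBall s d) := by
    refine (hF.mono hS).mul (Continuous.continuousOn ?_)
    exact continuous_ofReal.comp (Continuous.rpow_const (by fun_prop) fun w => Or.inr (by norm_num))
  obtain ⟨M, hM⟩ := (isCompact_closedBall s d).exists_bound_of_continuousOn hcont
  refine ⟨max C M, fun w hw => ?_⟩
  by_cases h : d ≤ ‖w - s‖
  · refine (hC w hw h).trans ?_
    gcongr
    exact le_max_left _ _
  · have h1 := hM w (by simpa [dist_eq_norm] using (not_le.mp h).le)
    rw [norm_mul, norm_real, Real.norm_of_nonneg (by positivity)] at h1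
    rw [Real.rpow_neg (by positivity), ← div_eq_mul_inv, le_div_iff₀ (by positivity)]
    exact h1.trans (le_max_right _ _)

section halfPlane

variable {f : ℂ → ℂ} {b₀ b C : ℝ}

lemma integrable_mul_selbergKernel (hf : DifferentiableOn ℂ f {w | b₀ < w.re})
    (hC : ∀ w : ℂ, b ≤ w.re → ‖f w‖ ≤ C * (1 + ‖w‖) ^ (1 / 2 : ℝ))
    {l : ℝ} (hl : 0 ≤ l) {c : ℝ} (h0 : b₀ < c) (hbc : b ≤ c) {s : ℂ} (hs : s.re ≠ c) :
    Integrable fun u : ℝ => f (c + u * I) * selbergKernel l (c + u * I - s) := by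
  have hne : ∀ w : ℂ, w.re = c → w - s ≠ 0 := fun w hw h => hs (by
    rw [← hw, sub_eq_zero.mp h])
  have hd : 0 < |c - s.re| := abs_pos.mpr (sub_ne_zero.mpr hs.symm)
  refine integrable_vertical (F := fun w => f w * selbergKernel l (w - s))
    (C := C * ((Real.exp (l * (c - s.re)) + Real.exp (2 * l * (c - s.re))) *
      ((1 + ‖s‖) / |c - s.re| + 1) ^ 2)) ?_ ?_
  · refine (hf.continuousOn.mono fun w (hw : w.re = c) => h0.trans_eq hw.symm).mul ?_
    unfold selbergKernel
    refine ContinuousOn.div (by fun_prop) (by fun_prop) fun w hw => pow_ne_zero 2 (hne w hw)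
  · intro w hw
    refine mul_bound_of_dist hd ?_ (hC w (hbc.trans_eq hw.symm)) (norm_selbergKernel_le hl ?_)
    · rw [← hw, ← sub_re]
      exact abs_re_le_norm _
    · simp [hw]

/-- Moving the line of integration past the pole of the kernel. -/
lemma integral_mul_selbergKernel_shift (hf : DifferentiableOn ℂ f {w | b₀ < w.re}) (hb : b₀ < b)
    (hC : ∀ w : ℂ, b ≤ w.re → ‖f w‖ ≤ C * (1 + ‖w‖) ^ (1 / 2 : ℝ))
    {l : ℝ} (hl : 0 ≤ l) {s : ℂ} {c : ℝ} (hbs : b < s.re) (hsc : s.re < c) :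
    ∫ u : ℝ, f (b + u * I) * selbergKernel l (b + u * I - s) =
      (∫ u : ℝ, f (c + u * I) * selbergKernel l (c + u * I - s)) + 2 * π * l * f s := by
  set N : ℂ → ℂ := fun v => cexp (l * v) - cexp (2 * l * v) with hN
  set F : ℂ → ℂ := fun w => dslope f s w * dslope N 0 (w - s) with hF
  have hFs : ∀ w, w ≠ s → F w = f w * selbergKernel l (w - s) - f s * selbergKernel l (w - s) := by
    intro w hw
    have hw' : w - s ≠ 0 := sub_ne_zero.mpr hw
    simp only [hF, dslope_of_ne _ hw, dslope_of_ne _ hw', slope_def_field, hN, selbergKernel]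
    simp
    field_simp
  have hd1 : DifferentiableOn ℂ (dslope f s) {w | b₀ < w.re} := by
    rw [Complex.differentiableOn_dslope]
    · exact hf
    · exact (isOpen_lt continuous_const continuous_re).mem_nhds (hb.trans hbs)
  have hd2 : Differentiable ℂ (dslope N 0) := by
    rw [← differentiableOn_univ, Complex.differentiableOn_dslope Filter.univ_mem]
    fun_prop
  have hdF : DifferentiableOn ℂ F {w | b₀ < w.re} := hd1.mul (by fun_prop)
  obtain ⟨d, hd, hd3⟩ : ∃ d, 0 < d ∧ Metric.closedBall s d ⊆ {w | b ≤ w.re ∧ w.re ≤ c} := by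
    refine ⟨min (s.re - b) (c - s.re), lt_min (by linarith) (by linarith), fun w hw => ?_⟩
    have h1 := (abs_re_le_norm (w - s)).trans
      (show ‖w - s‖ ≤ min (s.re - b) (c - s.re) by rw [← dist_eq_norm]; exact hw)
    rw [sub_re, abs_le] at h1
    have := min_le_left (s.re - b) (c - s.re)
    have := min_le_right (s.re - b) (c - s.re)
    constructor <;> linarith [h1.1, h1.2]
  set K := Real.exp (l * (c - s.re)) + Real.exp (2 * l * (c - s.re))
  obtain ⟨C', hC'⟩ := exists_bound_of_dist (F := F) (S := {w | b ≤ w.re ∧ w.re ≤ c}) (s := s)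
    (d := d) (C := (C + ‖f s‖) * (K * ((1 + ‖s‖) / d + 1) ^ 2))
    (hdF.continuousOn.mono fun w hw => hb.trans_le hw.1) hd3 (by
      intro w hw hdw
      have hws : w ≠ s := fun h => by simp [h] at hdw; linarith
      rw [hFs w hws, ← sub_mul]
      refine mul_bound_of_dist hd hdw ?_ (norm_selbergKernel_le hl (by simpa using hw.2))
      refine (norm_sub_le _ _).trans ?_
      rw [add_mul]
      refine add_le_add (hC w hw.1) ?_
      exact le_mul_of_one_le_right (norm_nonneg _)
        (Real.one_le_rpow (by linarith [norm_nonneg w]) (by norm_num)))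
  have key := integral_vertical_shift (F := F) (hbs.trans hsc).le
    (hdF.mono fun w hw => hb.trans_le hw.1) fun w h1 h2 => hC' w ⟨h1, h2⟩
  have line : ∀ x : ℝ, b ≤ x → x ≠ s.re → ∫ u : ℝ, F (x + u * I) =
      (∫ u : ℝ, f (x + u * I) * selbergKernel l (x + u * I - s)) -
        f s * ∫ u : ℝ, selbergKernel l (x + u * I - s) := by
    intro x hx hxs
    rw [← integral_const_mul, ← integral_sub
      (integrable_mul_selbergKernel hf hC hl (hb.trans_le hx) hx hxs.symm)
      ((integrable_selbergKernel_sub hxs l).const_mul _)]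
    congr 1
    ext u
    exact hFs _ fun h => hxs (by simp [← h])
  rw [line b le_rfl hbs.ne, line c (hbs.trans hsc).le hsc.ne'] at key
  have hb0 : ∫ u : ℝ, selbergKernel l (b + u * I - s) = 0 := by
    have h := integral_exp_mul_selbergKernel_sub b l 0 s
    rw [integral_selbergKernel_left (sub_neg.mpr hbs)] at h
    have h2 : max 0 (0 - l) - max 0 (0 - 2 * l) = 0 := by
      rw [max_eq_left (by linarith), max_eq_left (by linarith), sub_zero]
    rw [h2] at h
    simpa using h
  have hc0 : ∫ u : ℝ, selbergKernel l (c + u * I - s) = -(2 * π * l) := by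
    have h := integral_exp_mul_selbergKernel_sub c l 0 s
    rw [integral_selbergKernel_right (sub_pos.mpr hsc)] at h
    have h2 : max 0 (l - 0) - max 0 (2 * l - 0) = -l := by
      rw [max_eq_right (by linarith), max_eq_right (by linarith)]; ring
    rw [h2] at h
    simpa using h
  rw [hb0, hc0] at key
  linear_combination key

lemma integral_conj_mul_selbergKernel (hf : DifferentiableOn ℂ f {w | b₀ < w.re}) (hb : b₀ < b)
    (hC : ∀ w : ℂ, b ≤ w.re → ‖f w‖ ≤ C * (1 + ‖w‖) ^ (1 / 2 : ℝ))
    {l : ℝ} (hl : 0 ≤ l) {s : ℂ} (hbs : b < s.re) :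
    ∫ u : ℝ, (starRingEnd ℂ) (f (b + u * I)) * selbergKernel l (b + u * I - s) = 0 := by
  set p : ℂ := 2 * b - (starRingEnd ℂ) s with hp
  have hpre : p.re = 2 * b - s.re := by simp [hp]
  have hne : ∀ w : ℂ, b ≤ w.re → p - w ≠ 0 := fun w hw h => by
    have := congrArg re (sub_eq_zero.mp h)
    linarith
  have hd : 0 < s.re - b := sub_pos.mpr hbs
  have key := integral_vertical_eq_zero (F := fun w => f w * selbergKernel l (p - w)) (b := b)
    (C := C * ((Real.exp (l * 0) + Real.exp (2 * l * 0)) *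
      ((1 + ‖p‖) / (s.re - b) + 1) ^ 2)) ?_ ?_
  · have h := integral_conj (μ := volume) (f := fun u : ℝ => f (b + u * I) * selbergKernel l (p - (b + u * I)))
    rw [key, _root_.map_zero] at h
    rw [← h]
    congr 1
    ext u
    rw [map_mul, conj_selbergKernel]
    congr 2
    apply Complex.ext <;> simp [hp] <;> ring
  · refine (hf.mono fun w (hw : b ≤ w.re) => hb.trans_le hw).mul ?_
    unfold selbergKernel
    exact DifferentiableOn.div (by fun_prop) (by fun_prop) fun w hw => pow_ne_zero 2 (hne w hw)
  · intro w hw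
    refine mul_bound_of_dist hd ?_ (hC w hw) ?_
    · refine le_trans ?_ (abs_re_le_norm _)
      rw [sub_re, hpre]
      exact le_trans (by linarith) (le_abs_self _)
    · rw [← norm_neg (w - p), neg_sub]
      exact norm_selbergKernel_le hl (by rw [sub_re]; linarith)

lemma integral_inv_norm_sq {d : ℝ} (hd : 0 < d) :
    ∫ u : ℝ, (‖((d : ℂ) + u * I)‖ ^ 2)⁻¹ = π / d := by
  have h : ∀ u : ℝ, (‖((d : ℂ) + u * I)‖ ^ 2)⁻¹ = (d ^ 2)⁻¹ * (1 + (u / d) ^ 2)⁻¹ := by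
    intro u
    rw [← Complex.normSq_eq_norm_sq, ← mul_inv]
    simp [Complex.normSq_apply]
    field_simp
  simp only [h]
  rw [integral_const_mul, Measure.integral_comp_div (fun u : ℝ => (1 + u ^ 2)⁻¹),
    integral_univ_inv_one_add_sq, abs_of_pos hd, smul_eq_mul]
  field_simp

/-- Poisson's formula on a half-plane. -/
lemma integral_div_norm_sq (hf : DifferentiableOn ℂ f {w | b₀ < w.re}) (hb : b₀ < b)
    (hC : ∀ w : ℂ, b ≤ w.re → ‖f w‖ ≤ C * (1 + ‖w‖) ^ (1 / 2 : ℝ)) {s : ℂ} (hbs : b < s.re) :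
    (Integrable fun u : ℝ => f (b + u * I) * ((‖(b : ℂ) + u * I - s‖ ^ 2)⁻¹ : ℝ)) ∧
    ∫ u : ℝ, f (b + u * I) * ((‖(b : ℂ) + u * I - s‖ ^ 2)⁻¹ : ℝ) = π / (s.re - b) * f s := by
  set p : ℂ := 2 * b - (starRingEnd ℂ) s with hp
  have hpre : p.re = 2 * b - s.re := by simp [hp]
  have hne : ∀ w : ℂ, b ≤ w.re → w - p ≠ 0 := fun w hw h => by
    have := congrArg re (sub_eq_zero.mp h)
    linarith
  have hd : 0 < s.re - b := sub_pos.mpr hbs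
  have hline : ∀ u : ℝ, s.re - b ≤ ‖(b : ℂ) + u * I - s‖ := fun u => by
    refine le_trans ?_ (abs_re_le_norm _)
    simp only [sub_re, add_re, ofReal_re, mul_re, I_re, mul_zero, ofReal_im, I_im, mul_one,
      sub_self, add_zero]
    rw [abs_sub_comm]
    exact le_abs_self _
  have hcont : Continuous fun u : ℝ => ((‖(b : ℂ) + u * I - s‖ ^ 2)⁻¹ : ℝ) :=
    Continuous.inv₀ (by fun_prop) fun u => (pow_pos (hd.trans_le (hline u)) 2).ne'
  have hfc : Continuous fun u : ℝ => f (b + u * I) :=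
    hf.continuousOn.comp_continuous (by fun_prop) fun u => by simpa using hb
  have hint : Integrable fun u : ℝ => f (b + u * I) * ((‖(b : ℂ) + u * I - s‖ ^ 2)⁻¹ : ℝ) := by
    refine (integrable_one_add_abs_rpow.const_mul
      |C * (1 * ((1 + ‖s‖) / (s.re - b) + 1) ^ 2)|).mono'
      (hfc.mul (continuous_ofReal.comp hcont)).aestronglyMeasurable
      (Filter.Eventually.of_forall fun u => ?_)
    refine (mul_bound_of_dist (K := 1) hd (hline u) (hC _ (by simp)) ?_).trans ?_
    · rw [norm_real, Real.norm_of_nonneg (by positivity), one_div]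
    · exact mul_le_mul (le_abs_self _) (one_add_norm_rpow_le b u) (by positivity) (abs_nonneg _)
  refine ⟨hint, ?_⟩
  set F : ℂ → ℂ := fun w => dslope f s w / (w - p) with hF
  have hd1 : DifferentiableOn ℂ (dslope f s) {w | b₀ < w.re} := by
    rw [Complex.differentiableOn_dslope]
    · exact hf
    · exact (isOpen_lt continuous_const continuous_re).mem_nhds (hb.trans hbs)
  have hdF : DifferentiableOn ℂ F {w | b ≤ w.re} :=
    (hd1.mono fun w (hw : b ≤ w.re) => hb.trans_le hw).div (by fun_prop) hne
  obtain ⟨C', hC'⟩ := exists_bound_of_dist (F := F) (S := {w | b ≤ w.re}) (s := s)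
    (d := s.re - b) (C := (C + ‖f s‖) * (1 * ((1 + ‖s‖) / (s.re - b) + 1) ^ 2))
    hdF.continuousOn (by
      intro w hw
      have h1 := (abs_re_le_norm (w - s)).trans
        (show ‖w - s‖ ≤ s.re - b by rw [← dist_eq_norm]; exact hw)
      rw [sub_re, abs_le] at h1
      change b ≤ w.re
      linarith [h1.1]) (by
      intro w (hw : b ≤ w.re) hdw
      have hws : w ≠ s := fun h => by simp [h] at hdw; linarith
      have h0 : 0 < ‖w - s‖ := hd.trans_le hdw
      have h2 : F w = (f w - f s) * ((w - s) * (w - p))⁻¹ := by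
        simp only [hF, dslope_of_ne _ hws, slope_def_field]
        rw [div_div, div_eq_mul_inv]
      rw [h2]
      refine mul_bound_of_dist hd hdw ?_ ?_
      · refine (norm_sub_le _ _).trans ?_
        rw [add_mul]
        refine add_le_add (hC w hw) ?_
        exact le_mul_of_one_le_right (norm_nonneg _)
          (Real.one_le_rpow (by linarith [norm_nonneg w]) (by norm_num))
      · have h3 : ‖w - s‖ ≤ ‖w - p‖ := by
          rw [Complex.norm_def, Complex.norm_def]
          apply Real.sqrt_le_sqrt
          simp only [Complex.normSq_apply, sub_re, sub_im, hpre]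
          have : p.im = s.im := by simp [hp]
          rw [this]
          nlinarith
        rw [norm_inv, norm_mul, one_div, sq]
        gcongr)
  have key := integral_vertical_eq_zero hdF hC'
  have h4 : ∀ u : ℝ, F (b + u * I) = f s * ((‖(b : ℂ) + u * I - s‖ ^ 2)⁻¹ : ℝ) -
      f (b + u * I) * ((‖(b : ℂ) + u * I - s‖ ^ 2)⁻¹ : ℝ) := by
    intro u
    have hws : (b : ℂ) + u * I ≠ s := fun h => hbs.ne (by simp [← h])
    have h5 : ((‖(b : ℂ) + u * I - s‖ ^ 2 : ℝ) : ℂ) =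
        -(((b : ℂ) + u * I - s) * ((b : ℂ) + u * I - p)) := by
      rw [← Complex.normSq_eq_norm_sq, ← Complex.mul_conj, neg_mul_eq_mul_neg]
      congr 1
      apply Complex.ext <;> simp [hp] <;> ring
    rw [ofReal_inv, h5]
    simp only [hF, dslope_of_ne _ hws, slope_def_field]
    have := hne ((b : ℂ) + u * I) (by simp)
    have := sub_ne_zero.mpr hws
    field_simp
    ring
  have h6 : Integrable fun u : ℝ => ((‖(b : ℂ) + u * I - s‖ ^ 2)⁻¹ : ℝ) := by
    have h := ((integrable_inv_sq_vertical (sub_neg.mpr hbs).ne).comp_sub_right s.im).norm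
    simp only [vertical_sub]
    simpa using h
  have h7 : ∫ u : ℝ, ((‖(b : ℂ) + u * I - s‖ ^ 2)⁻¹ : ℝ) = π / (s.re - b) := by
    have h := integral_sub_right_eq_self (μ := volume)
      (fun u : ℝ => (‖((s.re - b : ℝ) : ℂ) + u * I‖ ^ 2)⁻¹) s.im
    rw [integral_inv_norm_sq hd] at h
    rw [← h]
    congr 1
    ext u
    congr 2
    rw [Complex.norm_def, Complex.norm_def]
    congr 1
    simp [Complex.normSq_apply]
    ring
  have h6' : Integrable fun u : ℝ => f s * (((‖(b : ℂ) + u * I - s‖ ^ 2)⁻¹ : ℝ) : ℂ) :=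
    h6.ofReal.const_mul _
  simp only [h4] at key
  rw [integral_sub h6' hint, integral_const_mul, integral_complex_ofReal, h7]
    at key
  push_cast at key ⊢
  linear_combination -key

/-- The kernel integral of a function of nonnegative real part is controlled by the real part. -/
lemma norm_integral_mul_selbergKernel_le (hf : DifferentiableOn ℂ f {w | b₀ < w.re}) (hb : b₀ < b)
    (hC : ∀ w : ℂ, b ≤ w.re → ‖f w‖ ≤ C * (1 + ‖w‖) ^ (1 / 2 : ℝ))
    (hpos : ∀ w : ℂ, w.re = b → 0 ≤ (f w).re)
    {l : ℝ} (hl : 0 ≤ l) {s s₁ : ℂ} (hbs : b < s₁.re) (hs : s₁.re ≤ s.re) (him : s.im = s₁.im) :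
    ‖∫ u : ℝ, f (b + u * I) * selbergKernel l (b + u * I - s)‖ ≤
      2 * π * (Real.exp (-(l * (s.re - b))) + Real.exp (-(2 * l * (s.re - b)))) *
        ((f s₁).re / (s₁.re - b)) := by
  have hbs' : b < s.re := hbs.trans_le hs
  have h1 := integral_conj_mul_selbergKernel hf hb hC hl hbs'
  have hi := integrable_mul_selbergKernel hf hC hl hb le_rfl hbs'.ne'
  have hi2 : Integrable fun u : ℝ =>
      (starRingEnd ℂ) (f (b + u * I)) * selbergKernel l (b + u * I - s) := by
    refine (hi.norm).mono' ?_ (Filter.Eventually.of_forall fun u => by simp)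
    have hfc : Continuous fun u : ℝ => f (b + u * I) :=
      hf.continuousOn.comp_continuous (by fun_prop) fun u => by simpa using hb
    exact (continuous_conj.comp hfc).aestronglyMeasurable.mul
      (integrable_selbergKernel_sub hbs'.ne l).aestronglyMeasurable
  obtain ⟨hp1, hp2⟩ := integral_div_norm_sq hf hb hC hbs
  set E := Real.exp (-(l * (s.re - b))) + Real.exp (-(2 * l * (s.re - b))) with hE
  have h2 : ∫ u : ℝ, f (b + u * I) * selbergKernel l (b + u * I - s) =
      ∫ u : ℝ, ((2 * (f (b + u * I)).re : ℝ) : ℂ) * selbergKernel l (b + u * I - s) := by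
    rw [← add_zero (∫ u : ℝ, f (b + u * I) * selbergKernel l (b + u * I - s)), ← h1,
      ← integral_add hi hi2]
    congr 1
    ext u
    rw [← add_mul, Complex.add_conj]
  have h3 : ∫ u : ℝ, 2 * E * (f (b + u * I) * ((‖(b : ℂ) + u * I - s₁‖ ^ 2)⁻¹ : ℝ)).re =
      2 * E * (π / (s₁.re - b) * (f s₁).re) := by
    rw [integral_const_mul]
    congr 1
    have h := integral_re hp1
    simp only [RCLike.re_to_complex] at h
    rw [h, hp2, ← ofReal_sub, ← ofReal_div, re_ofReal_mul]
  rw [h2]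
  refine (norm_integral_le_of_norm_le (hp1.re.const_mul (2 * E))
    (Filter.Eventually.of_forall fun u => ?_)).trans ?_
  · have hpu := hpos (b + u * I) (by simp)
    have hk := norm_selbergKernel_le (v := (b : ℂ) + u * I - s) (r := -(s.re - b)) hl (by simp)
    rw [norm_mul, norm_real, Real.norm_of_nonneg (by positivity), RCLike.re_to_complex,
      re_mul_ofReal]
    have h4 : ‖(b : ℂ) + u * I - s₁‖ ^ 2 ≤ ‖(b : ℂ) + u * I - s‖ ^ 2 := by
      rw [← Complex.normSq_eq_norm_sq, ← Complex.normSq_eq_norm_sq]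
      simp only [Complex.normSq_apply, sub_re, sub_im, him]
      simp
      nlinarith
    have h5 : 0 < ‖(b : ℂ) + u * I - s₁‖ ^ 2 := by
      have : (b : ℂ) + u * I - s₁ ≠ 0 := fun h => hbs.ne (by simp [← sub_eq_zero.mp h])
      positivity
    calc 2 * (f (b + u * I)).re * ‖selbergKernel l (b + u * I - s)‖
        ≤ 2 * (f (b + u * I)).re * (E / ‖(b : ℂ) + u * I - s₁‖ ^ 2) := by
          refine mul_le_mul_of_nonneg_left (hk.trans ?_) (by positivity)
          simp only [mul_neg, hE]
          gcongr
      _ = _ := by rw [div_eq_mul_inv]; ring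
  · simp only [RCLike.re_to_complex]
    rw [h3]
    apply le_of_eq
    ring

end halfPlane

lemma image_exp_neg_Ioi : (fun y : ℝ => Real.exp (-y)) '' Set.Ioi 0 = Set.Ioo 0 1 := by
  ext u
  constructor
  · rintro ⟨y, hy, rfl⟩
    exact ⟨Real.exp_pos _, Real.exp_lt_one_iff.mpr (neg_neg_of_pos hy)⟩
  · rintro ⟨h0, h1⟩
    exact ⟨-Real.log u, neg_pos.mpr (Real.log_neg h0 h1), by simp [Real.exp_log h0]⟩

/-- The Beta integral in exponential coordinates. -/
lemma betaIntegral_eq_integral_exp {z : ℂ} (hz : 0 < z.re) {d : ℝ} (hd : 0 < d) :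
    IntegrableOn (fun y : ℝ => cexp (-z * y) * ((1 - Real.exp (-y)) ^ (d - 1) : ℝ)) (Set.Ioi 0) ∧
      betaIntegral z d =
        ∫ y in Set.Ioi (0 : ℝ), cexp (-z * y) * ((1 - Real.exp (-y)) ^ (d - 1) : ℝ) := by
  have hder : ∀ y ∈ Set.Ioi (0 : ℝ), HasDerivWithinAt (fun y : ℝ => Real.exp (-y))
      (-Real.exp (-y)) (Set.Ioi 0) y := fun y _ =>
    ((((hasDerivAt_id y).neg).exp).congr_deriv (by simp)).hasDerivWithinAt
  have hinj : Set.InjOn (fun y : ℝ => Real.exp (-y)) (Set.Ioi 0) := fun a _ b _ h =>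
    neg_injective (Real.exp_injective h)
  set g : ℝ → ℂ := fun x => (x : ℂ) ^ (z - 1) * (1 - (x : ℂ)) ^ ((d : ℂ) - 1) with hg
  have hgc : ∀ y ∈ Set.Ioi (0 : ℝ), |-Real.exp (-y)| • g (Real.exp (-y)) =
      cexp (-z * y) * ((1 - Real.exp (-y)) ^ (d - 1) : ℝ) := by
    intro y hy
    have h1 : 0 ≤ 1 - Real.exp (-y) := by
      have := Real.exp_lt_one_iff.mpr (neg_neg_of_pos (Set.mem_Ioi.mp hy)); linarith
    have h2 : ((Real.exp (-y) : ℝ) : ℂ) ≠ 0 := by exact_mod_cast (Real.exp_pos _).ne'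
    rw [abs_neg, abs_of_pos (Real.exp_pos _), hg, Complex.real_smul, ← mul_assoc,
      ofReal_cpow h1, cpow_def_of_ne_zero h2, ← ofReal_log (Real.exp_pos _).le, Real.log_exp]
    push_cast
    rw [← Complex.exp_add]
    ring_nf
  have hint : IntegrableOn g (Set.Ioo 0 1) := by
    have h := betaIntegral_convergent hz (v := d) (by simpa using hd)
    exact ((intervalIntegrable_iff_integrableOn_Ioc_of_le zero_le_one).mp h).mono_set
      Set.Ioo_subset_Ioc_self
  constructor
  · rw [← image_exp_neg_Ioi,
      integrableOn_image_iff_integrableOn_abs_deriv_smul measurableSet_Ioi hder hinj] at hint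
    exact hint.congr_fun hgc measurableSet_Ioi
  · rw [betaIntegral, intervalIntegral.integral_of_le zero_le_one, integral_Ioc_eq_integral_Ioo,
      ← image_exp_neg_Ioi,
      integral_image_eq_integral_abs_deriv_smul measurableSet_Ioi hder hinj]
    exact setIntegral_congr_fun measurableSet_Ioi hgc

lemma norm_cexp_neg_sub_le {m : ℝ} {z w : ℂ} (hz : m ≤ z.re) (hw : m ≤ w.re) {y : ℝ}
    (hy : 0 ≤ y) :
    ‖cexp (-z * y) - cexp (-w * y)‖ ≤ 2 * Real.exp (-m * y) * (√‖z - w‖ * √y) := by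
  have hn : ∀ v : ℂ, m ≤ v.re → ‖cexp (-v * y)‖ ≤ Real.exp (-m * y) := fun v hv => by
    rw [Complex.norm_exp]
    simp
    nlinarith
  have h1 : ‖cexp (-z * y) - cexp (-w * y)‖ ≤ 2 * Real.exp (-m * y) :=
    (norm_sub_le _ _).trans (by linarith [hn z hz, hn w hw])
  have h2 : ‖cexp (-z * y) - cexp (-w * y)‖ ≤ Real.exp (-m * y) * y * ‖z - w‖ := by
    refine Convex.norm_image_sub_le_of_norm_hasDerivWithin_le (𝕜 := ℂ)
      (f := fun v : ℂ => cexp (-v * y))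
      (f' := fun v => cexp (-v * y) * (-y)) (s := {v : ℂ | m ≤ v.re}) ?_ ?_
      (convex_halfSpace_re_ge m) hw hz
    · intro v _
      have h := (((hasDerivAt_id v).neg.mul_const (y : ℂ)).cexp)
      exact (h.congr_deriv (by simp)).hasDerivWithinAt
    · intro v hv
      rw [norm_mul, norm_neg, norm_real, Real.norm_of_nonneg hy]
      gcongr
      exact hn v hv
  have h0 := norm_nonneg (cexp (-z * y) - cexp (-w * y))
  have h3 : ‖cexp (-z * y) - cexp (-w * y)‖ ^ 2 ≤
      (2 * Real.exp (-m * y) * (√‖z - w‖ * √y)) ^ 2 := by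
    rw [mul_pow, mul_pow, mul_pow, Real.sq_sqrt (norm_nonneg _), Real.sq_sqrt hy, sq]
    have := mul_le_mul h1 h2 h0 (by positivity)
    have h5 : 0 ≤ Real.exp (-m * y) ^ 2 * (‖z - w‖ * y) := by positivity
    nlinarith
  exact (pow_le_pow_iff_left₀ h0 (by positivity) two_ne_zero).mp h3

lemma inv_one_sub_exp_neg_le {y : ℝ} (hy : 0 < y) : (1 - Real.exp (-y))⁻¹ ≤ 1 + y⁻¹ := by
  have h := Real.add_one_le_exp y
  have h1 : Real.exp (-y) ≤ (1 + y)⁻¹ := by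
    rw [Real.exp_neg]; gcongr; linarith
  have h2 : y / (1 + y) ≤ 1 - Real.exp (-y) := by
    have : y / (1 + y) = 1 - (1 + y)⁻¹ := by field_simp; ring
    linarith
  calc (1 - Real.exp (-y))⁻¹ ≤ (y / (1 + y))⁻¹ := by gcongr
    _ = 1 + y⁻¹ := by field_simp; ring

lemma integrableOn_exp_mul_sqrt {m : ℝ} (hm : 0 < m) :
    IntegrableOn (fun y : ℝ => Real.exp (-m * y) * (√y * (1 + y⁻¹))) (Set.Ioi 0) := by
  have h1 := integrableOn_rpow_mul_exp_neg_mul_rpow (p := 1) (s := 1 / 2) (b := m) (by norm_num)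
    one_pos hm
  have h2 := integrableOn_rpow_mul_exp_neg_mul_rpow (p := 1) (s := -1 / 2) (b := m) (by norm_num)
    one_pos hm
  refine (h1.add h2).congr_fun (fun y (hy : 0 < y) => ?_) measurableSet_Ioi
  have : y ^ (-1 / 2 : ℝ) = √y * y⁻¹ := by
    rw [Real.sqrt_eq_rpow, ← Real.rpow_neg_one, ← Real.rpow_add hy]; norm_num
  simp only [Pi.add_apply, this, Real.rpow_one, ← Real.sqrt_eq_rpow]
  ring

lemma norm_exp_sub_div_le {m : ℝ} {z w : ℂ} (hz : m ≤ z.re) (hw : m ≤ w.re) {y : ℝ}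
    (hy : 0 < y) :
    ‖(cexp (-z * y) - cexp (-w * y)) * ((1 - Real.exp (-y))⁻¹ : ℝ)‖ ≤
      2 * √‖z - w‖ * (Real.exp (-m * y) * (√y * (1 + y⁻¹))) := by
  have h1 : 0 < 1 - Real.exp (-y) := by
    have := Real.exp_lt_one_iff.mpr (neg_neg_of_pos hy); linarith
  rw [norm_mul, norm_real, Real.norm_of_nonneg (inv_pos.mpr h1).le]
  calc _ ≤ 2 * Real.exp (-m * y) * (√‖z - w‖ * √y) * (1 + y⁻¹) := by
        gcongr
        · exact norm_cexp_neg_sub_le hz hw hy.le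
        · exact inv_one_sub_exp_neg_le hy
    _ = _ := by ring

lemma integrableOn_exp_sub_div {z w : ℂ} (hz : 0 < z.re) (hw : 0 < w.re) :
    IntegrableOn (fun y : ℝ => (cexp (-z * y) - cexp (-w * y)) * ((1 - Real.exp (-y))⁻¹ : ℝ))
      (Set.Ioi 0) := by
  have hm : 0 < min z.re w.re := lt_min hz hw
  refine ((integrableOn_exp_mul_sqrt hm).const_mul (2 * √‖z - w‖)).mono'
    (Measurable.aestronglyMeasurable (by fun_prop)) ?_
  filter_upwards [ae_restrict_mem measurableSet_Ioi] with y hy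
  exact norm_exp_sub_div_le (min_le_left _ _) (min_le_right _ _) hy

/-- Gauss's integral for the digamma function. -/
lemma digamma_eq_integral {z : ℂ} (hz : 0 < z.re) :
    digamma z = -Real.eulerMascheroniConstant + ∫ y in Set.Ioi (0 : ℝ),
      (cexp (-1 * y) - cexp (-z * y)) * ((1 - Real.exp (-y))⁻¹ : ℝ) := by
  have hG : ∀ w : ℂ, 0 < w.re → DifferentiableAt ℂ Complex.Gamma w := fun w hw =>
    differentiableAt_Gamma w fun m h => by
      rw [h] at hw; simp at hw; linarith [(Nat.cast_nonneg m : (0 : ℝ) ≤ m)]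
  have hz0 := Gamma_ne_zero_of_re_pos hz
  have hlim1 : Filter.Tendsto (fun d : ℝ => betaIntegral z d - betaIntegral 1 d)
      (nhdsWithin 0 (Set.Ioi 0)) (nhds (-Real.eulerMascheroniConstant - digamma z)) := by
    set g : ℝ → ℂ := fun d => Complex.Gamma z * Complex.Gamma (1 + d) - Complex.Gamma (z + d) with hg
    have h0 : HasDerivAt (fun d : ℝ => (d : ℂ)) 1 0 := ofRealCLM.hasDerivAt
    have hgd : HasDerivAt g (Complex.Gamma z * -Real.eulerMascheroniConstant - deriv Complex.Gamma z) 0 := by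
      have h1 : HasDerivAt (fun d : ℝ => Complex.Gamma (1 + d)) (-Real.eulerMascheroniConstant * 1) 0 := by
        refine HasDerivAt.comp_ofReal (e := fun d : ℂ => Complex.Gamma (1 + d)) (z := 0) ?_
        have := Complex.hasDerivAt_Gamma_one
        refine HasDerivAt.comp (h₂ := Complex.Gamma) ((0 : ℝ) : ℂ) ?_ ((hasDerivAt_id _).const_add 1)
        simpa using this
      have h2 : HasDerivAt (fun d : ℝ => Complex.Gamma (z + d)) (deriv Complex.Gamma z * 1) 0 := by
        refine HasDerivAt.comp_ofReal (e := fun d : ℂ => Complex.Gamma (z + d)) (z := 0) ?_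
        refine HasDerivAt.comp (h₂ := Complex.Gamma) ((0 : ℝ) : ℂ) ?_ ((hasDerivAt_id _).const_add z)
        simpa using (hG z hz).hasDerivAt
      exact ((h1.const_mul (Complex.Gamma z)).sub h2).congr_deriv (by simp)
    have hs := (hasDerivAt_iff_tendsto_slope.mp hgd).mono_left
      (nhdsWithin_mono 0 (fun x (hx : 0 < x) => hx.ne' : Set.Ioi (0 : ℝ) ⊆ {0}ᶜ))
    have hc : Filter.Tendsto (fun d : ℝ => Complex.Gamma (z + d)) (nhdsWithin 0 (Set.Ioi 0))
        (nhds (Complex.Gamma z)) := by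
      have h1 : ContinuousAt (fun d : ℝ => Complex.Gamma (z + d)) 0 := by
        refine ContinuousAt.comp (g := Complex.Gamma) ?_ (by fun_prop)
        simpa using (hG z hz).continuousAt
      have := h1.tendsto.mono_left (nhdsWithin_le_nhds (s := Set.Ioi (0 : ℝ)))
      simpa using this
    have h := hs.div hc hz0
    have e : (Complex.Gamma z * -Real.eulerMascheroniConstant - deriv Complex.Gamma z) / Complex.Gamma z =
        -Real.eulerMascheroniConstant - digamma z := by
      rw [digamma_def, logDeriv_apply]; field_simp
    rw [e] at h
    refine h.congr' ?_
    filter_upwards [self_mem_nhdsWithin] with d (hd : 0 < d)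
    have hd' : (0 : ℝ) < (d : ℂ).re := by simpa using hd
    have hd0 : (d : ℂ) ≠ 0 := by exact_mod_cast hd.ne'
    have hzd : Complex.Gamma (z + d) ≠ 0 := Gamma_ne_zero_of_re_pos (by simp; linarith)
    have h1d : Complex.Gamma (d + 1) ≠ 0 := Gamma_ne_zero_of_re_pos (by simp; linarith)
    have hgd := Gamma_add_one (d : ℂ) hd0
    have hgd0 := Gamma_ne_zero_of_re_pos hd'
    rw [betaIntegral_eq_Gamma_mul_div _ _ hz hd', betaIntegral_eq_Gamma_mul_div _ _ (by simp) hd',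
      Pi.div_apply, slope_def_module]
    simp only [hg, sub_zero, Complex.real_smul, ofReal_zero, add_zero, Complex.Gamma_one]
    rw [add_comm 1 (d : ℂ), hgd]
    push_cast
    field_simp
    ring
  have hlim2 : Filter.Tendsto (fun d : ℝ => betaIntegral z d - betaIntegral 1 d)
      (nhdsWithin 0 (Set.Ioi 0)) (nhds (∫ y in Set.Ioi (0 : ℝ),
        (cexp (-z * y) - cexp (-1 * y)) * ((1 - Real.exp (-y))⁻¹ : ℝ))) := by
    have h := tendsto_integral_filter_of_dominated_convergence (l := nhdsWithin (0 : ℝ) (Set.Ioi 0))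
      (μ := volume.restrict (Set.Ioi (0 : ℝ)))
      (F := fun (d : ℝ) (y : ℝ) => (cexp (-z * y) - cexp (-1 * y)) *
        ((1 - Real.exp (-y)) ^ (d - 1) : ℝ))
      (f := fun y : ℝ => (cexp (-z * y) - cexp (-1 * y)) * ((1 - Real.exp (-y))⁻¹ : ℝ))
      (fun y => ‖(cexp (-z * y) - cexp (-1 * y)) * ((1 - Real.exp (-y))⁻¹ : ℝ)‖)
      (Filter.Eventually.of_forall fun d => Measurable.aestronglyMeasurable (by fun_prop)) ?_
      (integrableOn_exp_sub_div hz (by simp)).norm ?_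
    · refine h.congr' ?_
      filter_upwards [self_mem_nhdsWithin] with d (hd : 0 < d)
      obtain ⟨i1, e1⟩ := betaIntegral_eq_integral_exp hz hd
      obtain ⟨i2, e2⟩ := betaIntegral_eq_integral_exp (z := 1) (by simp) hd
      rw [e1, e2, ← integral_sub i1 i2]
      simp only [sub_mul]
    · filter_upwards [self_mem_nhdsWithin] with d (hd : 0 < d)
      filter_upwards [ae_restrict_mem measurableSet_Ioi] with y (hy : 0 < y)
      have h1 : Real.exp (-y) < 1 := Real.exp_lt_one_iff.mpr (neg_neg_of_pos hy)
      rw [norm_mul, norm_mul, norm_real, norm_real,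
        Real.norm_of_nonneg (Real.rpow_nonneg (by linarith) _),
        Real.norm_of_nonneg (inv_nonneg.mpr (by linarith)), ← Real.rpow_neg_one]
      refine mul_le_mul_of_nonneg_left ?_ (norm_nonneg _)
      exact Real.rpow_le_rpow_of_exponent_ge (by linarith) (by linarith [Real.exp_pos (-y)])
        (by linarith)
    · filter_upwards [ae_restrict_mem measurableSet_Ioi] with y (hy : 0 < y)
      have h1 : Real.exp (-y) < 1 := Real.exp_lt_one_iff.mpr (neg_neg_of_pos hy)
      refine Filter.Tendsto.const_mul _ ?_
      refine (Complex.continuous_ofReal.tendsto _).comp ?_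
      have : ContinuousAt (fun d : ℝ => (1 - Real.exp (-y)) ^ (d - 1)) 0 :=
        ContinuousAt.rpow (by fun_prop) (by fun_prop) (Or.inl (by linarith))
      have h2 := this.tendsto.mono_left (nhdsWithin_le_nhds (s := Set.Ioi (0 : ℝ)))
      simpa [Real.rpow_neg_one] using h2
  have h := tendsto_nhds_unique hlim1 hlim2
  have h3 : ∫ y in Set.Ioi (0 : ℝ), (cexp (-1 * y) - cexp (-z * y)) * ((1 - Real.exp (-y))⁻¹ : ℝ)
      = -∫ y in Set.Ioi (0 : ℝ), (cexp (-z * y) - cexp (-1 * y)) * ((1 - Real.exp (-y))⁻¹ : ℝ) := by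
    rw [← integral_neg]
    congr 1
    ext y
    ring
  rw [h3]
  linear_combination -h

lemma norm_cexp_neg_mul (z : ℂ) (y : ℝ) : ‖cexp (-z * y)‖ = Real.exp (-z.re * y) := by
  simp [Complex.norm_exp]

lemma one_sub_exp_neg_pos {y : ℝ} (hy : 0 < y) : 0 < 1 - Real.exp (-y) :=
  sub_pos.mpr (Real.exp_lt_one_iff.mpr (neg_neg_of_pos hy))

lemma integrableOn_exp_sub_div_id {z w : ℂ} (hz : 0 < z.re) (hw : 0 < w.re) :
    IntegrableOn (fun y : ℝ => (cexp (-z * y) - cexp (-w * y)) * (y⁻¹ : ℝ)) (Set.Ioi 0) := by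
  refine (integrableOn_exp_sub_div hz hw).norm.mono'
    (Measurable.aestronglyMeasurable (by fun_prop)) ?_
  filter_upwards [ae_restrict_mem measurableSet_Ioi] with y (hy : 0 < y)
  have h1 := one_sub_exp_neg_pos hy
  rw [norm_mul, norm_mul, norm_real, norm_real, Real.norm_of_nonneg (inv_pos.mpr h1).le,
    Real.norm_of_nonneg (inv_pos.mpr hy).le]
  gcongr
  linarith [Real.add_one_le_exp (-y)]

/-- Frullani's integral for the logarithm. -/
lemma clog_eq_integral {z : ℂ} (hz : 0 < z.re) :
    Complex.log z =
      ∫ y in Set.Ioi (0 : ℝ), (cexp (-1 * y) - cexp (-z * y)) * (y⁻¹ : ℝ) := by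
  have hder : ∀ w : ℂ, 0 < w.re → HasDerivAt
      (fun w : ℂ => ∫ y in Set.Ioi (0 : ℝ), (cexp (-1 * y) - cexp (-w * y)) * (y⁻¹ : ℝ))
      (w⁻¹) w := by
    intro w hw
    have hval : ∫ y in Set.Ioi (0 : ℝ), cexp (-w * y) = w⁻¹ := by
      rw [integral_exp_mul_complex_Ioi (by simpa using hw)]
      simp
    have h := hasDerivAt_integral_of_dominated_loc_of_deriv_le (𝕜 := ℂ)
      (μ := volume.restrict (Set.Ioi (0 : ℝ)))
      (F := fun (w : ℂ) (y : ℝ) => (cexp (-1 * y) - cexp (-w * y)) * (y⁻¹ : ℝ))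
      (F' := fun (w : ℂ) (y : ℝ) => cexp (-w * y)) (x₀ := w)
      (s := {v : ℂ | w.re / 2 < v.re}) (bound := fun y => Real.exp (-(w.re / 2) * y))
      ((isOpen_lt continuous_const continuous_re).mem_nhds (by
        change w.re / 2 < w.re; linarith))
      (Filter.Eventually.of_forall fun v => Measurable.aestronglyMeasurable (by fun_prop))
      (integrableOn_exp_sub_div_id (by simp) hw)
      (Measurable.aestronglyMeasurable (by fun_prop)) ?_
      (integrableOn_exp_mul_Ioi (by linarith) 0) ?_
    · rw [← hval]; exact h.2
    · filter_upwards [ae_restrict_mem measurableSet_Ioi] with y (hy : 0 < y) v hv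
      rw [norm_cexp_neg_mul, Real.exp_le_exp]
      have : w.re / 2 < v.re := hv
      nlinarith
    · filter_upwards [ae_restrict_mem measurableSet_Ioi] with y (hy : 0 < y) v hv
      have h1 := ((((hasDerivAt_id v).neg.mul_const (y : ℂ)).cexp).const_sub
        (cexp (-1 * y))).mul_const ((y⁻¹ : ℝ) : ℂ)
      refine h1.congr_deriv ?_
      have : (y : ℂ) ≠ 0 := by exact_mod_cast hy.ne'
      simp
      field_simp
  have hS : IsOpen {v : ℂ | 0 < v.re} := isOpen_lt continuous_const continuous_re
  have hlog : ∀ v : ℂ, 0 < v.re → HasDerivAt Complex.log v⁻¹ v := fun v hv =>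
    Complex.hasDerivAt_log (Or.inl hv)
  refine hS.eqOn_of_deriv_eq (convex_halfSpace_re_gt 0).isPreconnected
    (fun v hv => (hlog v hv).differentiableAt.differentiableWithinAt)
    (fun v hv => (hder v hv).differentiableAt.differentiableWithinAt)
    (fun v hv => (hlog v hv).deriv.trans (hder v hv).deriv.symm)
    (x := 1) (by simp) ?_ hz
  simp

/-- The kernel `1 / (1 - e ^ (-y)) - 1 / y` takes values in `[0, 1]`. -/
lemma binet_kernel_mem {y : ℝ} (hy : 0 < y) : (1 - Real.exp (-y))⁻¹ - y⁻¹ ∈ Set.Icc (0 : ℝ) 1 := by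
  have h1 := one_sub_exp_neg_pos hy
  constructor
  · rw [sub_nonneg]
    gcongr
    linarith [Real.add_one_le_exp (-y)]
  · linarith [inv_one_sub_exp_neg_le hy]

lemma integrableOn_cexp_neg {z : ℂ} (hz : 0 < z.re) :
    IntegrableOn (fun y : ℝ => cexp (-z * y)) (Set.Ioi 0) :=
  integrableOn_exp_mul_complex_Ioi (by simpa using hz) 0

lemma integrableOn_binet {z : ℂ} (hz : 0 < z.re) :
    IntegrableOn (fun y : ℝ => cexp (-z * y) * ((1 - Real.exp (-y))⁻¹ - y⁻¹ : ℝ))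
      (Set.Ioi 0) := by
  refine (integrableOn_cexp_neg hz).norm.mono' (Measurable.aestronglyMeasurable (by fun_prop)) ?_
  filter_upwards [ae_restrict_mem measurableSet_Ioi] with y hy
  have h := binet_kernel_mem hy
  rw [norm_mul, norm_real, Real.norm_of_nonneg h.1]
  exact mul_le_of_le_one_right (norm_nonneg _) h.2

lemma norm_integral_cexp_mul_le {z : ℂ} (hz : 0 < z.re) {r : ℝ → ℝ} {B : ℝ}
    (hr : ∀ y, 0 < y → |r y| ≤ B) :
    ‖∫ y in Set.Ioi (0 : ℝ), cexp (-z * y) * (r y : ℂ)‖ ≤ B / z.re := by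
  have hi := (integrableOn_cexp_neg hz).norm.mul_const B
  refine (norm_integral_le_of_norm_le hi ?_).trans_eq ?_
  · filter_upwards [ae_restrict_mem measurableSet_Ioi] with y hy
    rw [norm_mul, norm_real]
    exact mul_le_mul_of_nonneg_left (hr y hy) (norm_nonneg _)
  · rw [integral_mul_const]
    simp only [norm_cexp_neg_mul]
    rw [integral_exp_mul_Ioi (by linarith)]
    simp
    field_simp

/-- Binet's integral for the digamma function. -/
lemma digamma_eq_log_sub {z : ℂ} (hz : 0 < z.re) :
    digamma z = Complex.log z -
      ∫ y in Set.Ioi (0 : ℝ), cexp (-z * y) * ((1 - Real.exp (-y))⁻¹ - y⁻¹ : ℝ) := by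
  set K : ℂ → ℂ := fun z =>
    ∫ y in Set.Ioi (0 : ℝ), cexp (-z * y) * ((1 - Real.exp (-y))⁻¹ - y⁻¹ : ℝ) with hK
  have key : ∀ w : ℂ, 0 < w.re → digamma w = Complex.log w - K w +
      (K 1 - Real.eulerMascheroniConstant) := by
    intro w hw
    have h1 : K 1 - K w = (∫ y in Set.Ioi (0 : ℝ),
        (cexp (-1 * y) - cexp (-w * y)) * ((1 - Real.exp (-y))⁻¹ : ℝ)) - Complex.log w := by
      rw [hK, clog_eq_integral hw, ← integral_sub (integrableOn_binet (by simp))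
        (integrableOn_binet hw), ← integral_sub (integrableOn_exp_sub_div (by simp) hw)
        (integrableOn_exp_sub_div_id (by simp) hw)]
      congr 1
      ext y
      push_cast
      ring
    rw [digamma_eq_integral hw]
    linear_combination -h1
  have hlim : Filter.Tendsto (fun n : ℕ => ‖K 1 - Real.eulerMascheroniConstant‖) Filter.atTop
      (nhds 0) := by
    have h1 : Filter.Tendsto (fun n : ℕ => |((harmonic n : ℝ) - Real.log (n + 1)) -
        Real.eulerMascheroniConstant| + 1 / ((n : ℝ) + 1)) Filter.atTop (nhds 0) := by
      have := (Real.tendsto_harmonic_sub_log_add_one.sub_const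
        Real.eulerMascheroniConstant).abs.add (tendsto_one_div_add_atTop_nhds_zero_nat (𝕜 := ℝ))
      simpa using this
    refine squeeze_zero (fun _ => norm_nonneg _) (fun n => ?_) h1
    have hn : 0 < ((n : ℂ) + 1).re := by simp; positivity
    have h2 := key _ hn
    have h3 : digamma ((n : ℂ) + 1) = -Real.eulerMascheroniConstant + harmonic n := by
      rw [digamma_def, logDeriv_apply, Complex.deriv_Gamma_nat, Complex.Gamma_nat_eq_factorial]
      have : ((n.factorial : ℕ) : ℂ) ≠ 0 := by exact_mod_cast n.factorial_ne_zero
      field_simp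
    have h4 : Complex.log ((n : ℂ) + 1) = ((Real.log (n + 1) : ℝ) : ℂ) := by
      rw [ofReal_log (by positivity)]; push_cast; rfl
    have h5 : K 1 - Real.eulerMascheroniConstant = ((((harmonic n : ℝ) - Real.log (n + 1)) -
        Real.eulerMascheroniConstant : ℝ) : ℂ) + K (n + 1) := by
      rw [h3, h4] at h2
      push_cast
      linear_combination -h2
    rw [h5]
    refine (norm_add_le _ _).trans ?_
    rw [norm_real, Real.norm_eq_abs]
    gcongr
    have := norm_integral_cexp_mul_le hn (r := fun y => (1 - Real.exp (-y))⁻¹ - y⁻¹) (B := 1)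
      fun y hy => by
        have h := binet_kernel_mem hy
        rw [abs_of_nonneg h.1]; exact h.2
    have hre : ((n : ℂ) + 1).re = (n : ℝ) + 1 := by simp
    rw [hre] at this
    exact this
  have h0 := tendsto_nhds_unique hlim tendsto_const_nhds
  rw [key z hz, norm_eq_zero.mp h0.symm, add_zero]

lemma norm_digamma_le {z : ℂ} (hz : 0 < z.re) :
    ‖digamma z‖ ≤ ‖Complex.log z‖ + 1 / z.re := by
  rw [digamma_eq_log_sub hz]
  refine (norm_sub_le _ _).trans (add_le_add_right ?_ _)
  exact norm_integral_cexp_mul_le hz (r := fun y => (1 - Real.exp (-y))⁻¹ - y⁻¹) fun y hy => by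
    have h := binet_kernel_mem hy
    rw [abs_of_nonneg h.1]; exact h.2

lemma re_digamma_le {z : ℂ} (hz : 0 < z.re) :
    (digamma z).re ≤ Real.log ‖z‖ + (1 / 2) / z.re := by
  have h1 : ∫ y in Set.Ioi (0 : ℝ), cexp (-z * y) * ((1 - Real.exp (-y))⁻¹ - y⁻¹ : ℝ) =
      (1 / 2) * z⁻¹ +
        ∫ y in Set.Ioi (0 : ℝ), cexp (-z * y) * ((1 - Real.exp (-y))⁻¹ - y⁻¹ - 1 / 2 : ℝ) := by
    have h2 : ∫ y in Set.Ioi (0 : ℝ), cexp (-z * y) = z⁻¹ := by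
      rw [integral_exp_mul_complex_Ioi (by simpa using hz)]
      simp
    have h3 : ∀ y : ℝ, cexp (-z * y) * ((1 - Real.exp (-y))⁻¹ - y⁻¹ - 1 / 2 : ℝ) =
        cexp (-z * y) * ((1 - Real.exp (-y))⁻¹ - y⁻¹ : ℝ) - cexp (-z * y) * (1 / 2) := by
      intro y; push_cast; ring
    simp only [h3]
    rw [integral_sub (integrableOn_binet hz) ((integrableOn_cexp_neg hz).mul_const _),
      integral_mul_const, h2]
    ring
  have h4 := norm_integral_cexp_mul_le hz (r := fun y => (1 - Real.exp (-y))⁻¹ - y⁻¹ - 1 / 2)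
    (B := 1 / 2) fun y hy => by
      have h := binet_kernel_mem hy
      rw [abs_le]; constructor <;> linarith [h.1, h.2]
  have h5 := (abs_le.mp ((abs_re_le_norm _).trans h4)).1
  have h6 : 0 ≤ (1 / 2 * z⁻¹ : ℂ).re := by
    have : (1 / 2 * z⁻¹ : ℂ) = ((1 / 2 : ℝ) : ℂ) * z⁻¹ := by push_cast; ring
    rw [this, re_ofReal_mul, inv_re]
    have := Complex.normSq_nonneg z
    positivity
  rw [digamma_eq_log_sub hz, h1, sub_re, add_re, Complex.log_re]
  linarith

lemma exists_norm_digamma_le {δ : ℝ} (hδ : 0 < δ) :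
    ∃ C : ℝ, ∀ z : ℂ, δ ≤ z.re → ‖digamma z‖ ≤ C * (1 + ‖z‖) ^ (1 / 2 : ℝ) := by
  refine ⟨2 + |Real.log δ| + π + 1 / δ, fun z hz => ?_⟩
  have hz0 : 0 < z.re := hδ.trans_le hz
  have hzn : δ ≤ ‖z‖ := hz.trans ((le_abs_self _).trans (abs_re_le_norm z))
  have hn : 0 < ‖z‖ := hδ.trans_le hzn
  have h1 : 1 ≤ (1 + ‖z‖) ^ (1 / 2 : ℝ) := Real.one_le_rpow (by linarith) (by norm_num)
  have h2 : Real.log ‖z‖ ≤ 2 * (1 + ‖z‖) ^ (1 / 2 : ℝ) := by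
    have h3 := Real.log_le_rpow_div hn.le (ε := 1 / 2) (by norm_num)
    have h4 : ‖z‖ ^ (1 / 2 : ℝ) ≤ (1 + ‖z‖) ^ (1 / 2 : ℝ) :=
      Real.rpow_le_rpow hn.le (by linarith) (by norm_num)
    linarith
  have h3 : |Real.log ‖z‖| ≤ 2 * (1 + ‖z‖) ^ (1 / 2 : ℝ) + |Real.log δ| := by
    have h4 := Real.log_le_log hδ hzn
    rw [abs_le]
    constructor <;> linarith [neg_abs_le (Real.log δ), abs_nonneg (Real.log δ)]
  have h4 : ‖Complex.log z‖ ≤ |Real.log ‖z‖| + π := by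
    refine (norm_le_abs_re_add_abs_im _).trans ?_
    rw [log_re, log_im]
    linarith [abs_arg_le_pi z]
  have h5 : 1 / z.re ≤ 1 / δ := by gcongr
  have h6 := norm_digamma_le hz0
  have h7 : 0 ≤ |Real.log δ| + π + 1 / δ := by positivity
  nlinarith

lemma integrable_sqrt_mul_selbergKernel {b l : ℝ} (hl : 0 ≤ l) {s : ℂ} (hbs : b < s.re)
    (a : ℝ) :
    Integrable fun u : ℝ => (√‖(b + u * I + a) / 2 - 1‖ : ℂ) * selbergKernel l (b + u * I - s) := by
  have hne : ∀ w : ℂ, w.re = b → w - s ≠ 0 := fun w hw h => hbs.ne (by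
    rw [← hw, sub_eq_zero.mp h])
  have hd : 0 < s.re - b := sub_pos.mpr hbs
  refine integrable_vertical (F := fun w => (√‖(w + a) / 2 - 1‖ : ℂ) * selbergKernel l (w - s))
    (C := √(2 + |a|) * ((Real.exp (l * 0) + Real.exp (2 * l * 0)) *
      ((1 + ‖s‖) / (s.re - b) + 1) ^ 2)) ?_ ?_
  · refine Continuous.continuousOn ?_ |>.mul ?_
    · fun_prop
    · unfold selbergKernel
      exact ContinuousOn.div (by fun_prop) (by fun_prop) fun w hw => pow_ne_zero 2 (hne w hw)
  · intro w hw
    refine mul_bound_of_dist hd ?_ ?_ ?_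
    · refine le_trans ?_ (abs_re_le_norm _)
      rw [sub_re, hw, abs_sub_comm]
      exact le_abs_self _
    · rw [norm_real, Real.norm_of_nonneg (Real.sqrt_nonneg _), ← Real.sqrt_eq_rpow,
        ← Real.sqrt_mul (by positivity)]
      apply Real.sqrt_le_sqrt
      have h1 := norm_sub_le ((w + a) / 2) 1
      have h2 := norm_add_le w (a : ℂ)
      rw [norm_real, Real.norm_eq_abs] at h2
      rw [norm_div, norm_one] at h1
      have : ‖(2 : ℂ)‖ = 2 := by simp
      rw [this] at h1
      nlinarith [norm_nonneg w, abs_nonneg a, mul_nonneg (norm_nonneg w) (abs_nonneg a)]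
    · exact norm_selbergKernel_le hl (by rw [sub_re, hw]; linarith)

/-- The kernel integral of the archimedean factor. -/
lemma norm_integral_digamma_mul_selbergKernel_le {b l a : ℝ} (hl : 0 < l) (ha : 0 ≤ a) (hb : 0 < b)
    {s : ℂ} (hbs : b < s.re) :
    ‖∫ u : ℝ, digamma ((b + u * I + a) / 2) * selbergKernel l (b + u * I - s)‖ ≤
      2 * π * ((1 - Real.exp (-(2 * l)))⁻¹ * (2 * Real.exp (-(s.re * l)) / s.re ^ 2)) := by
  have hs0 : 0 < s.re := hb.trans hbs
  set k : ℝ → ℂ := fun u => selbergKernel l (b + u * I - s) with hk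
  set z : ℝ → ℂ := fun u => (b + u * I + a) / 2 with hz
  have hzre : ∀ u, (z u).re = (b + a) / 2 := fun u => by simp [hz]
  have hzpos : ∀ u, 0 < (z u).re := fun u => by rw [hzre]; positivity
  set h : ℝ → ℝ → ℂ := fun u y => (cexp (-1 * y) - cexp (-z u * y)) * ((1 - Real.exp (-y))⁻¹ : ℝ)
    with hh
  have hk0 : Integrable k := integrable_selbergKernel_sub hbs.ne l
  have hkint : ∫ u : ℝ, k u = 0 := by
    have h1 := integral_exp_mul_selbergKernel_sub b l 0 s
    rw [integral_selbergKernel_left (sub_neg.mpr hbs)] at h1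
    simpa [hk, hl.le] using h1
  have hke : ∀ y : ℝ, ∫ u : ℝ, cexp (-z u * y) * k u = cexp (-((s + a) / 2) * y) *
      (2 * π * (max 0 (y / 2 - l) - max 0 (y / 2 - 2 * l) : ℝ)) := by
    intro y
    rw [← integral_selbergKernel_left (sub_neg.mpr hbs), ← integral_exp_mul_selbergKernel_sub,
      ← integral_const_mul]
    congr 1
    ext u
    rw [← mul_assoc, ← Complex.exp_add]
    congr 2
    simp only [hz]
    push_cast
    ring
  have hkei : ∀ y : ℝ, Integrable fun u : ℝ => cexp (-z u * y) * k u := by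
    intro y
    refine (hk0.norm.const_mul (Real.exp (-((b + a) / 2) * y))).mono'
      (Measurable.aestronglyMeasurable ?_) (Filter.Eventually.of_forall fun u => ?_)
    · simp only [hk, hz]; unfold selbergKernel; fun_prop
    · rw [norm_mul, norm_cexp_neg_mul, hzre]
  set E : ℝ → ℝ := fun y => Real.exp (-(min ((b + a) / 2) 1) * y) * (√y * (1 + y⁻¹)) with hE
  have hEi : IntegrableOn E (Set.Ioi 0) :=
    integrableOn_exp_mul_sqrt (lt_min (by positivity) one_pos)
  have hprod : Integrable (Function.uncurry fun u y => h u y * k u)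
      (volume.prod (volume.restrict (Set.Ioi (0 : ℝ)))) := by
    have h1 := ((integrable_sqrt_mul_selbergKernel hl.le hbs a).norm.const_mul 2).mul_prod hEi
    refine h1.mono' (Measurable.aestronglyMeasurable ?_) ?_
    · simp only [hk, hz, hh, Function.uncurry_def]; unfold selbergKernel; fun_prop
    · have h2 : ∀ᵐ p : ℝ × ℝ ∂(volume.prod (volume.restrict (Set.Ioi (0 : ℝ)))), 0 < p.2 := by
        have h3 : ∀ᵐ y : ℝ ∂(volume.restrict (Set.Ioi (0 : ℝ))), 0 < y :=
          ae_restrict_mem measurableSet_Ioi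
        exact Measure.quasiMeasurePreserving_snd.ae h3
      filter_upwards [h2] with p hp
      have h3 := norm_exp_sub_div_le (z := 1) (w := z p.1) (m := min ((b + a) / 2) 1)
        (by simp) (by rw [hzre]; exact min_le_left _ _) hp
      rw [norm_sub_rev] at h3
      have e1 : ‖((√‖z p.1 - 1‖ : ℝ) : ℂ) * k p.1‖ = √‖z p.1 - 1‖ * ‖k p.1‖ := by
        rw [norm_mul, norm_real, Real.norm_of_nonneg (Real.sqrt_nonneg _)]
      change ‖h p.1 p.2 * k p.1‖ ≤ 2 * ‖((√‖z p.1 - 1‖ : ℝ) : ℂ) * k p.1‖ * E p.2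
      rw [e1, norm_mul]
      calc _ ≤ 2 * √‖z p.1 - 1‖ * E p.2 * ‖k p.1‖ :=
            mul_le_mul_of_nonneg_right h3 (norm_nonneg _)
        _ = _ := by ring
  have h1 : ∫ u : ℝ, digamma (z u) * k u = ∫ u : ℝ, ∫ y in Set.Ioi (0 : ℝ), h u y * k u := by
    have h2 : ∀ u, digamma (z u) * k u = -Real.eulerMascheroniConstant * k u +
        ∫ y in Set.Ioi (0 : ℝ), h u y * k u := by
      intro u
      rw [digamma_eq_integral (hzpos u), integral_mul_const]
      ring
    simp only [h2]
    have hpl : Integrable fun u => ∫ y in Set.Ioi (0 : ℝ), h u y * k u := hprod.integral_prod_left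
    rw [integral_add (hk0.const_mul _) hpl, integral_const_mul, hkint]
    simp
  have h2 : ∀ y : ℝ, ∫ u : ℝ, h u y * k u = -(cexp (-((s + a) / 2) * y) *
      (2 * π * (max 0 (y / 2 - l) - max 0 (y / 2 - 2 * l) : ℝ))) *
        ((1 - Real.exp (-y))⁻¹ : ℝ) := by
    intro y
    have h3 : ∀ u, h u y * k u = (cexp (-1 * y) * k u - cexp (-z u * y) * k u) *
        ((1 - Real.exp (-y))⁻¹ : ℝ) := fun u => by simp only [hh]; ring
    simp only [h3]
    rw [integral_mul_const, integral_sub (hk0.const_mul _) (hkei y), integral_const_mul, hkint,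
      hke, mul_zero, zero_sub]
  rw [h1, integral_integral_swap hprod]
  simp only [h2]
  set g : ℝ → ℝ := fun y => 2 * π * (1 - Real.exp (-(2 * l)))⁻¹ *
    (Real.exp (-(s.re * l)) * (((y - 2 * l) / 2) * Real.exp (-(s.re / 2) * (y - 2 * l)))) with hg
  have hvanish : ∀ y ∈ Set.Ioi (0 : ℝ) \ Set.Ioi (2 * l),
      -(cexp (-((s + a) / 2) * y) *
      (2 * π * (max 0 (y / 2 - l) - max 0 (y / 2 - 2 * l) : ℝ))) *
        ((1 - Real.exp (-y))⁻¹ : ℝ) = 0 := by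
    rintro y ⟨_, hy⟩
    have hy' : y ≤ 2 * l := not_lt.mp hy
    rw [max_eq_left (by linarith), max_eq_left (by linarith)]
    simp
  rw [setIntegral_eq_of_subset_of_forall_sdiff_eq_zero measurableSet_Ioi
    (Set.Ioi_subset_Ioi (by positivity)) hvanish]
  have hc : 0 < s.re / 2 := by positivity
  have hgi0 : IntegrableOn (fun y : ℝ => y * Real.exp (-(s.re / 2) * y)) (Set.Ioi 0) :=
    integrableOn_mul_exp_neg hc
  have hval0 : ∫ y in Set.Ioi (0 : ℝ), y * Real.exp (-(s.re / 2) * y) = ((s.re / 2) ^ 2)⁻¹ := by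
    have h3 := integral_mul_cexp_neg_Ioi (a := ((s.re / 2 : ℝ) : ℂ)) (by simpa using hs0)
    have h4 : ∀ y : ℝ, (y : ℂ) * cexp (-((s.re / 2 : ℝ) : ℂ) * y) =
        ((y * Real.exp (-(s.re / 2) * y) : ℝ) : ℂ) := fun y => by push_cast; rfl
    simp only [h4] at h3
    rw [integral_complex_ofReal] at h3
    exact_mod_cast h3
  have hgi : IntegrableOn g (Set.Ioi (2 * l)) ∧ ∫ y in Set.Ioi (2 * l), g y =
      2 * π * ((1 - Real.exp (-(2 * l)))⁻¹ * (2 * Real.exp (-(s.re * l)) / s.re ^ 2)) := by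
    have h3 : ∀ y, g y = (2 * π * (1 - Real.exp (-(2 * l)))⁻¹ * (Real.exp (-(s.re * l)) / 2)) *
        ((y - 2 * l) * Real.exp (-(s.re / 2) * (y - 2 * l))) := fun y => by simp only [hg]; ring
    rw [funext h3]
    have hmp := measurePreserving_sub_right (volume : Measure ℝ) (2 * l)
    have hme : MeasurableEmbedding fun y : ℝ => y - 2 * l :=
      (Homeomorph.subRight (2 * l)).measurableEmbedding
    have hpre : (fun y : ℝ => y - 2 * l) ⁻¹' Set.Ioi 0 = Set.Ioi (2 * l) := by simp
    constructor
    · refine Integrable.const_mul ?_ _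
      rw [← hpre]
      exact (hmp.integrableOn_comp_preimage hme).mpr hgi0
    · rw [integral_const_mul, ← hpre, hmp.setIntegral_preimage_emb hme
        (fun y : ℝ => y * Real.exp (-(s.re / 2) * y)), hval0]
      field_simp
      try ring
  rw [← hgi.2]
  refine norm_integral_le_of_norm_le hgi.1 ?_
  filter_upwards [ae_restrict_mem measurableSet_Ioi] with y (hy : 2 * l < y)
  have hy0 : 0 < y := by linarith
  have h5 : 0 ≤ y / 2 - l := by linarith
  have h6 : |max 0 (y / 2 - l) - max 0 (y / 2 - 2 * l)| ≤ y / 2 - l := by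
    rw [max_eq_right h5, abs_le]
    constructor
    · linarith [max_le h5 (by linarith : y / 2 - 2 * l ≤ y / 2 - l)]
    · linarith [le_max_left 0 (y / 2 - 2 * l)]
  have h7 := one_sub_exp_neg_pos (by positivity : 0 < 2 * l)
  rw [norm_mul, norm_neg, norm_mul, norm_cexp_neg_mul, norm_mul, norm_real, norm_real,
    Real.norm_eq_abs, Real.norm_of_nonneg (inv_pos.mpr (one_sub_exp_neg_pos hy0)).le]
  have h8 : ‖(2 * π : ℂ)‖ = 2 * π := by
    rw [norm_mul, norm_real, Real.norm_of_nonneg Real.pi_pos.le]; simp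
  have h9 : Real.exp (-((s + a) / 2).re * y) ≤
      Real.exp (-(s.re * l)) * Real.exp (-(s.re / 2) * (y - 2 * l)) := by
    rw [← Real.exp_add, Real.exp_le_exp]
    simp
    nlinarith
  rw [h8]
  have h10 : 0 ≤ 2 * π * (y / 2 - l) := mul_nonneg (by positivity) h5
  have h11 := one_sub_exp_neg_pos hy0
  calc _ ≤ (Real.exp (-(s.re * l)) * Real.exp (-(s.re / 2) * (y - 2 * l))) *
        (2 * π * (y / 2 - l)) * (1 - Real.exp (-(2 * l)))⁻¹ := by
        gcongr
    _ = g y := by simp only [hg]; ring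

theorem sum_range_add_eq_zero {q : ℕ} [NeZero q] {χ : DirichletCharacter ℂ q} (hχ : χ ≠ 1)
    (n : ℕ) : ∑ k ∈ Finset.range q, χ ((n + k : ℕ) : ZMod q) = 0 := by
  rw [← MulChar.sum_eq_zero_of_ne_one hχ, ← Equiv.sum_comp (Equiv.addLeft (n : ZMod q)) χ]
  refine Finset.sum_nbij' (fun k : ℕ => (k : ZMod q)) (fun a => a.val) ?_ ?_ ?_ ?_ ?_
  · simp
  · intro a _; simpa using ZMod.val_lt a
  · intro k hk; simpa using ZMod.val_cast_of_lt (Finset.mem_range.mp hk)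
  · intro a _; simp
  · intro k _; simp

theorem norm_sum_range_dirichletCharacter_le {q : ℕ} [NeZero q] {χ : DirichletCharacter ℂ q}
    (hχ : χ ≠ 1) (n : ℕ) : ‖∑ k ∈ Finset.range n, χ (k : ZMod q)‖ ≤ q := by
  have hper : Function.Periodic (fun n : ℕ => ∑ k ∈ Finset.range n, χ (k : ZMod q)) q := by
    intro n
    simp only [Finset.sum_range_add, sum_range_add_eq_zero hχ, add_zero]
  have h : ∑ k ∈ Finset.range (n % q), χ (k : ZMod q) = ∑ k ∈ Finset.range n, χ (k : ZMod q) :=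
    hper.map_mod_nat n
  rw [← h]
  calc _ ≤ ∑ k ∈ Finset.range (n % q), ‖χ (k : ZMod q)‖ := norm_sum_le _ _
    _ ≤ ∑ k ∈ Finset.range (n % q), 1 := Finset.sum_le_sum fun k _ => χ.norm_le_one _
    _ = (n % q : ℕ) := by simp
    _ ≤ q := by exact_mod_cast (Nat.mod_lt _ (NeZero.pos q)).le

theorem norm_sum_Icc_dirichletCharacter_le {q : ℕ} [NeZero q] {χ : DirichletCharacter ℂ q}
    (hq : 1 < q) (hχ : χ ≠ 1) (n : ℕ) : ‖∑ k ∈ Finset.Icc 1 n, χ (k : ZMod q)‖ ≤ q := by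
  have h := norm_sum_range_dirichletCharacter_le hχ (n + 1)
  have : Nontrivial (ZMod q) := ZMod.nontrivial_iff.mpr hq.ne'
  rw [Finset.sum_range_succ'] at h
  rw [Finset.range_eq_Ico, Finset.sum_Ico_add' (fun k : ℕ => χ (k : ZMod q)) 0 n 1] at h
  simp only [Nat.cast_zero, MulChar.map_zero, add_zero, zero_add] at h
  convert h using 3
  ext a
  simp

/-- `∫₁^∞ (∑_{k ≤ t} χ k) t^{-s-1} dt`, written as a Mellin transform. -/
theorem LFunction_eq_mul_mellin {q : ℕ} [NeZero q] {χ : DirichletCharacter ℂ q}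
    (hq : 1 < q) (hχ : χ ≠ 1) {s : ℂ} (hs : 0 < s.re) :
    DirichletCharacter.LFunction χ s = s * mellin
      ((Set.Ioi (1 : ℝ)).indicator fun t => ∑ k ∈ Finset.Icc 1 ⌊t⌋₊, χ (k : ZMod q)) (-s) := by
  set A : ℝ → ℂ := (Set.Ioi (1 : ℝ)).indicator
    fun t => ∑ k ∈ Finset.Icc 1 ⌊t⌋₊, χ (k : ZMod q) with hA
  have hAm : Measurable A := by
    refine Measurable.indicator ?_ measurableSet_Ioi
    exact (measurable_from_top (f := fun n : ℕ => ∑ k ∈ Finset.Icc 1 n, χ (k : ZMod q))).comp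
      Nat.measurable_floor
  have hAb : ∀ t, ‖A t‖ ≤ q := by
    intro t
    refine (norm_indicator_le_norm_self _ _).trans ?_
    exact norm_sum_Icc_dirichletCharacter_le hq hχ _
  have hdiff : ∀ w : ℂ, 0 < w.re → DifferentiableAt ℂ (fun w => w * mellin A (-w)) w := by
    intro w hw
    refine differentiableAt_id.mul ?_
    refine DifferentiableAt.comp w (g := mellin A) (f := fun w => -w) ?_ differentiableAt_id.neg
    refine mellin_differentiableAt_of_isBigO_rpow (a := 0) (b := -w.re - 1) ?_ ?_ ?_ ?_ ?_
    · refine LocallyIntegrable.locallyIntegrableOn ?_ _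
      refine LocallyIntegrable.mono (g := A) (f := fun _ : ℝ => (q : ℝ))
        (locallyIntegrable_const _) hAm.aestronglyMeasurable (Filter.Eventually.of_forall ?_)
      intro t
      simpa using hAb t
    · refine Asymptotics.IsBigO.of_bound q (Filter.Eventually.of_forall fun t => ?_)
      simpa using hAb t
    · simpa using hw
    · refine Asymptotics.IsBigO.of_bound 1 ?_
      filter_upwards [Ioo_mem_nhdsGT (zero_lt_one (α := ℝ))] with t ht
      have : A t = 0 := Set.indicator_of_notMem (by simpa using ht.2.le) _
      rw [this, norm_zero]; positivity
    · simp
  have hopen : IsOpen {w : ℂ | 0 < w.re} := isOpen_lt continuous_const continuous_re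
  have hconn : IsPreconnected {w : ℂ | 0 < w.re} := (convex_halfSpace_re_gt 0).isPreconnected
  have h1 : AnalyticOnNhd ℂ (DirichletCharacter.LFunction χ) {w : ℂ | 0 < w.re} :=
    ((DirichletCharacter.differentiable_LFunction hχ).differentiableOn).analyticOnNhd hopen
  have h2 : AnalyticOnNhd ℂ (fun w => w * mellin A (-w)) {w : ℂ | 0 < w.re} :=
    DifferentiableOn.analyticOnNhd (fun w hw => (hdiff w hw).differentiableWithinAt) hopen
  refine h1.eqOn_of_preconnected_of_eventuallyEq h2 hconn (z₀ := 2) (by simp) ?_ hs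
  filter_upwards [(isOpen_lt continuous_const continuous_re).mem_nhds
    (show (2 : ℂ) ∈ {w : ℂ | 1 < w.re} by simp)] with w (hw : 1 < w.re)
  rw [DirichletCharacter.LFunction_eq_LSeries χ hw]
  rw [LSeries_eq_mul_integral (fun n => χ (n : ZMod q)) le_rfl (by linarith)
    (DirichletCharacter.LSeriesSummable_of_one_lt_re χ hw)]
  · congr 1
    rw [mellin, ← integral_indicator measurableSet_Ioi, ← integral_indicator measurableSet_Ioi]
    congr 1
    funext t
    by_cases ht : 1 < t
    · rw [Set.indicator_of_mem (by exact ht), Set.indicator_of_mem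
        (by exact zero_lt_one.trans ht), hA, Set.indicator_of_mem (by exact ht), smul_eq_mul,
        mul_comm]
      congr 2
      ring
    · rw [Set.indicator_of_notMem (by simpa using ht)]
      have : A t = 0 := Set.indicator_of_notMem (by simpa using ht) _
      by_cases ht0 : 0 < t
      · rw [Set.indicator_of_mem (by exact ht0), this, smul_zero]
      · rw [Set.indicator_of_notMem (by simpa using ht0)]
  · refine Asymptotics.IsBigO.of_bound q (Filter.Eventually.of_forall fun n => ?_)
    simpa using norm_sum_Icc_dirichletCharacter_le hq hχ n

theorem norm_LFunction_le {q : ℕ} [NeZero q] {χ : DirichletCharacter ℂ q}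
    (hq : 1 < q) (hχ : χ ≠ 1) {s : ℂ} (hs : 0 < s.re) :
    ‖DirichletCharacter.LFunction χ s‖ ≤ q * ‖s‖ / s.re := by
  rw [LFunction_eq_mul_mellin hq hχ hs, norm_mul, mul_comm (q : ℝ), mul_div_assoc]
  refine mul_le_mul_of_nonneg_left ?_ (norm_nonneg _)
  have hi : IntegrableOn (fun t : ℝ => (q : ℝ) * t ^ (-s.re - 1)) (Set.Ioi 1) :=
    (integrableOn_Ioi_rpow_of_lt (by linarith) zero_lt_one).const_mul _
  have hv : ∫ t in Set.Ioi (1 : ℝ), (q : ℝ) * t ^ (-s.re - 1) = q / s.re := by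
    rw [integral_const_mul, integral_Ioi_rpow_of_lt (by linarith) zero_lt_one]
    simp
    field_simp
  rw [← hv, mellin, ← integral_indicator measurableSet_Ioi]
  rw [← integral_indicator measurableSet_Ioi]
  refine norm_integral_le_of_norm_le (hi.integrable_indicator measurableSet_Ioi)
    (Filter.Eventually.of_forall fun t => ?_)
  by_cases ht : 1 < t
  · have h0 : 0 < t := by linarith
    rw [Set.indicator_of_mem (by exact h0), Set.indicator_of_mem (by exact ht),
      Set.indicator_of_mem (by exact ht), norm_smul, norm_cpow_eq_rpow_re_of_pos h0, mul_comm]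
    refine mul_le_mul (norm_sum_Icc_dirichletCharacter_le hq hχ _) (le_of_eq ?_)
      (by positivity) (by positivity)
    simp
  · rw [Set.indicator_of_notMem (s := Set.Ioi 1) (by simpa using ht)]
    by_cases ht0 : 0 < t
    · rw [Set.indicator_of_mem (by exact ht0), Set.indicator_of_notMem (by simpa using ht),
        smul_zero, norm_zero]
    · rw [Set.indicator_of_notMem (by simpa using ht0), norm_zero]

theorem norm_LFunction_ge {q : ℕ} [NeZero q] (χ : DirichletCharacter ℂ q)
    {s : ℂ} (hs : 2 ≤ s.re) : 1 / 4 ≤ ‖DirichletCharacter.LFunction χ s‖ := by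
  have h1 : 1 < s.re := by linarith
  rw [DirichletCharacter.LFunction_eq_LSeries χ h1]
  have h2 := (DirichletCharacter.LSeriesSummable_of_one_lt_re χ h1).LSeriesHasSum
  have h3 : HasSum (fun n : ℕ => LSeries.term (fun n => χ (n : ZMod q)) s n -
      (if n = 1 then (1 : ℂ) else 0)) (LSeries (fun n => χ (n : ZMod q)) s - 1) :=
    HasSum.sub h2 (hasSum_ite_eq 1 1)
  have h4 : HasSum (fun n : ℕ => 1 / (n : ℝ) ^ 2 - (if n = 1 then (1 : ℝ) else 0))
      (π ^ 2 / 6 - 1) := hasSum_zeta_two.sub (hasSum_ite_eq 1 1)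
  have h5 : ‖LSeries (fun n => χ (n : ZMod q)) s - 1‖ ≤ π ^ 2 / 6 - 1 := by
    rw [← h3.tsum_eq]
    refine tsum_of_norm_bounded h4 fun n => ?_
    rcases eq_or_ne n 0 with rfl | hn0
    · simp
    rcases eq_or_ne n 1 with rfl | hn1
    · simp [LSeries.term]
    · rw [if_neg hn1, if_neg hn1, sub_zero, sub_zero, LSeries.norm_term_eq, if_neg hn0]
      have hn : (1 : ℝ) ≤ n := by exact_mod_cast Nat.one_le_iff_ne_zero.mpr hn0
      have h6 : (n : ℝ) ^ 2 ≤ (n : ℝ) ^ s.re := by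
        rw [← Real.rpow_natCast]
        exact Real.rpow_le_rpow_of_exponent_le hn (by simpa using hs)
      exact div_le_div₀ zero_le_one (χ.norm_le_one _) (by positivity) h6
  have h6 := norm_sub_norm_le (1 : ℂ) (1 - LSeries (fun n => χ (n : ZMod q)) s)
  rw [norm_sub_rev] at h5
  simp only [norm_one, sub_sub_cancel] at h6
  have h7 : π < 3.15 := Real.pi_lt_d2
  nlinarith [Real.pi_pos]

theorem exists_exp_eq_of_ne_zero {F : ℂ → ℂ} {c : ℂ} {r : ℝ} (hr : 0 < r)
    (hF : DifferentiableOn ℂ F (Metric.ball c r)) (hne : ∀ z ∈ Metric.ball c r, F z ≠ 0) :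
    ∃ g : ℂ → ℂ, g c = 0 ∧ ∀ z ∈ Metric.ball c r,
      HasDerivAt g (logDeriv F z) z ∧ F z = F c * cexp (g z) := by
  have hopen : IsOpen (Metric.ball c r) := Metric.isOpen_ball
  have hlog : DifferentiableOn ℂ (logDeriv F) (Metric.ball c r) := by
    refine DifferentiableOn.div ?_ hF hne
    exact hF.deriv hopen
  obtain ⟨g, hgc, hg⟩ := hlog.isExactOn_ball.with_val_at c 0
  refine ⟨g, hgc, fun z hz => ⟨hg z hz, ?_⟩⟩
  have hd : ∀ z ∈ Metric.ball c r, HasDerivAt (fun z => F z * cexp (-g z)) 0 z := by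
    intro z hz
    have h1 := (hF.differentiableAt (hopen.mem_nhds hz)).hasDerivAt
    refine (h1.mul (hg z hz).neg.cexp).congr_deriv ?_
    rw [logDeriv_apply]
    field_simp [hne z hz]
    simp
  have h2 := (convex_ball c r).is_const_of_fderivWithin_eq_zero (𝕜 := ℂ)
    (f := fun z => F z * cexp (-g z))
    (fun z hz => (hd z hz).differentiableAt.differentiableWithinAt)
    (fun z hz => by
      rw [fderivWithin_of_isOpen hopen hz]
      ext
      simpa using (hd z hz).deriv)
    hz (Metric.mem_ball_self hr)
  simp only [hgc, neg_zero, Complex.exp_zero, mul_one] at h2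
  rw [← h2, mul_assoc, ← Complex.exp_add, neg_add_cancel, Complex.exp_zero, mul_one]

theorem LFunction_ne_zero_of_half_lt_re {q : ℕ} [NeZero q] {χ : DirichletCharacter ℂ q}
    (hχ : χ ≠ 1) (hG : GRH χ) {s : ℂ} (hs : 1 / 2 < s.re) :
    DirichletCharacter.LFunction χ s ≠ 0 := by
  intro h
  by_cases h1 : s.re < 1
  · have := hG s h (by linarith) h1
    linarith
  · exact DirichletCharacter.LFunction_ne_zero_of_one_le_re χ (Or.inl hχ) (not_lt.mp h1) h

theorem exists_norm_logDeriv_LFunction_le {q : ℕ} [NeZero q] {χ : DirichletCharacter ℂ q}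
    (hq : 1 < q) (hχ : χ ≠ 1) (hG : GRH χ) {b : ℝ} (hb : 1 / 2 < b) (hb1 : b ≤ 1) :
    ∃ C : ℝ, 0 < C ∧ ∀ w : ℂ, b ≤ w.re →
      ‖logDeriv (DirichletCharacter.LFunction χ) w‖ ≤ C * (1 + ‖w‖) ^ (1 / 2 : ℝ) ∧
      ‖(DirichletCharacter.LFunction χ w)⁻¹‖ ≤ Real.exp (C * (1 + ‖w‖) ^ (1 / 2 : ℝ)) := by
  set L := DirichletCharacter.LFunction χ with hL
  set d : ℝ := (b - 1 / 2) / 2 with hd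
  have hd0 : 0 < d := by rw [hd]; linarith
  have hd1 : d < 3 / 2 := by rw [hd]; linarith
  set K : ℝ := 2 * (32 * (q : ℝ)) ^ (1 / 2 : ℝ) with hK
  have hqr : (1 : ℝ) < q := by exact_mod_cast hq
  have hK0 : 0 < K := by positivity
  set K₂ : ℝ := 2 * K * (3 / 2 - d) / d with hK₂
  have hK₂0 : 0 ≤ K₂ := div_nonneg (mul_nonneg (by positivity) (by linarith)) hd0.le
  refine ⟨K₂ / d + K₂ + 2, by positivity, fun w hw => ?_⟩
  set z₀ : ℂ := ⟨max 2 w.re, w.im⟩ with hz₀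
  have hz₀re : 2 ≤ z₀.re := le_max_left _ _
  have hdist : ‖w - z₀‖ ≤ 2 - b := by
    have : w - z₀ = ((w.re - max 2 w.re : ℝ) : ℂ) := by
      apply Complex.ext <;> simp [hz₀]
    rw [this, norm_real, Real.norm_eq_abs, abs_le]
    rcases le_total 2 w.re with h | h
    · rw [max_eq_right h]; constructor <;> linarith
    · rw [max_eq_left h]; constructor <;> linarith
  have hne : ∀ z ∈ Metric.ball z₀ (3 / 2), 1 / 2 < z.re := by
    intro z hz
    rw [Metric.mem_ball, dist_eq_norm] at hz
    have := (abs_le.mp (abs_re_le_norm (z - z₀))).1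
    rw [sub_re] at this
    linarith
  have hLd : Differentiable ℂ L := DirichletCharacter.differentiable_LFunction hχ
  obtain ⟨g, hg0, hg⟩ := exists_exp_eq_of_ne_zero (F := L) (c := z₀) (r := 3 / 2) (by norm_num)
    hLd.differentiableOn (fun z hz => LFunction_ne_zero_of_half_lt_re hχ hG (hne z hz))
  set P : ℝ := (1 + ‖w‖) ^ (1 / 2 : ℝ) with hP
  have hP1 : 1 ≤ P := Real.one_le_rpow (by linarith [norm_nonneg w]) (by norm_num)
  set M : ℝ := K * P with hM
  have hM0 : 0 < M := by positivity
  have hlow : 1 / 4 ≤ ‖L z₀‖ := norm_LFunction_ge χ hz₀re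
  have hL0 : L z₀ ≠ 0 := norm_pos_iff.mp (by linarith)
  have hre : ∀ z ∈ Metric.ball z₀ (3 / 2), (g z).re ≤ M := by
    intro z hz
    have h1 : ‖L z‖ = ‖L z₀‖ * Real.exp (g z).re := by
      rw [(hg z hz).2, norm_mul, Complex.norm_exp]
    have h2 : ‖L z‖ ≤ 8 * q * (1 + ‖w‖) := by
      have h3 := norm_LFunction_le hq hχ (by linarith [hne z hz] : 0 < z.re)
      have h4 : ‖z‖ ≤ 4 * (1 + ‖w‖) := by
        rw [Metric.mem_ball, dist_eq_norm] at hz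
        have h5 : ‖z‖ ≤ ‖z - z₀‖ + ‖w - z₀‖ + ‖w‖ := by
          have : z = (z - z₀) - (w - z₀) + w := by ring
          calc ‖z‖ = ‖(z - z₀) - (w - z₀) + w‖ := by rw [← this]
            _ ≤ _ := (norm_add_le _ _).trans (add_le_add (norm_sub_le _ _) le_rfl)
        linarith [norm_nonneg w]
      refine h3.trans ?_
      rw [div_le_iff₀ (by linarith [hne z hz])]
      calc (q : ℝ) * ‖z‖ ≤ q * (4 * (1 + ‖w‖)) := by gcongr
        _ = 8 * q * (1 + ‖w‖) * (1 / 2) := by ring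
        _ ≤ _ := by
          refine mul_le_mul_of_nonneg_left (hne z hz).le (by positivity)
    have h3 : Real.exp (g z).re ≤ 32 * q * (1 + ‖w‖) := by
      have := mul_le_mul_of_nonneg_right hlow (Real.exp_pos (g z).re).le
      linarith
    have h4 : (g z).re ≤ Real.log (32 * q * (1 + ‖w‖)) :=
      (Real.le_log_iff_exp_le (by positivity)).mpr h3
    refine h4.trans ((Real.log_le_rpow_div (by positivity)
      (by norm_num : (0 : ℝ) < 1 / 2)).trans (le_of_eq ?_))
    rw [Real.mul_rpow (by positivity) (by positivity), hM, hK, hP]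
    ring
  have hgd : DifferentiableOn ℂ g (Metric.ball z₀ (3 / 2)) :=
    fun z hz => (hg z hz).1.differentiableAt.differentiableWithinAt
  have hgb : ∀ z, ‖z - z₀‖ ≤ 3 / 2 - d → ‖g z‖ ≤ K₂ * P := by
    intro z hz
    have hmap : ∀ u ∈ Metric.ball (0 : ℂ) (3 / 2), u + z₀ ∈ Metric.ball z₀ (3 / 2) := by
      intro u hu
      simpa [Metric.mem_ball, dist_eq_norm] using hu
    have h1 := Complex.borelCaratheodory_zero (f := fun u => g (u + z₀)) (M := M) (R := 3 / 2)
      (z := z - z₀) hM0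
      (hgd.comp (differentiable_id.add_const z₀).differentiableOn hmap)
      (fun u hu => hre _ (hmap u hu)) (by norm_num)
      (by rw [Metric.mem_ball, dist_zero_right]; linarith) (by simpa using hg0)
    simp only [sub_add_cancel] at h1
    refine h1.trans ?_
    calc 2 * M * ‖z - z₀‖ / (3 / 2 - ‖z - z₀‖) ≤ 2 * M * (3 / 2 - d) / d := by
          refine div_le_div₀ (mul_nonneg (by positivity) (by linarith)) ?_ hd0 (by linarith)
          exact mul_le_mul_of_nonneg_left hz (by positivity)
      _ = K₂ * P := by rw [hK₂, hM]; ring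
  have hwb : w ∈ Metric.ball z₀ (3 / 2) := by
    rw [Metric.mem_ball, dist_eq_norm]; linarith
  constructor
  · rw [← (hg w hwb).1.deriv]
    have h1 : ‖deriv g w‖ ≤ K₂ * P / d := by
      refine Complex.norm_deriv_le_of_forall_mem_sphere_norm_le hd0 ?_ ?_
      · refine DifferentiableOn.diffContOnCl (hgd.mono ?_)
        refine (Metric.closure_ball_subset_closedBall).trans ?_
        intro z hz
        rw [Metric.mem_closedBall, dist_eq_norm] at hz
        rw [Metric.mem_ball, dist_eq_norm]
        have := norm_add_le (z - w) (w - z₀)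
        rw [sub_add_sub_cancel] at this
        linarith
      · intro z hz
        rw [mem_sphere_iff_norm] at hz
        refine hgb z ?_
        have := norm_add_le (z - w) (w - z₀)
        rw [sub_add_sub_cancel] at this
        linarith
    refine h1.trans ?_
    rw [mul_div_right_comm]
    refine mul_le_mul_of_nonneg_right ?_ (by positivity)
    linarith
  · rw [(hg w hwb).2, mul_inv, ← Complex.exp_neg, norm_mul, norm_inv, Complex.norm_exp]
    have h1 : ‖L z₀‖⁻¹ ≤ Real.exp 2 := by
      have h2 : ‖L z₀‖⁻¹ ≤ 4 := by
        rw [inv_le_comm₀ (by linarith) (by norm_num)]; linarith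
      have h3 : (4 : ℝ) ≤ Real.exp 2 := by
        have := Real.exp_one_gt_d9
        rw [show (2 : ℝ) = 1 + 1 by norm_num, Real.exp_add]
        nlinarith
      linarith
    have h2 : (-g w).re ≤ K₂ * P := by
      refine (re_le_norm _).trans ?_
      rw [norm_neg]
      exact hgb w (by linarith)
    calc _ ≤ Real.exp 2 * Real.exp (K₂ * P) := by gcongr
      _ = Real.exp (2 + K₂ * P) := by rw [Real.exp_add]
      _ ≤ _ := by
        rw [Real.exp_le_exp]
        have : 0 ≤ K₂ / d := by positivity
        nlinarith

theorem exists_gammaFactor_eq {q : ℕ} (χ : DirichletCharacter ℂ q) :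
    ∃ a : ℝ, (a = 0 ∨ a = 1) ∧ (∀ s, χ.gammaFactor s = Gammaℝ (s + a)) ∧
      ∀ s, χ⁻¹.gammaFactor s = Gammaℝ (s + a) := by
  rcases χ.even_or_odd with h | h
  · have h' : χ⁻¹.Even := by
      change χ⁻¹ (-1) = 1
      rw [← MulChar.star_apply', show χ (-1) = 1 from h, star_one]
    refine ⟨0, Or.inl rfl, fun s => ?_, fun s => ?_⟩
    · simp [h.gammaFactor_def]
    · simp [h'.gammaFactor_def]
  · have h' : χ⁻¹.Odd := by
      change χ⁻¹ (-1) = -1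
      rw [← MulChar.star_apply', show χ (-1) = -1 from h, star_neg, star_one]
    refine ⟨1, Or.inr rfl, fun s => ?_, fun s => ?_⟩
    · simp [h.gammaFactor_def]
    · simp [h'.gammaFactor_def]

theorem completedLFunction_eq_mul {q : ℕ} [NeZero q] {χ : DirichletCharacter ℂ q} {a : ℝ}
    (ha : 0 ≤ a) (hγ : ∀ s, χ.gammaFactor s = Gammaℝ (s + a)) {s : ℂ} (hs : 0 < s.re) :
    DirichletCharacter.completedLFunction χ s
      = DirichletCharacter.LFunction χ s * Gammaℝ (s + a) := by
  have h0 : s ≠ 0 := fun h => by simp [h] at hs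
  rw [DirichletCharacter.LFunction_eq_completed_div_gammaFactor χ s (Or.inl h0), hγ,
    div_mul_cancel₀]
  exact Gammaℝ_ne_zero_of_re_pos (by simp; linarith)

theorem Gammaℝ_conj (s : ℂ) : Gammaℝ ((starRingEnd ℂ) s) = (starRingEnd ℂ) (Gammaℝ s) := by
  have h1 : -(starRingEnd ℂ) s / 2 = (starRingEnd ℂ) (-s / 2) := by
    rw [map_div₀, map_neg, map_ofNat]
  have h2 : (starRingEnd ℂ) s / 2 = (starRingEnd ℂ) (s / 2) := by rw [map_div₀, map_ofNat]
  rw [Gammaℝ_def, Gammaℝ_def, h1, h2, Complex.Gamma_conj, cpow_conj, conj_ofReal,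
    _root_.map_mul]
  rw [arg_ofReal_of_nonneg Real.pi_pos.le]
  exact Real.pi_pos.ne

theorem LFunction_inv_eq_conj {q : ℕ} [NeZero q] (χ : DirichletCharacter ℂ q) {s : ℂ}
    (hs : 1 < s.re) : DirichletCharacter.LFunction χ⁻¹ s
      = (starRingEnd ℂ) (DirichletCharacter.LFunction χ ((starRingEnd ℂ) s)) := by
  rw [DirichletCharacter.LFunction_eq_LSeries _ hs,
    DirichletCharacter.LFunction_eq_LSeries _ (by simpa using hs), LSeries, LSeries, conj_tsum]
  congr 1
  funext n
  simp only [LSeries.term]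
  split_ifs with hn
  · simp
  · rw [map_div₀, ← MulChar.star_apply', cpow_conj, conj_conj, conj_natCast]
    · rfl
    · rw [natCast_arg]
      exact Real.pi_pos.ne

theorem completedLFunction_inv_eq_conj {q : ℕ} [NeZero q] {χ : DirichletCharacter ℂ q}
    (hχ : χ ≠ 1) (s : ℂ) : DirichletCharacter.completedLFunction χ⁻¹ s
      = (starRingEnd ℂ) (DirichletCharacter.completedLFunction χ ((starRingEnd ℂ) s)) := by
  obtain ⟨a, ha, hγ, hγ'⟩ := exists_gammaFactor_eq χ
  have ha0 : 0 ≤ a := by rcases ha with rfl | rfl <;> norm_num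
  have h1 : Differentiable ℂ (DirichletCharacter.completedLFunction χ⁻¹) :=
    DirichletCharacter.differentiable_completedLFunction (inv_ne_one.mpr hχ)
  have h2 : Differentiable ℂ ((starRingEnd ℂ) ∘ DirichletCharacter.completedLFunction χ ∘
      (starRingEnd ℂ)) := by
    intro z
    have := ((DirichletCharacter.differentiable_completedLFunction hχ)
      ((starRingEnd ℂ) z)).conj_conj
    rwa [conj_conj] at this
  have h3 := h1.differentiableOn.analyticOnNhd isOpen_univ
  have h4 := h2.differentiableOn.analyticOnNhd isOpen_univ
  refine h3.eqOn_of_preconnected_of_eventuallyEq h4 isPreconnected_univ (Set.mem_univ 2) ?_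
    (Set.mem_univ s)
  filter_upwards [(isOpen_lt continuous_const continuous_re).mem_nhds
    (show (2 : ℂ) ∈ {w : ℂ | 1 < w.re} by simp)] with w (hw : 1 < w.re)
  rw [Function.comp_apply, Function.comp_apply,
    completedLFunction_eq_mul ha0 hγ' (by linarith),
    completedLFunction_eq_mul ha0 hγ (by simp; linarith), LFunction_inv_eq_conj χ hw,
    _root_.map_mul, ← Gammaℝ_conj]
  simp

theorem norm_completedLFunction_one_sub_conj_aux {q : ℕ} [NeZero q] {χ : DirichletCharacter ℂ q}
    (hp : χ.IsPrimitive) (hχ : χ ≠ 1) (s : ℂ) :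
    ‖DirichletCharacter.completedLFunction χ (1 - (starRingEnd ℂ) s)‖
      = (q : ℝ) ^ (s.re - 1 / 2) * ‖χ.rootNumber‖ *
        ‖DirichletCharacter.completedLFunction χ s‖ := by
  rw [hp.completedLFunction_one_sub, completedLFunction_inv_eq_conj hχ, conj_conj, norm_mul,
    norm_mul, norm_conj, norm_natCast_cpow_of_pos (NeZero.pos q)]
  simp

theorem norm_rootNumber {q : ℕ} [NeZero q] {χ : DirichletCharacter ℂ q}
    (hp : χ.IsPrimitive) (hχ : χ ≠ 1) : ‖χ.rootNumber‖ = 1 := by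
  obtain ⟨a, ha, hγ, -⟩ := exists_gammaFactor_eq χ
  have ha0 : 0 ≤ a := by rcases ha with rfl | rfl <;> norm_num
  have h1 := norm_completedLFunction_one_sub_conj_aux hp hχ 2
  have h2 := norm_completedLFunction_one_sub_conj_aux hp hχ (-1)
  have h3 : DirichletCharacter.completedLFunction χ 2 ≠ 0 := by
    rw [completedLFunction_eq_mul ha0 hγ (by simp)]
    refine mul_ne_zero
      (DirichletCharacter.LFunction_ne_zero_of_one_le_re χ (Or.inl hχ) (by simp)) ?_
    exact Gammaℝ_ne_zero_of_re_pos (by simp; linarith)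
  have e1 : (1 : ℂ) - (starRingEnd ℂ) 2 = -1 := by rw [map_ofNat]; norm_num
  have e2 : (1 : ℂ) - (starRingEnd ℂ) (-1) = 2 := by rw [map_neg, _root_.map_one]; norm_num
  rw [e1] at h1
  rw [e2, h1] at h2
  have hq : (0 : ℝ) < q := by exact_mod_cast NeZero.pos q
  have h4 : (q : ℝ) ^ ((-1 : ℂ).re - 1 / 2) * (q : ℝ) ^ ((2 : ℂ).re - 1 / 2) = 1 := by
    rw [← Real.rpow_add hq]
    norm_num
  have h5 : ‖DirichletCharacter.completedLFunction χ 2‖ * (‖χ.rootNumber‖ ^ 2 - 1) = 0 := by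
    linear_combination (-1 : ℝ) * h2 - ‖χ.rootNumber‖ ^ 2 *
      ‖DirichletCharacter.completedLFunction χ 2‖ * h4
  rcases mul_eq_zero.mp h5 with h | h
  · exact absurd (norm_eq_zero.mp h) h3
  · have := norm_nonneg χ.rootNumber
    nlinarith

theorem norm_completedLFunction_one_sub_conj {q : ℕ} [NeZero q] {χ : DirichletCharacter ℂ q}
    (hp : χ.IsPrimitive) (hχ : χ ≠ 1) (s : ℂ) :
    ‖DirichletCharacter.completedLFunction χ (1 - (starRingEnd ℂ) s)‖
      = (q : ℝ) ^ (s.re - 1 / 2) * ‖DirichletCharacter.completedLFunction χ s‖ := by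
  rw [norm_completedLFunction_one_sub_conj_aux hp hχ, norm_rootNumber hp hχ, mul_one]

/-- A ratio of nearby values of the Gamma function is bounded on half-planes. -/
theorem exists_norm_Gamma_div_Gamma_le {d x₀ : ℝ} (hd : 0 < d) (hx : 0 < x₀) :
    ∃ C : ℝ, 0 < C ∧ ∀ z : ℂ, x₀ ≤ z.re →
      ‖Complex.Gamma z / Complex.Gamma (z + d)‖ ≤ C := by
  have hx' : 0 < (x₀ : ℂ).re := by simpa using hx
  have hi := (betaIntegral_eq_integral_exp hx' hd).1.norm
  set K := ∫ y in Set.Ioi (0 : ℝ), ‖cexp (-(x₀ : ℂ) * y) * ((1 - rexp (-y)) ^ (d - 1) : ℝ)‖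
    with hK
  have hK0 : 0 ≤ K := integral_nonneg fun y => norm_nonneg _
  have hG : Complex.Gamma (d : ℂ) ≠ 0 := Complex.Gamma_ne_zero_of_re_pos (by simpa using hd)
  refine ⟨K / ‖Complex.Gamma (d : ℂ)‖ + 1, by positivity, fun z hz => ?_⟩
  have hz0 : 0 < z.re := by linarith
  have h1 := Complex.betaIntegral_eq_Gamma_mul_div z d hz0 (by simpa using hd)
  have h2 : Complex.Gamma z / Complex.Gamma (z + d)
      = z.betaIntegral d / Complex.Gamma (d : ℂ) := by
    rw [h1]
    have : Complex.Gamma (z + d) ≠ 0 := Complex.Gamma_ne_zero_of_re_pos (by simp; linarith)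
    field_simp
  have h3 : ‖z.betaIntegral d‖ ≤ K := by
    rw [(betaIntegral_eq_integral_exp hz0 hd).2]
    refine norm_integral_le_of_norm_le hi ?_
    filter_upwards [ae_restrict_mem measurableSet_Ioi] with y (hy : 0 < y)
    rw [norm_mul, norm_mul, norm_cexp_neg_mul, norm_cexp_neg_mul]
    refine mul_le_mul_of_nonneg_right ?_ (norm_nonneg _)
    rw [Real.exp_le_exp, ofReal_re]
    nlinarith
  rw [h2, norm_div]
  refine (div_le_div_of_nonneg_right h3 (norm_nonneg _)).trans ?_
  linarith

theorem completedLFunction_ne_zero {q : ℕ} [NeZero q] {χ : DirichletCharacter ℂ q}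
    (hχ : χ ≠ 1) (hG : GRH χ) {s : ℂ} (hs : 1 / 2 < s.re) :
    DirichletCharacter.completedLFunction χ s ≠ 0 := by
  obtain ⟨a, ha, hγ, -⟩ := exists_gammaFactor_eq χ
  have ha0 : 0 ≤ a := by rcases ha with rfl | rfl <;> norm_num
  rw [completedLFunction_eq_mul ha0 hγ (by linarith)]
  exact mul_ne_zero (LFunction_ne_zero_of_half_lt_re hχ hG hs)
    (Gammaℝ_ne_zero_of_re_pos (by simp; linarith))

/-- Growth bounds for the ratio of the completed L-function at two points `s ± d`. -/
theorem exists_norm_completedLFunction_div_le {q : ℕ} [NeZero q] {χ : DirichletCharacter ℂ q}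
    (hq : 1 < q) (hχ : χ ≠ 1) {d : ℝ} (hd : 0 < d) (hd1 : d ≤ 1 / 4) :
    ∃ C : ℝ, 0 < C ∧ ∀ s : ℂ, 1 / 2 ≤ s.re →
      ‖DirichletCharacter.completedLFunction χ (s - d) /
        DirichletCharacter.completedLFunction χ (s + d)‖ ≤
      C * (‖s - d‖ / (s - d).re) * ‖(DirichletCharacter.LFunction χ (s + d))⁻¹‖ := by
  obtain ⟨a, ha, hγ, -⟩ := exists_gammaFactor_eq χ
  have ha0 : 0 ≤ a := by rcases ha with rfl | rfl <;> norm_num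
  obtain ⟨C, hC, hCb⟩ := exists_norm_Gamma_div_Gamma_le hd (by norm_num : (0 : ℝ) < 1 / 8)
  have hq0 : (0 : ℝ) < q := by exact_mod_cast NeZero.pos q
  refine ⟨q * (C * ‖(π : ℂ) ^ (d : ℂ)‖ + 1), by positivity, fun s hs => ?_⟩
  have h1 : (s - d).re = s.re - d := by simp
  have h2 : (s + d).re = s.re + d := by simp
  rw [completedLFunction_eq_mul ha0 hγ (by linarith : 0 < (s - d).re),
    completedLFunction_eq_mul ha0 hγ (by linarith : 0 < (s + d).re)]
  have h3 : Gammaℝ (s - d + a) / Gammaℝ (s + d + a) = (π : ℂ) ^ (d : ℂ) *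
      (Complex.Gamma ((s - d + a) / 2) / Complex.Gamma ((s - d + a) / 2 + d)) := by
    rw [Gammaℝ_def, Gammaℝ_def, mul_div_mul_comm, ← cpow_sub _ _ (by exact_mod_cast pi_ne_zero)]
    congr 2
    · ring
    · congr 1; ring
  have h4 : ‖Complex.Gamma ((s - d + a) / 2) / Complex.Gamma ((s - d + a) / 2 + d)‖ ≤ C := by
    refine hCb _ ?_
    have : ((s - d + a) / 2).re = (s.re - d + a) / 2 := by simp
    rw [this]; linarith
  rw [mul_div_mul_comm, h3, div_eq_mul_inv (DirichletCharacter.LFunction χ _), norm_mul, norm_mul,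
    norm_mul]
  have h5 := norm_LFunction_le hq hχ (by linarith : 0 < (s - d).re)
  have h6 : ‖(π : ℂ) ^ (d : ℂ)‖ * ‖Complex.Gamma ((s - d + a) / 2) /
      Complex.Gamma ((s - d + a) / 2 + d)‖ ≤ C * ‖(π : ℂ) ^ (d : ℂ)‖ + 1 := by
    nlinarith [norm_nonneg ((π : ℂ) ^ (d : ℂ))]
  have h7 : 0 ≤ ‖s - d‖ / (s - d).re := div_nonneg (norm_nonneg _) (by linarith)
  calc _ ≤ (q * ‖s - d‖ / (s - d).re) * ‖(DirichletCharacter.LFunction χ (s + d))⁻¹‖ *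
        (C * ‖(π : ℂ) ^ (d : ℂ)‖ + 1) := by
        refine mul_le_mul (mul_le_mul_of_nonneg_right h5 (norm_nonneg _)) h6 (by positivity) ?_
        rw [mul_div_assoc]
        positivity
    _ = _ := by ring

open Filter Asymptotics Bornology in
theorem norm_completedLFunction_sub_le {q : ℕ} [NeZero q] {χ : DirichletCharacter ℂ q}
    (hp : χ.IsPrimitive) (hq : 1 < q) (hχ : χ ≠ 1) (hG : GRH χ) {d : ℝ} (hd : 0 < d)
    (hd1 : d ≤ 1 / 4) {s : ℂ} (hs : 1 / 2 ≤ s.re) :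
    ‖DirichletCharacter.completedLFunction χ (s - d)‖ ≤
      (q : ℝ) ^ d * ‖DirichletCharacter.completedLFunction χ (s + d)‖ := by
  set X := DirichletCharacter.completedLFunction χ with hX
  set F : ℂ → ℂ := fun z => X (1 / 2 + z - d) / X (1 / 2 + z + d) with hF
  have hXd : Differentiable ℂ X := DirichletCharacter.differentiable_completedLFunction hχ
  have hne : ∀ z : ℂ, 0 ≤ z.re → X (1 / 2 + z + d) ≠ 0 := by
    intro z hz
    refine completedLFunction_ne_zero hχ hG ?_
    simp; linarith
  obtain ⟨C₁, hC₁, h₁⟩ := exists_norm_completedLFunction_div_le hq hχ hd hd1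
  obtain ⟨C₂, hC₂, h₂⟩ := exists_norm_logDeriv_LFunction_le hq hχ hG
    (by linarith : 1 / 2 < 1 / 2 + d) (by linarith)
  have hmain : ∀ z : ℂ, 0 ≤ z.re → ‖F z‖ ≤ (q : ℝ) ^ d := by
    intro z hz
    refine PhragmenLindelof.right_half_plane_of_bounded_on_real ?_ ?_ ?_ ?_ hz
    · refine DifferentiableOn.diffContOnCl fun w hw => ?_
      have hw' : 0 ≤ w.re := by
        have := closure_lt_subset_le continuous_const continuous_re hw
        exact this
      refine DifferentiableAt.differentiableWithinAt (DifferentiableAt.div ?_ ?_ (hne w hw'))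
      · exact (hXd _).comp w ((differentiableAt_id.const_add _).sub_const _)
      · exact (hXd _).comp w ((differentiableAt_id.const_add _).add_const _)
    · refine ⟨1, by norm_num, C₂ + 1, ?_⟩
      refine IsBigO.of_bound (C₁ * 4 * Real.exp 1 * Real.exp (2 * C₂)) ?_
      refine eventually_inf_principal.mpr (Eventually.of_forall fun w (hw : 0 < w.re) => ?_)
      have hs1 : 1 / 2 ≤ (1 / 2 + w).re := by simp; linarith
      have hs2 : 1 / 2 + d ≤ (1 / 2 + w + d).re := by simp; linarith
      have e1 := h₁ (1 / 2 + w) hs1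
      have e2 := (h₂ _ hs2).2
      rw [Real.rpow_one, Real.norm_of_nonneg (Real.exp_pos _).le]
      have n1 : ‖1 / 2 + w - d‖ ≤ 1 + ‖w‖ := by
        have : (1 / 2 + w - d : ℂ) = ((1 / 2 - d : ℝ) : ℂ) + w := by push_cast; ring
        rw [this]
        refine (norm_add_le _ _).trans ?_
        rw [norm_real, Real.norm_of_nonneg (by linarith)]
        linarith
      have n2 : ‖1 / 2 + w + d‖ ≤ 1 + ‖w‖ := by
        have : (1 / 2 + w + d : ℂ) = ((1 / 2 + d : ℝ) : ℂ) + w := by push_cast; ring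
        rw [this]
        refine (norm_add_le _ _).trans ?_
        rw [norm_real, Real.norm_of_nonneg (by linarith)]
        linarith
      have n3 : ‖1 / 2 + w - d‖ / (1 / 2 + w - d).re ≤ 4 * (Real.exp 1 * Real.exp ‖w‖) := by
        have : 1 / 4 ≤ (1 / 2 + w - d).re := by simp; linarith
        rw [div_le_iff₀ (by linarith), ← Real.exp_add]
        have h5 := Real.add_one_le_exp (1 + ‖w‖)
        have h6 := Real.exp_pos (1 + ‖w‖)
        nlinarith
      have n4 : (1 + ‖1 / 2 + w + d‖) ^ (1 / 2 : ℝ) ≤ 2 + ‖w‖ := by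
        have h5 : 1 ≤ 1 + ‖1 / 2 + w + d‖ := by linarith [norm_nonneg (1 / 2 + w + d)]
        have h6 := Real.rpow_le_rpow_of_exponent_le h5 (by norm_num : (1 / 2 : ℝ) ≤ 1)
        rw [Real.rpow_one] at h6
        linarith
      have n5 : ‖(DirichletCharacter.LFunction χ (1 / 2 + w + d))⁻¹‖ ≤
          Real.exp (2 * C₂) * Real.exp (C₂ * ‖w‖) := by
        refine e2.trans ?_
        rw [← Real.exp_add, Real.exp_le_exp]
        nlinarith
      refine e1.trans ?_
      calc _ ≤ C₁ * (4 * (Real.exp 1 * Real.exp ‖w‖)) *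
            (Real.exp (2 * C₂) * Real.exp (C₂ * ‖w‖)) := by
            refine mul_le_mul (mul_le_mul_of_nonneg_left n3 hC₁.le) n5 (norm_nonneg _)
              (by positivity)
        _ = _ := by rw [add_mul, one_mul, Real.exp_add]; ring
    · refine ⟨C₁ * 1 * 4, ?_⟩
      rw [eventually_map]
      filter_upwards [eventually_ge_atTop 2] with x hx
      have e1 := h₁ (1 / 2 + (x : ℂ)) (by simp; linarith)
      refine e1.trans ?_
      have n1 : ‖(1 / 2 + x - d : ℂ)‖ / (1 / 2 + x - d : ℂ).re ≤ 1 := by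
        have : (1 / 2 + x - d : ℂ) = ((1 / 2 + x - d : ℝ) : ℂ) := by push_cast; ring
        rw [this, norm_real, ofReal_re, Real.norm_of_nonneg (by linarith)]
        exact div_self_le_one _
      have n2 : ‖(DirichletCharacter.LFunction χ (1 / 2 + x + d))⁻¹‖ ≤ 4 := by
        have := norm_LFunction_ge χ (s := 1 / 2 + x + d) (by simp; linarith)
        rw [norm_inv, inv_le_comm₀ (by linarith) (by norm_num)]
        linarith
      exact mul_le_mul (mul_le_mul_of_nonneg_left n1 hC₁.le) n2 (norm_nonneg _) (by positivity)
    · intro u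
      have e1 : (1 / 2 + u * I - d : ℂ) = 1 - (starRingEnd ℂ) (1 / 2 + u * I + d) := by
        apply Complex.ext
        · simp; ring
        · simp
      simp only [hF]
      rw [norm_div, e1, norm_completedLFunction_one_sub_conj hp hχ, mul_div_assoc, div_self]
      · simp
      · exact norm_ne_zero_iff.mpr (hne _ (by simp))
  have h := hmain (s - 1 / 2) (by simp; linarith)
  simp only [hF, add_sub_cancel] at h
  have hne' := hne (s - 1 / 2) (by simp; linarith)
  rw [add_sub_cancel] at hne'
  rwa [norm_div, div_le_iff₀ (norm_pos_iff.mpr hne')] at h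

theorem logDeriv_Gammaℝ {s : ℂ} (hs : 0 < s.re) :
    DifferentiableAt ℂ Gammaℝ s ∧ logDeriv Gammaℝ s = -(Real.log π : ℂ) / 2 + digamma (s / 2) / 2 := by
  have hπ : (π : ℂ) ≠ 0 := by exact_mod_cast pi_ne_zero
  have hs2 : 0 < (s / 2).re := by simp; linarith
  have hG : Complex.Gamma (s / 2) ≠ 0 := Complex.Gamma_ne_zero_of_re_pos hs2
  have h1 : HasDerivAt (fun w : ℂ => (π : ℂ) ^ (-w / 2))
      ((π : ℂ) ^ (-s / 2) * Complex.log π * (-1 / 2)) s :=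
    HasDerivAt.const_cpow ((hasDerivAt_id s).neg.div_const 2) (Or.inl hπ)
  have h2 : HasDerivAt (fun w : ℂ => Complex.Gamma (w / 2))
      (deriv Complex.Gamma (s / 2) * (1 / 2)) s := by
    refine HasDerivAt.comp s (h₂ := Complex.Gamma) ?_ ((hasDerivAt_id s).div_const 2)
    refine (Complex.differentiableAt_Gamma _ fun m h => ?_).hasDerivAt
    rw [h] at hs2
    simp at hs2
    linarith [(Nat.cast_nonneg m : (0 : ℝ) ≤ m)]
  have h3 : HasDerivAt Gammaℝ _ s := h1.mul h2
  refine ⟨h3.differentiableAt, ?_⟩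
  rw [logDeriv_apply, h3.deriv, digamma_def, logDeriv_apply, Gammaℝ_def, ofReal_log Real.pi_pos.le]
  have : (π : ℂ) ^ (-s / 2) ≠ 0 := by simp [cpow_eq_zero_iff, hπ]
  field_simp

theorem re_deriv_div_nonneg_of_norm_sub_le {f : ℂ → ℂ} (hf : Differentiable ℂ f) {s : ℂ}
    (hs : f s ≠ 0) {r : ℝ} (hr : 0 < r)
    (h : ∀ d : ℝ, 0 < d → d ≤ r → ‖f (s - d)‖ ≤ ‖f (s + d)‖) : 0 ≤ (deriv f s / f s).re := by
  have h1 : HasDerivAt (fun d : ℝ => f (s + d)) (deriv f s) 0 := by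
    have : HasDerivAt (fun w : ℂ => f (s + w)) (deriv f s) ((0 : ℝ) : ℂ) := by
      refine HasDerivAt.comp_const_add s _ ?_
      simpa using (hf s).hasDerivAt
    exact this.comp_ofReal
  have h2 : HasDerivAt (fun d : ℝ => f (s - d)) (-deriv f s) 0 := by
    have : HasDerivAt (fun w : ℂ => f (s - w)) (-deriv f s) ((0 : ℝ) : ℂ) := by
      refine HasDerivAt.comp_const_sub s _ ?_
      simpa using (hf s).hasDerivAt
    exact this.comp_ofReal
  have h3 := h1.norm_sq.sub h2.norm_sq
  have h4 := h3.tendsto_slope_zero_right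
  have h5 : 0 ≤ (deriv f s * (starRingEnd ℂ) (f s)).re := by
    have h6 := ge_of_tendsto h4 (b := 0) ?_
    · simp [Complex.inner] at h6
      simp
      nlinarith
    · filter_upwards [Ioc_mem_nhdsGT hr] with d hd
      have := h d hd.1 hd.2
      simp only [Pi.sub_apply, ofReal_zero, add_zero, sub_zero, zero_add, sub_self]
      have h7 := pow_le_pow_left₀ (norm_nonneg _) this 2
      exact smul_nonneg (inv_nonneg.mpr hd.1.le) (by linarith)
  have h6 : deriv f s / f s = (deriv f s * (starRingEnd ℂ) (f s)) * ((‖f s‖ ^ 2)⁻¹ : ℝ) := by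
    rw [div_eq_mul_inv, Complex.inv_def, Complex.normSq_eq_norm_sq, mul_assoc]
  rw [h6, re_mul_ofReal]
  positivity

theorem exists_re_logDeriv_LFunction_nonneg {q : ℕ} [NeZero q] {χ : DirichletCharacter ℂ q}
    (hp : χ.IsPrimitive) (hq : 1 < q) (hχ : χ ≠ 1) (hG : GRH χ) :
    ∃ a : ℝ, (a = 0 ∨ a = 1) ∧ ∀ s : ℂ, 1 / 2 < s.re →
      0 ≤ (logDeriv (DirichletCharacter.LFunction χ) s + digamma ((s + a) / 2) / 2
        + ((Real.log q - Real.log π) / 2 : ℝ)).re := by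
  obtain ⟨a, ha, hγ, -⟩ := exists_gammaFactor_eq χ
  have ha0 : 0 ≤ a := by rcases ha with rfl | rfl <;> norm_num
  refine ⟨a, ha, fun s hs => ?_⟩
  set X := DirichletCharacter.completedLFunction χ with hX
  have hq0 : (0 : ℝ) < q := by exact_mod_cast NeZero.pos q
  have hXd : Differentiable ℂ X := DirichletCharacter.differentiable_completedLFunction hχ
  have hXs : X s ≠ 0 := completedLFunction_ne_zero hχ hG hs
  set f : ℂ → ℂ := fun w => cexp (w * (Real.log q / 2 : ℝ)) * X w with hf
  have hE : ∀ w : ℂ, HasDerivAt (fun w : ℂ => cexp (w * (Real.log q / 2 : ℝ)))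
      (cexp (w * (Real.log q / 2 : ℝ)) * (1 * (Real.log q / 2 : ℝ))) w :=
    fun w => ((hasDerivAt_id w).mul_const _).cexp
  have hfd : ∀ w : ℂ, HasDerivAt f _ w := fun w => (hE w).mul (hXd w).hasDerivAt
  have h1 := re_deriv_div_nonneg_of_norm_sub_le (f := f) (s := s)
    (fun w => (hfd w).differentiableAt) (mul_ne_zero (Complex.exp_ne_zero _) hXs)
    (by norm_num : (0 : ℝ) < 1 / 4) (fun d hd hd1 => by
      have h2 := norm_completedLFunction_sub_le hp hq hχ hG hd hd1 hs.le
      simp only [hf]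
      rw [norm_mul, norm_mul, Complex.norm_exp, Complex.norm_exp, re_mul_ofReal, re_mul_ofReal]
      have h3 : (q : ℝ) ^ d = Real.exp (Real.log q * d) := Real.rpow_def_of_pos hq0 d
      rw [h3] at h2
      refine (mul_le_mul_of_nonneg_left h2 (Real.exp_pos _).le).trans (le_of_eq ?_)
      rw [← mul_assoc, ← Real.exp_add]
      congr 2
      simp
      ring)
  rw [(hfd s).deriv] at h1
  have hL : DirichletCharacter.LFunction χ s ≠ 0 := LFunction_ne_zero_of_half_lt_re hχ hG hs
  have hGa : 0 < (s + a).re := by simp; linarith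
  have hXL : deriv X s / X s = logDeriv (DirichletCharacter.LFunction χ) s +
      (-(Real.log π : ℂ) / 2 + digamma ((s + a) / 2) / 2) := by
    rw [← (logDeriv_Gammaℝ hGa).2, ← logDeriv_apply]
    have e1 : X =ᶠ[nhds s] fun w => DirichletCharacter.LFunction χ w * Gammaℝ (w + a) := by
      filter_upwards [(isOpen_lt continuous_const continuous_re).mem_nhds
        (show s ∈ {w : ℂ | 0 < w.re} by change 0 < s.re; linarith)] with w hw
      exact completedLFunction_eq_mul ha0 hγ hw
    have hGd : DifferentiableAt ℂ Gammaℝ (s + a) := (logDeriv_Gammaℝ hGa).1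
    rw [logDeriv_apply, e1.deriv_eq, e1.eq_of_nhds, ← logDeriv_apply (fun w => _),
      logDeriv_mul (f := DirichletCharacter.LFunction χ) (g := fun w => Gammaℝ (w + a)) s hL
      (Gammaℝ_ne_zero_of_re_pos hGa) (DirichletCharacter.differentiable_LFunction hχ s)
      (hGd.comp s (differentiableAt_id.add_const _))]
    congr 1
    rw [logDeriv_apply, logDeriv_apply, deriv_comp_add_const]
  have h2 : (cexp (s * (Real.log q / 2 : ℝ)) * (1 * (Real.log q / 2 : ℝ)) * X s +
      cexp (s * (Real.log q / 2 : ℝ)) * deriv X s) / f s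
      = (Real.log q / 2 : ℝ) + deriv X s / X s := by
    simp only [hf]
    field_simp
  rw [h2, hXL] at h1
  refine h1.trans (le_of_eq ?_)
  congr 1
  push_cast
  ring

theorem Lambdax_eq {x : ℝ} (hx : 1 < x) {n : ℕ} (hn : (n : ℝ) < x ^ 2) :
    Real.log x * Lambdax x n = -(vonMangoldt n *
      (max 0 (Real.log x - Real.log n) - max 0 (2 * Real.log x - Real.log n))) := by
  rcases eq_or_ne n 0 with rfl | hn0
  · simp [Lambdax]
  have hnp : (0 : ℝ) < n := by exact_mod_cast Nat.pos_of_ne_zero hn0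
  have hl : 0 < Real.log x := Real.log_pos hx
  have h2 : Real.log n ≤ 2 * Real.log x := by
    have := Real.log_le_log hnp hn.le
    rwa [Real.log_pow, Nat.cast_ofNat] at this
  rw [max_eq_right (by linarith : 0 ≤ 2 * Real.log x - Real.log n)]
  unfold Lambdax
  split_ifs with h
  · rw [max_eq_right (by linarith [Real.log_le_log hnp h])]
    ring
  · push Not at h
    have h3 := Real.log_le_log (by linarith : 0 < x) h.le
    rw [max_eq_left (by linarith), Real.log_div (by positivity) hnp.ne', Real.log_pow]
    field_simp
    push_cast
    ring
  · exact absurd hn.le ‹_›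

theorem integral_logDeriv_LFunction_mul_selbergKernel {q : ℕ} [NeZero q]
    (χ : DirichletCharacter ℂ q) {x : ℝ} (hx : 1 < x) {s : ℂ} {c : ℝ} (hc : 1 < c)
    (hsc : s.re < c) :
    ∫ u : ℝ, logDeriv (DirichletCharacter.LFunction χ) (c + u * I) *
      selbergKernel (Real.log x) (c + u * I - s) = 2 * π * Real.log x * Dpoly χ x s := by
  set l := Real.log x with hl
  have hl0 : 0 < l := Real.log_pos hx
  set A : ℕ → ℂ := (fun n : ℕ => χ (n : ZMod q)) * fun n : ℕ => (vonMangoldt n : ℂ) with hA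
  set F : ℕ → ℝ → ℂ := fun n u => -(LSeries.term A (c + u * I) n *
    selbergKernel l (c + u * I - s)) with hF
  have hre : ∀ u : ℝ, (c + u * I : ℂ).re = c := by simp
  have hker : Integrable (fun u : ℝ => selbergKernel l (c + u * I - s)) :=
    integrable_selbergKernel_sub hsc.ne' l
  have hterm : ∀ n : ℕ, ∀ u : ℝ, F n u = -(A n * (n : ℂ) ^ (-s) *
      (cexp (-(Real.log n : ℂ) * (c + u * I - s)) * selbergKernel l (c + u * I - s))) := by
    intro n u
    simp only [hF]
    rcases eq_or_ne n 0 with rfl | hn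
    · simp [hA]
    · rw [LSeries.term_of_ne_zero hn, div_eq_mul_inv, ← cpow_neg]
      have h1 : (n : ℂ) ^ (-(c + u * I : ℂ)) = (n : ℂ) ^ (-s) *
          cexp (-(Real.log n : ℂ) * (c + u * I - s)) := by
        have hn' : (n : ℂ) ≠ 0 := by exact_mod_cast hn
        rw [cpow_def_of_ne_zero hn', cpow_def_of_ne_zero hn', ← Complex.exp_add,
          ← natCast_log]
        congr 1
        ring
      rw [h1]
      ring
  have hint : ∀ n, Integrable (F n) := by
    intro n
    simp_rw [funext (hterm n)]
    refine (Integrable.const_mul ?_ _).neg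
    have h1 := integrable_exp_mul_selbergKernel (c := c - s.re) (by linarith) l (Real.log n)
    have h2 := h1.comp_add_right (-s.im)
    refine h2.congr (Filter.Eventually.of_forall fun u => ?_)
    have : ((c - s.re : ℝ) : ℂ) + ((u + -s.im : ℝ) : ℂ) * I = c + u * I - s := by
      apply Complex.ext
      · simp
      · simp
        ring
    simp only [this]
  have hval : ∀ n, ∫ u, F n u = -(A n * (n : ℂ) ^ (-s) *
      (2 * π * ((max 0 (l - Real.log n) - max 0 (2 * l - Real.log n) : ℝ) : ℂ))) := by
    intro n
    simp_rw [funext (hterm n)]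
    rw [integral_neg, integral_const_mul, integral_exp_mul_selbergKernel_sub,
      integral_selbergKernel_right (by linarith)]
  have hnorm : ∀ n, ∫ u, ‖F n u‖ = ‖LSeries.term A c n‖ *
      ∫ u : ℝ, ‖selbergKernel l (c + u * I - s)‖ := by
    intro n
    rw [← integral_const_mul]
    congr 1
    funext u
    simp only [hF]
    rw [norm_neg, norm_mul, LSeries.norm_term_eq, LSeries.norm_term_eq, hre, ofReal_re]
  have hsum : Summable fun n => ∫ u, ‖F n u‖ := by
    simp_rw [hnorm]
    refine Summable.mul_right _ ?_
    exact (DirichletCharacter.LSeriesSummable_twist_vonMangoldt χ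
      (s := c) (by simpa using hc)).norm
  have hmain := (hasSum_integral_of_summable_integral_norm hint hsum).tsum_eq
  have hlog : ∀ u : ℝ, logDeriv (DirichletCharacter.LFunction χ) (c + u * I) *
      selbergKernel l (c + u * I - s) = ∑' n, F n u := by
    intro u
    have h1 : 1 < (c + u * I : ℂ).re := by rw [hre]; exact hc
    simp only [hF]
    rw [tsum_neg, tsum_mul_right, logDeriv_apply,
      DirichletCharacter.deriv_LFunction_eq_deriv_LSeries χ h1,
      DirichletCharacter.LFunction_eq_LSeries χ h1]
    have h2 := DirichletCharacter.LSeries_twist_vonMangoldt_eq χ h1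
    rw [LSeries] at h2
    rw [h2]
    ring
  rw [funext hlog, ← hmain, tsum_eq_sum
    (s := Finset.filter (fun n : ℕ => (n : ℝ) < x ^ 2) (Finset.range (⌈x ^ 2⌉₊ + 1)))]
  · rw [Dpoly, Finset.mul_sum]
    refine Finset.sum_congr rfl fun n hn => ?_
    have hn2 := (Finset.mem_filter.mp hn).2
    have h1 := Lambdax_eq hx hn2
    rw [hval, cpow_neg]
    simp only [hA, Pi.mul_apply]
    have h2 : (l : ℂ) * (Lambdax x n : ℂ) = -((vonMangoldt n : ℂ) *
      ((max 0 (l - Real.log n) - max 0 (2 * l - Real.log n) : ℝ) : ℂ)) := by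
      exact_mod_cast h1
    linear_combination (-2 * π * χ n * ((n : ℂ) ^ s)⁻¹) * h2
  · intro n hn
    have hn2 : x ^ 2 ≤ n := by
      by_contra hcon
      push Not at hcon
      apply hn
      rw [Finset.mem_filter, Finset.mem_range]
      refine ⟨?_, hcon⟩
      have : (n : ℝ) < (⌈x ^ 2⌉₊ + 1 : ℕ) := by
        push_cast
        linarith [Nat.le_ceil (x ^ 2)]
      exact_mod_cast this
    have h3 : 2 * l ≤ Real.log n := by
      have := Real.log_le_log (by positivity) hn2
      rwa [Real.log_pow, Nat.cast_ofNat] at this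
    rw [hval, max_eq_left (by linarith), max_eq_left (by linarith)]
    simp

/-- The logarithmic derivative of the completed L-function, up to normalization: `a` is the parity
of the character and `κ` a real constant. -/
noncomputable def completedLogDeriv {q : ℕ} [NeZero q] (χ : DirichletCharacter ℂ q) (a κ : ℝ)
    (w : ℂ) : ℂ :=
  logDeriv (DirichletCharacter.LFunction χ) w + digamma ((w + a) / 2) / 2 + (κ : ℂ)

theorem differentiableAt_digamma {z : ℂ} (hz : 0 < z.re) : DifferentiableAt ℂ digamma z := by
  have hopen : IsOpen {w : ℂ | 0 < w.re} := isOpen_lt continuous_const continuous_re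
  have h1 : DifferentiableOn ℂ Complex.Gamma {w : ℂ | 0 < w.re} := by
    intro w hw
    refine (Complex.differentiableAt_Gamma _ fun m h => ?_).differentiableWithinAt
    rw [h] at hw
    simp at hw
    linarith [(Nat.cast_nonneg m : (0 : ℝ) ≤ m)]
  have h2 : DifferentiableOn ℂ (fun w => deriv Complex.Gamma w / Complex.Gamma w)
      {w : ℂ | 0 < w.re} :=
    (h1.deriv hopen).div h1 fun w hw => Complex.Gamma_ne_zero_of_re_pos hw
  exact (h2.differentiableAt (hopen.mem_nhds hz)).congr_of_eventuallyEq
    (Filter.Eventually.of_forall fun w => by rw [digamma_def, logDeriv_apply])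

theorem differentiableOn_logDeriv_LFunction {q : ℕ} [NeZero q] {χ : DirichletCharacter ℂ q}
    (hχ : χ ≠ 1) (hG : GRH χ) :
    DifferentiableOn ℂ (logDeriv (DirichletCharacter.LFunction χ)) {w | 1 / 2 < w.re} := by
  have hopen : IsOpen {w : ℂ | 1 / 2 < w.re} := isOpen_lt continuous_const continuous_re
  have h1 := (DirichletCharacter.differentiable_LFunction hχ).differentiableOn
    (s := {w : ℂ | 1 / 2 < w.re})
  exact (h1.deriv hopen).div h1 fun w hw => LFunction_ne_zero_of_half_lt_re hχ hG hw

theorem differentiableOn_digamma_half {a : ℝ} (ha : 0 ≤ a) :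
    DifferentiableOn ℂ (fun w : ℂ => digamma ((w + a) / 2)) {w | 1 / 2 < w.re} := by
  intro w (hw : 1 / 2 < w.re)
  refine DifferentiableAt.differentiableWithinAt ?_
  refine DifferentiableAt.comp w (g := digamma) (differentiableAt_digamma ?_)
    ((differentiableAt_id.add_const _).div_const 2)
  simp
  linarith

theorem exists_norm_digamma_half_le {a : ℝ} (ha : 0 ≤ a) (ha1 : a ≤ 1) :
    ∃ C : ℝ, 0 < C ∧ ∀ w : ℂ, 1 / 2 ≤ w.re →
      ‖digamma ((w + a) / 2)‖ ≤ C * (1 + ‖w‖) ^ (1 / 2 : ℝ) := by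
  obtain ⟨C, hC⟩ := exists_norm_digamma_le (by norm_num : (0 : ℝ) < 1 / 4)
  refine ⟨max C 1 * 2, by positivity, fun w hw => ?_⟩
  refine (hC _ ?_).trans ?_
  · simp; linarith
  · have h1 : 1 + ‖(w + a) / 2‖ ≤ 2 * (1 + ‖w‖) := by
      have := norm_add_le w (a : ℂ)
      rw [norm_real, Real.norm_of_nonneg ha] at this
      rw [norm_div, Complex.norm_ofNat]
      linarith [norm_nonneg w]
    have h2 : (1 + ‖(w + a) / 2‖) ^ (1 / 2 : ℝ) ≤ 2 * (1 + ‖w‖) ^ (1 / 2 : ℝ) := by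
      refine (Real.rpow_le_rpow (by positivity) h1 (by norm_num)).trans ?_
      rw [Real.mul_rpow (by norm_num) (by positivity)]
      refine mul_le_mul_of_nonneg_right ?_ (by positivity)
      calc (2 : ℝ) ^ (1 / 2 : ℝ) ≤ 2 ^ (1 : ℝ) :=
            Real.rpow_le_rpow_of_exponent_le (by norm_num) (by norm_num)
        _ = 2 := Real.rpow_one 2
    rw [mul_assoc]
    exact mul_le_mul (le_max_left _ _) h2 (by positivity) (by positivity)

theorem norm_logDeriv_LFunction_add_Dpoly_le_of_lt {q : ℕ} [NeZero q] {χ : DirichletCharacter ℂ q}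
    (hq : 1 < q) (hχ : χ ≠ 1) (hG : GRH χ) {a κ : ℝ} (ha : 0 ≤ a) (ha1 : a ≤ 1)
    (hpos : ∀ s : ℂ, 1 / 2 < s.re → 0 ≤ (completedLogDeriv χ a κ s).re)
    {x : ℝ} (hx : 1 < x) {b : ℝ} (hb : 1 / 2 < b) (hb1 : b ≤ 1) {s s₁ : ℂ}
    (hbs : b < s₁.re) (hss : s₁.re ≤ s.re) (him : s.im = s₁.im) :
    Real.log x * ‖logDeriv (DirichletCharacter.LFunction χ) s + Dpoly χ x s‖ ≤
      (Real.exp (-(Real.log x * (s.re - b))) + Real.exp (-(2 * Real.log x * (s.re - b)))) *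
        ((completedLogDeriv χ a κ s₁).re / (s₁.re - b)) +
      (1 - Real.exp (-(2 * Real.log x)))⁻¹ * (Real.exp (-(s.re * Real.log x)) / s.re ^ 2) := by
  set l := Real.log x with hl
  have hl0 : 0 < l := Real.log_pos hx
  have hbs' : b < s.re := hbs.trans_le hss
  obtain ⟨C₁, hC₁, h₁⟩ := exists_norm_logDeriv_LFunction_le hq hχ hG hb hb1
  obtain ⟨C₂, hC₂, h₂⟩ := exists_norm_digamma_half_le ha ha1
  set f := logDeriv (DirichletCharacter.LFunction χ) with hf
  set P : ℂ → ℂ := fun w => digamma ((w + a) / 2) with hP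
  have hfd := differentiableOn_logDeriv_LFunction hχ hG
  have hPd := differentiableOn_digamma_half ha
  have hfb : ∀ w : ℂ, b ≤ w.re → ‖f w‖ ≤ C₁ * (1 + ‖w‖) ^ (1 / 2 : ℝ) := fun w hw => (h₁ w hw).1
  have hPb : ∀ w : ℂ, b ≤ w.re → ‖P w‖ ≤ C₂ * (1 + ‖w‖) ^ (1 / 2 : ℝ) :=
    fun w hw => h₂ w (by linarith)
  have hHd : DifferentiableOn ℂ (completedLogDeriv χ a κ) {w | 1 / 2 < w.re} :=
    (hfd.add (hPd.div_const 2)).add_const _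
  have hHb : ∀ w : ℂ, b ≤ w.re → ‖completedLogDeriv χ a κ w‖ ≤
      (C₁ + C₂ + |κ|) * (1 + ‖w‖) ^ (1 / 2 : ℝ) := by
    intro w hw
    have e1 := hfb w hw
    have e2 := hPb w hw
    have e3 : 1 ≤ (1 + ‖w‖) ^ (1 / 2 : ℝ) :=
      Real.one_le_rpow (by linarith [norm_nonneg w]) (by norm_num)
    have e4 : ‖P w / 2‖ ≤ ‖P w‖ := by
      rw [norm_div, Complex.norm_ofNat]
      linarith [norm_nonneg (P w)]
    calc ‖completedLogDeriv χ a κ w‖ ≤ ‖f w‖ + ‖P w / 2‖ + ‖(κ : ℂ)‖ := norm_add₃_le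
      _ ≤ C₁ * (1 + ‖w‖) ^ (1 / 2 : ℝ) + C₂ * (1 + ‖w‖) ^ (1 / 2 : ℝ) +
          |κ| * (1 + ‖w‖) ^ (1 / 2 : ℝ) := by
          rw [norm_real, Real.norm_eq_abs]
          have := le_mul_of_one_le_right (abs_nonneg κ) e3
          linarith
      _ = _ := by ring
  have hshift := integral_mul_selbergKernel_shift hfd hb hfb hl0.le hbs'
    (c := max 1 s.re + 1) (by linarith [le_max_right 1 s.re])
  rw [integral_logDeriv_LFunction_mul_selbergKernel χ hx (c := max 1 s.re + 1)
    (by linarith [le_max_left 1 s.re]) (by linarith [le_max_right 1 s.re])] at hshift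
  have hi1 := integrable_mul_selbergKernel hHd hHb hl0.le hb le_rfl (s := s) hbs'.ne'
  have hi2 := integrable_mul_selbergKernel hPd hPb hl0.le hb le_rfl (s := s) hbs'.ne'
  have hi3 := integrable_selbergKernel_sub (b := b) (s := s) hbs'.ne l
  have hzero : ∫ u : ℝ, selbergKernel l (b + u * I - s) = 0 := by
    have h := integral_exp_mul_selbergKernel_sub b l 0 s
    rw [integral_selbergKernel_left (by linarith)] at h
    simpa [hl0.le] using h
  have hsplit : ∫ u : ℝ, f (b + u * I) * selbergKernel l (b + u * I - s) =
      (∫ u : ℝ, completedLogDeriv χ a κ (b + u * I) * selbergKernel l (b + u * I - s)) -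
      (∫ u : ℝ, P (b + u * I) * selbergKernel l (b + u * I - s)) / 2 := by
    have e1 : ∀ u : ℝ, f (b + u * I) * selbergKernel l (b + u * I - s) =
        completedLogDeriv χ a κ (b + u * I) * selbergKernel l (b + u * I - s) -
        (2⁻¹ * (P (b + u * I) * selbergKernel l (b + u * I - s)) +
          κ * selbergKernel l (b + u * I - s)) := by
      intro u
      simp only [completedLogDeriv, hP, hf]
      ring
    have i2 : Integrable fun u : ℝ => 2⁻¹ * (P (b + u * I) * selbergKernel l (b + u * I - s)) :=
      hi2.const_mul _
    have i3 : Integrable fun u : ℝ => (κ : ℂ) * selbergKernel l (b + u * I - s) := hi3.const_mul _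
    have i4 : Integrable fun u : ℝ => 2⁻¹ * (P (b + u * I) * selbergKernel l (b + u * I - s)) +
      (κ : ℂ) * selbergKernel l (b + u * I - s) := i2.add i3
    rw [funext e1, integral_sub hi1 i4, integral_add i2 i3, integral_const_mul,
      integral_const_mul, hzero]
    ring
  have hb1 := norm_integral_mul_selbergKernel_le hHd hb hHb
    (fun w hw => hpos w (by linarith)) hl0.le hbs hss him
  have hb2 := norm_integral_digamma_mul_selbergKernel_le (b := b) (l := l) (a := a) (s := s)
    hl0 ha (by linarith) hbs'
  have e : 2 * π * l * (f s + Dpoly χ x s) =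
      (∫ u : ℝ, completedLogDeriv χ a κ (b + u * I) * selbergKernel l (b + u * I - s)) -
      (∫ u : ℝ, P (b + u * I) * selbergKernel l (b + u * I - s)) / 2 := by
    rw [← hsplit, hshift]; ring
  have e2 : 2 * π * (l * ‖f s + Dpoly χ x s‖) = ‖2 * π * l * (f s + Dpoly χ x s)‖ := by
    rw [norm_mul, norm_mul, norm_mul, norm_real, norm_real, Complex.norm_ofNat,
      Real.norm_of_nonneg Real.pi_pos.le, Real.norm_of_nonneg hl0.le]
    ring
  have hpi : 0 < 2 * π := by positivity
  refine le_of_mul_le_mul_left ?_ hpi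
  rw [e2, e]
  refine (norm_sub_le _ _).trans ?_
  rw [norm_div, Complex.norm_ofNat]
  calc _ ≤ _ := add_le_add hb1 (div_le_div_of_nonneg_right hb2 zero_le_two)
    _ = _ := by ring

theorem norm_logDeriv_LFunction_add_Dpoly_le {q : ℕ} [NeZero q] {χ : DirichletCharacter ℂ q}
    (hq : 1 < q) (hχ : χ ≠ 1) (hG : GRH χ) {a κ : ℝ} (ha : 0 ≤ a) (ha1 : a ≤ 1)
    (hpos : ∀ s : ℂ, 1 / 2 < s.re → 0 ≤ (completedLogDeriv χ a κ s).re)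
    {x : ℝ} (hx : 1 < x) {s s₁ : ℂ}
    (hs₁ : 1 / 2 < s₁.re) (hss : s₁.re ≤ s.re) (him : s.im = s₁.im) :
    Real.log x * ‖logDeriv (DirichletCharacter.LFunction χ) s + Dpoly χ x s‖ ≤
      (Real.exp (-(Real.log x * (s.re - 1 / 2))) +
          Real.exp (-(2 * Real.log x * (s.re - 1 / 2)))) *
        ((completedLogDeriv χ a κ s₁).re / (s₁.re - 1 / 2)) +
      (1 - Real.exp (-(2 * Real.log x)))⁻¹ * (Real.exp (-(s.re * Real.log x)) / s.re ^ 2) := by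
  set l := Real.log x with hl
  have hcont : ContinuousAt (fun b : ℝ =>
      (Real.exp (-(l * (s.re - b))) + Real.exp (-(2 * l * (s.re - b)))) *
        ((completedLogDeriv χ a κ s₁).re / (s₁.re - b)) +
      (1 - Real.exp (-(2 * l)))⁻¹ * (Real.exp (-(s.re * l)) / s.re ^ 2)) (1 / 2) := by
    have : s₁.re - 1 / 2 ≠ 0 := by linarith
    fun_prop (disch := assumption)
  refine ge_of_tendsto (hcont.tendsto.mono_left (nhdsWithin_le_nhds (s := Set.Ioi (1 / 2)))) ?_
  filter_upwards [Ioo_mem_nhdsGT (lt_min hs₁ (by norm_num : (1 : ℝ) / 2 < 1))] with b hb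
  exact norm_logDeriv_LFunction_add_Dpoly_le_of_lt hq hχ hG ha ha1 hpos hx hb.1
    (hb.2.le.trans (min_le_right _ _)) (hb.2.trans_le (min_le_left _ _)) hss him

theorem Lambdax_eq_zero_of_lt_two {x : ℝ} {n : ℕ} (hn : n < 2) : Lambdax x n = 0 := by
  have : vonMangoldt n = 0 := by interval_cases n <;> simp
  simp [Lambdax, this]

theorem integral_natCast_cpow_neg {n : ℕ} (hn : 2 ≤ n) (t σ₁ : ℝ) :
    IntegrableOn (fun σ : ℝ => ((n : ℂ) ^ (σ + t * I : ℂ))⁻¹) (Set.Ioi σ₁) ∧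
      ∫ σ in Set.Ioi σ₁, ((n : ℂ) ^ ((σ : ℝ) + t * I : ℂ))⁻¹ =
        ((n : ℂ) ^ (σ₁ + t * I : ℂ) * (Real.log n : ℂ))⁻¹ := by
  have hn0 : (n : ℂ) ≠ 0 := by exact_mod_cast (by omega : n ≠ 0)
  have hn1 : (1 : ℝ) < n := by exact_mod_cast (by omega : 1 < n)
  have hlog : 0 < Real.log n := Real.log_pos hn1
  have h1 : ∀ σ : ℝ, ((n : ℂ) ^ (σ + t * I : ℂ))⁻¹ =
      cexp (-(Real.log n : ℂ) * (t * I)) * cexp (-(Real.log n : ℂ) * σ) := by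
    intro σ
    rw [← cpow_neg, cpow_def_of_ne_zero hn0, ← Complex.exp_add, ← natCast_log]
    congr 1
    ring
  have hre : (-(Real.log n : ℂ)).re < 0 := by rw [neg_re, ofReal_re]; linarith
  simp_rw [h1]
  refine ⟨(integrableOn_exp_mul_complex_Ioi hre σ₁).const_mul _, ?_⟩
  rw [integral_const_mul, integral_exp_mul_complex_Ioi hre, mul_inv, h1]
  have : (Real.log n : ℂ) ≠ 0 := by exact_mod_cast hlog.ne'
  field_simp

theorem integral_Dpoly {q : ℕ} [NeZero q] (χ : DirichletCharacter ℂ q) (x t σ₁ : ℝ) :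
    IntegrableOn (fun σ : ℝ => Dpoly χ x (σ + t * I)) (Set.Ioi σ₁) ∧
      ∫ σ in Set.Ioi σ₁, Dpoly χ x ((σ : ℝ) + t * I) =
        ∑ n ∈ Finset.filter (fun n : ℕ => (n : ℝ) < x ^ 2) (Finset.range (⌈x ^ 2⌉₊ + 1)),
          (Lambdax x n : ℂ) * χ n / ((n : ℂ) ^ ((σ₁ : ℂ) + t * I) * (Real.log n : ℂ)) := by
  have hterm : ∀ n : ℕ,
      IntegrableOn (fun σ : ℝ => (Lambdax x n : ℂ) * χ n / (n : ℂ) ^ (σ + t * I : ℂ))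
        (Set.Ioi σ₁) ∧
      ∫ σ in Set.Ioi σ₁, (Lambdax x n : ℂ) * χ n / (n : ℂ) ^ ((σ : ℝ) + t * I : ℂ) =
        (Lambdax x n : ℂ) * χ n / ((n : ℂ) ^ ((σ₁ : ℂ) + t * I) * (Real.log n : ℂ)) := by
    intro n
    by_cases hn : n < 2
    · simp [Lambdax_eq_zero_of_lt_two hn]
    · have h := integral_natCast_cpow_neg (not_lt.mp hn) t σ₁
      simp_rw [div_eq_mul_inv]
      exact ⟨h.1.const_mul _, by rw [integral_const_mul, h.2]⟩
  constructor
  · exact integrable_finsetSum _ fun n _ => (hterm n).1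
  · unfold Dpoly
    rw [integral_finsetSum _ fun n _ => (hterm n).1]
    exact Finset.sum_congr rfl fun n _ => (hterm n).2

theorem lt_log_of_four_le {x : ℝ} (hx : 4 ≤ x) : 1.38 < Real.log x := by
  have h1 := Real.log_le_log (by norm_num) hx
  have h2 : Real.log 4 = 2 * Real.log 2 := by
    rw [show (4 : ℝ) = 2 ^ 2 by norm_num, Real.log_pow]; norm_num
  have := Real.log_two_gt_d9
  linarith

theorem re_digamma_half_le {σ a t : ℝ} (hσ : 1 / 2 ≤ σ) (hσ1 : σ ≤ 1.24) (ha : 0 ≤ a)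
    (ha1 : a ≤ 1) (ht : 2 ≤ t) :
    (digamma (((σ + t * I : ℂ) + a) / 2)).re ≤ Real.log π + Real.log (t + 1) - 0.6 := by
  set z : ℂ := ((σ + t * I : ℂ) + a) / 2 with hz
  have hzre : z.re = (σ + a) / 2 := by simp [hz]
  have hzim : z.im = t / 2 := by simp [hz]
  have hz0 : 0 < z.re := by rw [hzre]; linarith
  have h1 : digamma (z + 1) = digamma z + 1 / z := by
    have := Complex.digamma_apply_add_one z (fun m h => by
      rw [h] at hz0
      simp at hz0
      linarith [(Nat.cast_nonneg m : (0 : ℝ) ≤ m)])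
    simpa using this
  have h2 : 0 ≤ (1 / z).re := by
    rw [one_div, inv_re]
    exact div_nonneg hz0.le (normSq_nonneg _)
  have h3 := re_digamma_le (z := z + 1) (by simp; linarith)
  rw [h1, add_re, add_re, one_re] at h3
  have h4 : (1 / 2) / (z.re + 1) ≤ 0.4 := by
    rw [div_le_iff₀ (by linarith), hzre]
    linarith
  have h5 : ‖z + 1‖ ≤ 2.12 + t / 2 := by
    refine (norm_le_abs_re_add_abs_im _).trans ?_
    rw [add_re, add_im, one_re, one_im, add_zero, hzim, hzre,
      abs_of_nonneg (by linarith), abs_of_nonneg (by linarith)]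
    linarith
  have h6 : Real.log ‖z + 1‖ ≤ Real.log (2.12 + t / 2) := by
    refine Real.log_le_log ?_ h5
    have := re_le_norm (z + 1)
    rw [add_re, one_re] at this
    linarith
  have h7 : Real.log (2.12 + t / 2) + 1 ≤ Real.log π + Real.log (t + 1) := by
    have e1 : Real.log (2.12 + t / 2) + 1 = Real.log ((2.12 + t / 2) * Real.exp 1) := by
      rw [Real.log_mul (by positivity) (Real.exp_ne_zero _), Real.log_exp]
    rw [e1, ← Real.log_mul Real.pi_pos.ne' (by positivity)]
    refine Real.log_le_log (by positivity) ?_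
    have := Real.exp_one_lt_d9
    have := Real.pi_gt_d2
    nlinarith
  linarith

/-- The contribution of the trivial zeros at the edge of the range of integration. -/
theorem exp_neg_div_sq_le {l : ℝ} (hl : 1.38 < l) :
    (1 - Real.exp (-(2 * l)))⁻¹ * (Real.exp (-((1 / 2 + 1 / l) * l)) / (1 / 2 + 1 / l) ^ 2)
      ≤ 0.11 * l := by
  have hl0 : 0 < l := by linarith
  have e1 : Real.exp (-1) < 0.3679 := by
    rw [Real.exp_neg, inv_lt_comm₀ (Real.exp_pos _) (by norm_num)]
    have := Real.exp_one_gt_d9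
    norm_num at this ⊢
    linarith
  have e69 : Real.exp (-(l / 2)) < 0.51 := by
    have h1 : Real.exp (-(l / 2)) < Real.exp (-0.69) := by
      rw [Real.exp_lt_exp]; linarith
    have h2 : Real.exp (-0.69) ≤ Real.exp (-Real.log 2) * Real.exp 0.0032 := by
      rw [← Real.exp_add, Real.exp_le_exp]
      have := Real.log_two_lt_d9
      linarith
    have h3 : Real.exp (-Real.log 2) = 1 / 2 := by
      rw [Real.exp_neg, Real.exp_log (by norm_num)]; norm_num
    have h4 : Real.exp 0.0032 < 1.01 := by
      have := Real.exp_bound_div_one_sub_of_interval (x := 0.0032) (by norm_num) (by norm_num)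
      norm_num at this ⊢
      linarith
    rw [h3] at h2
    linarith
  have h1 : (1 - Real.exp (-(2 * l)))⁻¹ ≤ 1.08 := by
    have h2 : Real.exp (-(2 * l)) = Real.exp (-(l / 2)) ^ 4 := by
      rw [← Real.exp_nat_mul]; congr 1; push_cast; ring
    have h3 : Real.exp (-(l / 2)) ^ 4 ≤ 0.51 ^ 4 :=
      pow_le_pow_left₀ (Real.exp_pos _).le e69.le 4
    rw [h2, inv_le_comm₀ (by norm_num at h3 ⊢; linarith) (by norm_num)]
    norm_num at h3 ⊢
    linarith
  have h2 : Real.exp (-((1 / 2 + 1 / l) * l)) ≤ 0.51 * 0.3679 := by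
    have : -((1 / 2 + 1 / l) * l) = -(l / 2) + -1 := by field_simp; ring
    rw [this, Real.exp_add]
    exact mul_le_mul e69.le e1.le (Real.exp_pos _).le (by norm_num)
  have h3 : 2 ≤ (1 / 2 + 1 / l) ^ 2 * l := by
    have : (1 / 2 + 1 / l) ^ 2 * l - 2 = (l / 2 - 1) ^ 2 / l := by field_simp; ring
    have h4 : 0 ≤ (l / 2 - 1) ^ 2 / l := by positivity
    linarith
  have h4 : Real.exp (-((1 / 2 + 1 / l) * l)) / (1 / 2 + 1 / l) ^ 2 ≤ 0.1 * l := by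
    rw [div_le_iff₀ (by positivity)]
    nlinarith
  calc _ ≤ 1.08 * (0.1 * l) := mul_le_mul h1 h4 (by positivity) (by norm_num)
    _ ≤ 0.11 * l := by linarith

theorem integral_exp_neg_mul_sub_Ioi {b : ℝ} (hb : 0 < b) (c σ₁ : ℝ) :
    IntegrableOn (fun σ : ℝ => Real.exp (-(b * (σ - c)))) (Set.Ioi σ₁) ∧
      ∫ σ in Set.Ioi σ₁, Real.exp (-(b * (σ - c))) = Real.exp (-(b * (σ₁ - c))) / b := by
  have h1 : ∀ σ : ℝ, Real.exp (-(b * (σ - c))) = Real.exp (b * c) * Real.exp (-b * σ) := by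
    intro σ
    rw [← Real.exp_add]
    congr 1
    ring
  have hb' : -b < 0 := by linarith
  simp_rw [h1]
  refine ⟨(integrableOn_exp_mul_Ioi hb' σ₁).const_mul _, ?_⟩
  rw [integral_const_mul, integral_exp_mul_Ioi hb']
  field_simp

theorem norm_integral_Ioi_le_of_norm_le_exp {g : ℝ → ℂ} {l F K σ₁ : ℝ} (hl : 0 < l)
    (hg : AEStronglyMeasurable g (volume.restrict (Set.Ioi σ₁)))
    (h : ∀ σ ∈ Set.Ioi σ₁, ‖g σ‖ ≤ F * (Real.exp (-(l * (σ - 1 / 2))) +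
      Real.exp (-(2 * l * (σ - 1 / 2)))) + K * Real.exp (-(l * (σ - 0)))) :
    IntegrableOn g (Set.Ioi σ₁) ∧ ‖∫ σ in Set.Ioi σ₁, g σ‖ ≤
      F * (Real.exp (-(l * (σ₁ - 1 / 2))) / l + Real.exp (-(2 * l * (σ₁ - 1 / 2))) / (2 * l)) +
        K * (Real.exp (-(l * (σ₁ - 0))) / l) := by
  obtain ⟨i1, v1⟩ := integral_exp_neg_mul_sub_Ioi hl (1 / 2) σ₁
  obtain ⟨i2, v2⟩ := integral_exp_neg_mul_sub_Ioi (show 0 < 2 * l by linarith) (1 / 2) σ₁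
  obtain ⟨i3, v3⟩ := integral_exp_neg_mul_sub_Ioi hl 0 σ₁
  have i12 := (i1.add i2).const_mul F
  have i4 := i12.add (i3.const_mul K)
  have hae := (ae_restrict_iff' (μ := volume) measurableSet_Ioi).2 (Filter.Eventually.of_forall h)
  refine ⟨Integrable.mono' i4 hg hae, (norm_integral_le_of_norm_le i4 hae).trans_eq ?_⟩
  calc _ = (∫ σ in Set.Ioi σ₁, F * (Real.exp (-(l * (σ - 1 / 2))) +
        Real.exp (-(2 * l * (σ - 1 / 2))))) +
        ∫ σ in Set.Ioi σ₁, K * Real.exp (-(l * (σ - 0))) := integral_add i12 (i3.const_mul K)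
    _ = _ := by
      rw [integral_const_mul, integral_const_mul, integral_add i1 i2, v1, v2, v3]

theorem DirichletCharacter.IsPrimitive.ne_one_of_one_lt {q : ℕ} [NeZero q]
    {χ : DirichletCharacter ℂ q} (hp : χ.IsPrimitive) (hq : 1 < q) : χ ≠ 1 := by
  rintro rfl
  have : (1 : DirichletCharacter ℂ q).conductor = 1 := DirichletCharacter.conductor_one
  rw [DirichletCharacter.IsPrimitive] at hp
  omega

theorem aestronglyMeasurable_logDeriv_LFunction_add_Dpoly {q : ℕ} [NeZero q]
    {χ : DirichletCharacter ℂ q} (hχ : χ ≠ 1) (hG : GRH χ) {x t σ₁ : ℝ} (hσ₁ : 1 / 2 < σ₁) :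
    AEStronglyMeasurable (fun σ : ℝ => logDeriv (DirichletCharacter.LFunction χ) (σ + t * I) +
      Dpoly χ x (σ + t * I)) (volume.restrict (Set.Ioi σ₁)) := by
  refine AEStronglyMeasurable.add (ContinuousOn.aestronglyMeasurable ?_ measurableSet_Ioi)
    (integral_Dpoly χ x t σ₁).1.aestronglyMeasurable
  refine (differentiableOn_logDeriv_LFunction hχ hG).continuousOn.comp
    (by fun_prop : Continuous fun σ : ℝ => (σ + t * I : ℂ)).continuousOn fun σ hσ => ?_
  have : σ₁ < σ := hσ
  simp
  linarith

theorem remainder_constant_le {F G D L : ℝ} (hG : G ≤ L / 2 - 0.3)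
    (h : F ≤ G + D + (1 / Real.exp 1 + 1 / Real.exp 1 ^ 2) * F + 0.11) :
    (1 / Real.exp 1 + 1 / (2 * Real.exp 1 ^ 2)) * F + 0.11 ≤
      ((1 / Real.exp 1 + 1 / (2 * (Real.exp 1) ^ 2))
        / (1 - (1 / Real.exp 1) * (1 + 1 / Real.exp 1))) * (L / 2 + D) := by
  have e1 := Real.exp_one_gt_d9
  have e2 := Real.exp_one_lt_d9
  set e := 1 / Real.exp 1 with he
  have h1 : e < 0.3679 := by
    rw [he, div_lt_iff₀ (Real.exp_pos _)]; norm_num at e1 ⊢; linarith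
  have h2 : 0.3678 < e := by
    rw [he, lt_div_iff₀ (Real.exp_pos _)]; norm_num at e2 ⊢; linarith
  have h3 : 1 / Real.exp 1 ^ 2 = e ^ 2 := by rw [he]; ring
  have h4 : 1 / (2 * Real.exp 1 ^ 2) = e ^ 2 / 2 := by rw [he]; ring
  rw [h3] at h
  rw [h4]
  have hden : 0 < 1 - e * (1 + e) := by nlinarith
  rw [div_mul_eq_mul_div, le_div_iff₀ hden]
  have h5 : F * (1 - e * (1 + e)) ≤ L / 2 + D - 0.19 := by linarith
  have h6 : 0 < e + e ^ 2 / 2 := by positivity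
  have h7 := mul_le_mul_of_nonneg_left h5 h6.le
  nlinarith

theorem norm_integral_logDeriv_LFunction_add_Dpoly_le {q : ℕ} [NeZero q]
    {χ : DirichletCharacter ℂ q} (hq : 1 < q) (hp : χ.IsPrimitive) (hG : GRH χ)
    {t x : ℝ} (ht : 2 ≤ t) (hx : 4 ≤ x) :
    IntegrableOn (fun σ : ℝ => logDeriv (DirichletCharacter.LFunction χ) (σ + t * I) +
        Dpoly χ x (σ + t * I)) (Set.Ioi (1 / 2 + 1 / Real.log x)) ∧
      ‖∫ σ in Set.Ioi (1 / 2 + 1 / Real.log x), (logDeriv (DirichletCharacter.LFunction χ)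
        ((σ : ℝ) + t * I) + Dpoly χ x ((σ : ℝ) + t * I))‖ ≤
      ((1 / Real.exp 1 + 1 / (2 * (Real.exp 1) ^ 2))
        / (1 - (1 / Real.exp 1) * (1 + 1 / Real.exp 1))) *
        (Real.log (q * (t + 1)) / 2 +
          ‖Dpoly χ x ((1 / 2 + 1 / Real.log x : ℝ) + t * I)‖) / Real.log x := by
  have hχ := hp.ne_one_of_one_lt hq
  obtain ⟨a, ha, hpos⟩ := exists_re_logDeriv_LFunction_nonneg hp hq hχ hG
  have ha0 : 0 ≤ a := by rcases ha with rfl | rfl <;> norm_num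
  have ha1 : a ≤ 1 := by rcases ha with rfl | rfl <;> norm_num
  have hl := lt_log_of_four_le hx
  have hx1 : 1 < x := by linarith
  set l := Real.log x with hldef
  have hl0 : 0 < l := by linarith
  set κ : ℝ := (Real.log q - Real.log π) / 2 with hκ
  set σ₁ : ℝ := 1 / 2 + 1 / l with hσ₁
  have hinv : 0 < 1 / l := by positivity
  have hσ₁' : 1 / 2 < σ₁ := by linarith
  have hσ₁1 : σ₁ ≤ 1.24 := by
    have : 1 / l ≤ 0.74 := by rw [div_le_iff₀ hl0]; linarith
    linarith
  set s₁ : ℂ := (σ₁ : ℂ) + t * I with hs₁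
  have hre : ∀ σ : ℝ, ((σ : ℂ) + t * I).re = σ := by intro σ; simp
  have him : ∀ σ : ℝ, ((σ : ℂ) + t * I).im = t := by intro σ; simp
  set F : ℝ := (completedLogDeriv χ a κ s₁).re with hF
  set T : ℝ := (1 - Real.exp (-(2 * l)))⁻¹ * (Real.exp (-(σ₁ * l)) / σ₁ ^ 2) with hT
  have hTle : T ≤ 0.11 * l := exp_neg_div_sq_le hl
  have hinv0 : 0 ≤ (1 - Real.exp (-(2 * l)))⁻¹ := by
    rw [inv_nonneg, sub_nonneg, Real.exp_le_one_iff]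
    linarith
  have hpos' : ∀ s : ℂ, 1 / 2 < s.re → 0 ≤ (completedLogDeriv χ a κ s).re := hpos
  have hdiv : F / (σ₁ - 1 / 2) = F * l := by rw [hσ₁]; field_simp; ring
  have key : ∀ σ : ℝ, σ₁ ≤ σ →
      l * ‖logDeriv (DirichletCharacter.LFunction χ) (σ + t * I) + Dpoly χ x (σ + t * I)‖ ≤
        (Real.exp (-(l * (σ - 1 / 2))) + Real.exp (-(2 * l * (σ - 1 / 2)))) * (F * l) +
        (1 - Real.exp (-(2 * l)))⁻¹ * (Real.exp (-(σ * l)) / σ ^ 2) := by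
    intro σ hσ
    have := norm_logDeriv_LFunction_add_Dpoly_le hq hχ hG ha0 ha1 hpos' hx1
      (s := (σ : ℂ) + t * I) (s₁ := s₁) (by rw [hs₁, hre]; exact hσ₁')
      (by rw [hs₁, hre, hre]; exact hσ) (by rw [hs₁, him, him])
    rwa [hre, hs₁, hre, ← hs₁, ← hF, hdiv] at this
  have hlσ : l * (σ₁ - 1 / 2) = 1 := by rw [hσ₁]; field_simp; ring
  have hlσ2 : 2 * l * (σ₁ - 1 / 2) = 2 := by rw [mul_assoc, hlσ]; norm_num
  have hexp1 : Real.exp (-1) = 1 / Real.exp 1 := by rw [Real.exp_neg, one_div]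
  have hexp2 : Real.exp (-2) = 1 / Real.exp 1 ^ 2 := by
    rw [← Real.exp_nat_mul, Real.exp_neg, one_div]; norm_num
  have hFle : F ≤ (Real.log (q * (t + 1)) / 2 - 0.3) + ‖Dpoly χ x s₁‖ +
      (1 / Real.exp 1 + 1 / Real.exp 1 ^ 2) * F + 0.11 := by
    have h1 := key σ₁ le_rfl
    rw [hlσ, hlσ2, hexp1, hexp2, ← hs₁, ← hT] at h1
    have h2 : ‖logDeriv (DirichletCharacter.LFunction χ) s₁ + Dpoly χ x s₁‖ ≤
        (1 / Real.exp 1 + 1 / Real.exp 1 ^ 2) * F + 0.11 := by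
      refine le_of_mul_le_mul_left (h1.trans ?_) hl0
      linarith
    have h3 := re_digamma_half_le hσ₁'.le hσ₁1 ha0 ha1 ht
    have h4 : F = (logDeriv (DirichletCharacter.LFunction χ) s₁).re +
        (digamma ((s₁ + a) / 2)).re / 2 + κ := by
      rw [hF, completedLogDeriv, add_re, add_re, ofReal_re]
      congr 2
      exact Complex.div_ofNat_re _ 2
    have h5 := (Complex.re_le_norm (logDeriv (DirichletCharacter.LFunction χ) s₁ +
      Dpoly χ x s₁)).trans h2
    have h6 := (abs_le.1 (Complex.abs_re_le_norm (Dpoly χ x s₁))).1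
    have hq0 : (0 : ℝ) < q := by exact_mod_cast (by omega : 0 < q)
    have h7 : Real.log (q * (t + 1)) = Real.log q + Real.log (t + 1) :=
      Real.log_mul hq0.ne' (by linarith)
    rw [add_re] at h5
    rw [← hs₁] at h3
    rw [h7]
    linarith
  have hconst := remainder_constant_le le_rfl hFle
  obtain ⟨hint, hbound⟩ := norm_integral_Ioi_le_of_norm_le_exp (F := F)
    (K := (1 - Real.exp (-(2 * l)))⁻¹ / (σ₁ ^ 2 * l)) hl0
    (aestronglyMeasurable_logDeriv_LFunction_add_Dpoly hχ hG (x := x) (t := t) hσ₁') (by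
      intro σ hσ
      have hσ : σ₁ < σ := hσ
      have h1 := key σ hσ.le
      refine le_of_mul_le_mul_left (h1.trans ?_) hl0
      have h2 : Real.exp (-(σ * l)) / σ ^ 2 ≤ Real.exp (-(σ * l)) / σ₁ ^ 2 := by
        have : 0 < σ₁ := by linarith
        gcongr
      have h3 := mul_le_mul_of_nonneg_left h2 hinv0
      refine (add_le_add_right h3 _).trans_eq ?_
      rw [sub_zero, mul_comm l σ]
      have : σ₁ ≠ 0 := by linarith
      field_simp)
  refine ⟨hint, hbound.trans ?_⟩
  rw [hlσ, hlσ2, hexp1, hexp2, sub_zero]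
  rw [le_div_iff₀ hl0]
  refine le_trans ?_ hconst
  have h8 : (1 - Real.exp (-(2 * l)))⁻¹ / (σ₁ ^ 2 * l) * (Real.exp (-(l * σ₁)) / l) * l = T / l := by
    rw [hT, mul_comm l σ₁]
    have : σ₁ ≠ 0 := by linarith
    field_simp
  have h9 : T / l ≤ 0.11 := by rw [div_le_iff₀ hl0]; exact hTle
  rw [add_mul, h8]
  refine add_le_add (le_of_eq ?_) h9
  field_simp

theorem M1_estimate :
    ∃ C : ℝ, 0 < C ∧
      ∀ (q : ℕ) [NeZero q] (χ : DirichletCharacter ℂ q), 1 < q → χ.IsPrimitive → GRH χ →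
        ∀ t : ℝ, 2 ≤ t → ∀ x : ℝ, 4 ≤ x → x ≤ t ^ 2 →
          ∃ η₁ : ℂ,
            (∫ sg in Set.Ioi (1 / 2 + 1 / Real.log x : ℝ),
                logDeriv (DirichletCharacter.LFunction χ) ((sg : ℝ) + t * Complex.I))
              = -(∑ n ∈ Finset.filter (fun n : ℕ => (n : ℝ) < x ^ 2)
                      (Finset.range (⌈x ^ 2⌉₊ + 1)),
                    (Lambdax x n : ℂ) * χ n /
                      ((n : ℂ) ^ (((1 / 2 + 1 / Real.log x : ℝ) : ℂ) + t * Complex.I)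
                        * (Real.log n : ℂ)))
                + η₁
            ∧ ‖η₁‖ ≤ ((1 / Real.exp 1 + 1 / (2 * (Real.exp 1) ^ 2))
                        / (1 - (1 / Real.exp 1) * (1 + 1 / Real.exp 1)))
                      * (1 / 2) * (Real.log (q * (t + 1)) / Real.log x)
                + C * (1 / Real.log x)
                    * ‖Dpoly χ x ((1 / 2 + 1 / Real.log x : ℝ) + t * Complex.I)‖ := by
  have hden : 0 < 1 - (1 / Real.exp 1) * (1 + 1 / Real.exp 1) := by
    have h1 : 1 / Real.exp 1 < 0.5 := by
      rw [div_lt_iff₀ (Real.exp_pos _)]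
      linarith [Real.exp_one_gt_d9]
    have h2 : 0 < 1 / Real.exp 1 := by positivity
    generalize 1 / Real.exp 1 = e at h1 h2 ⊢
    norm_num at h1
    nlinarith
  refine ⟨(1 / Real.exp 1 + 1 / (2 * (Real.exp 1) ^ 2))
    / (1 - (1 / Real.exp 1) * (1 + 1 / Real.exp 1)), by positivity, ?_⟩
  intro q _ χ hq hp hG t ht x hx _
  obtain ⟨hint, hbound⟩ := norm_integral_logDeriv_LFunction_add_Dpoly_le hq hp hG ht hx
  obtain ⟨hDint, hD⟩ := integral_Dpoly χ x t (1 / 2 + 1 / Real.log x)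
  refine ⟨_, ?_, hbound.trans_eq (by ring)⟩
  rw [← hD, neg_add_eq_sub, ← integral_sub hint hDint]
  simp
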